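/- arXiv:0909.1663 — 7 statements merged into one kernel-verified Lean document; each statement's English description precedes it below -/
import Mathlib

section
/- Let D be an integer and p > 5 a prime not dividing D. Then there exists a nonzero tuple (x₀,…,x₄) ∈ ℚ_p⁵ satisfying x₀² − 2x₁² + x₂² = 0, x₁² − 2x₂² + D·x₃² = 0 and x₂² − 2D·x₃² + x₄² = 0 (i.e. C_D(ℚ_p) ≠ ∅). -/
/-- The sign pattern needed on an arithmetic progression. -/
def CDPat (f : ℤ → ℤ) : Prop :=
  ∃ a d s : ℤ, (s = 1 ∨ s = -1) ∧ (a = 0 ∨ f a = s) ∧ (a + d = 0 ∨ f (a + d) = s) ∧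
    (a + 2 * d = 0 ∨ f (a + 2 * d) = s) ∧ f (a + 3 * d) = -s ∧
    (a + 4 * d = 0 ∨ f (a + 4 * d) = s)

lemma CD_exists_min (f g : ℤ → ℤ) (fm : ∀ a b, f (a * b) = f a * f b)
    (gm : ∀ a b, g (a * b) = g a * g b) (f1 : f 1 = 1) (g1 : g 1 = 1)
    (k : ℕ) (hk : 0 < k) (hgk : g k ≠ 0) (hfk : f k ≠ g k) :
    ∃ n : ℕ, n ≤ k ∧ n.Prime ∧ g n ≠ 0 ∧ f n ≠ g n ∧
      ∀ m : ℤ, 0 < m → m < n → g m ≠ 0 → f m = g m := by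
  classical
  have hex : ∃ n : ℕ, 0 < n ∧ g n ≠ 0 ∧ f n ≠ g n := ⟨k, hk, hgk, hfk⟩
  obtain ⟨h0, hg, hf⟩ := Nat.find_spec hex
  have hmin : ∀ m : ℤ, 0 < m → m < (Nat.find hex : ℕ) → g m ≠ 0 → f m = g m := by
    intro m hm hlt hgm
    lift m to ℕ using hm.le
    by_contra hne
    exact Nat.find_min hex (by exact_mod_cast hlt) ⟨by exact_mod_cast hm, hgm, hne⟩
  refine ⟨Nat.find hex, Nat.find_min' hex ⟨hk, hgk, hfk⟩, ?_, hg, hf, hmin⟩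
  set n := Nat.find hex with hn
  by_contra hnp
  have hn1 : n ≠ 1 := by
    intro h
    rw [h] at hf
    simp [f1, g1] at hf
  obtain ⟨a, b, ha, hb, hab⟩ := (Nat.not_prime_iff_exists_mul_eq (by omega)).1 hnp
  have e : (n : ℤ) = (a : ℤ) * b := by rw [← hab]; push_cast; ring
  have ha0 : 0 < a := Nat.pos_of_ne_zero (by rintro rfl; omega)
  have hb0 : 0 < b := Nat.pos_of_ne_zero (by rintro rfl; omega)
  rw [e, gm] at hg
  rw [e, gm, fm] at hf
  apply hf
  rw [hmin a (by exact_mod_cast ha0) (by exact_mod_cast ha) (left_ne_zero_of_mul hg),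
    hmin b (by exact_mod_cast hb0) (by exact_mod_cast hb) (right_ne_zero_of_mul hg)]

/-- quadratic character modulo 3 -/
def CDg3 (m : ℤ) : ℤ := if m % 3 = 0 then 0 else if m % 3 = 1 then 1 else -1

/-- quadratic character modulo 5 -/
def CDg5 (m : ℤ) : ℤ :=
  if m % 5 = 0 then 0 else if m % 5 = 1 ∨ m % 5 = 4 then 1 else -1

lemma CDg3_mul (a b : ℤ) : CDg3 (a * b) = CDg3 a * CDg3 b := by
  unfold CDg3
  have ha : a % 3 = 0 ∨ a % 3 = 1 ∨ a % 3 = 2 := by omega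
  have hb : b % 3 = 0 ∨ b % 3 = 1 ∨ b % 3 = 2 := by omega
  rcases ha with h | h | h <;> rcases hb with h' | h' | h' <;> simp [Int.mul_emod, h, h']

lemma CDg5_mul (a b : ℤ) : CDg5 (a * b) = CDg5 a * CDg5 b := by
  unfold CDg5
  have ha : a % 5 = 0 ∨ a % 5 = 1 ∨ a % 5 = 2 ∨ a % 5 = 3 ∨ a % 5 = 4 := by omega
  have hb : b % 5 = 0 ∨ b % 5 = 1 ∨ b % 5 = 2 ∨ b % 5 = 3 ∨ b % 5 = 4 := by omega
  rcases ha with h | h | h | h | h <;> rcases hb with h' | h' | h' | h' | h' <;>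
    simp [Int.mul_emod, h, h']

/-- Case 1: `2` is a residue; use the least nonresidue. -/
lemma CD_case1 (f : ℤ → ℤ) (fm : ∀ a b, f (a * b) = f a * f b) (f1 : f 1 = 1) (h2 : f 2 = 1)
    (k : ℕ) (hk : 0 < k) (hfk : ∀ m : ℤ, 0 < m → m ≤ k → f m = 1 ∨ f m = -1)
    (hk1 : f k ≠ 1) : CDPat f := by
  obtain ⟨n, hnk, hp, -, hn, hmin⟩ := CD_exists_min f (fun _ => 1) fm (by simp) f1 rfl k hk
    (by simp) hk1
  have hn0 := hp.two_le
  have hn2 : n ≠ 2 := by rintro rfl; exact hn (by simpa using h2)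
  have hodd := hp.eq_two_or_odd
  have hv : f n = -1 := (hfk n (by omega) (by omega)).resolve_left hn
  have hup : f (n + 1) = 1 := by
    have e : (n : ℤ) + 1 = 2 * (((n : ℤ) + 1) / 2) := by omega
    rw [e, fm, h2, hmin _ (by omega) (by omega) (by simp)]; rfl
  have hlow : ∀ m : ℤ, 0 ≤ m → m < n → m = 0 ∨ f m = 1 := by
    intro m h0 h1
    rcases h0.eq_or_lt with h | h
    · exact Or.inl h.symm
    · exact Or.inr (hmin m h h1 (by simp))
  refine ⟨n - 3, 1, 1, Or.inl rfl, hlow _ (by omega) (by omega), hlow _ (by omega) (by omega),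
    hlow _ (by omega) (by omega), ?_, Or.inr ?_⟩
  · exact (congrArg f (by ring)).trans hv
  · exact (congrArg f (by ring)).trans hup

/-- Case 2: `-1` and `2` nonresidues; compare with the character mod 3. -/
lemma CD_case2 (f : ℤ → ℤ) (fm : ∀ a b, f (a * b) = f a * f b) (f1 : f 1 = 1) (h2 : f 2 = -1)
    (hm1 : f (-1) = -1)
    (k : ℕ) (hk : 0 < k) (hfk : ∀ m : ℤ, 0 < m → m ≤ k → f m = 1 ∨ f m = -1)
    (h3 : f 3 = 1 ∨ f 3 = -1)
    (hgk : CDg3 k ≠ 0) (hk1 : f k ≠ CDg3 k) : CDPat f := by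
  obtain ⟨n, hnk, hp, hgn, hn, hmin⟩ := CD_exists_min f CDg3 fm CDg3_mul f1 rfl k hk hgk hk1
  have ag : ∀ m : ℤ, -n < m → m < n → CDg3 m ≠ 0 → f m = CDg3 m := by
    intro m h1 h2 h3
    rcases lt_trichotomy m 0 with h | h | h
    · have e : m = (-1) * (-m) := by ring
      rw [e, fm, CDg3_mul, hm1, hmin (-m) (by omega) (by omega)]
      · rfl
      · intro h0
        rw [e, CDg3_mul, h0] at h3
        simp at h3
    · subst h; exact absurd rfl h3
    · exact hmin m h h2 h3
  have hn0 := hp.two_le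
  have hv : f n = -CDg3 n := by
    rcases hfk n (by omega) (by omega) with h | h <;> rw [h] at hn ⊢ <;>
    · unfold CDg3 at hn hgn ⊢
      split_ifs at hn hgn ⊢ <;> simp_all
  have hvn : f (-n) = CDg3 n := by
    rw [show (-(n : ℤ)) = (-1) * n by ring, fm, hm1, hv]; ring
  rcases lt_or_ge n 16 with hlt | hge
  · interval_cases n <;> first | (exfalso; norm_num at hp; done) | skip
    · exact absurd h2 (by simpa [CDg3] using hn)
    · exact absurd rfl hgn
    · have v5 : f 5 = 1 := hv
      have v1 : f (-1) = -1 := hm1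
      have v4 : f (-4) = -1 := ag (-4) (by norm_num) (by norm_num) (by decide)
      have v8 : f 8 = -1 := by rw [show (8:ℤ) = 2 * 4 by norm_num, fm, h2, ag 4 (by norm_num) (by norm_num) (by decide)]; decide
      exact ⟨-4, 3, -1, by norm_num [*]⟩
    · have w2 : f (-2) = 1 := ag (-2) (by norm_num) (by norm_num) (by decide)
      have v4 : f 4 = 1 := ag (4) (by norm_num) (by norm_num) (by decide)
      have v5 : f 5 = -1 := ag (5) (by norm_num) (by norm_num) (by decide)
      have w5 : f (-5) = 1 := ag (-5) (by norm_num) (by norm_num) (by decide)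
      have v7 : f 7 = -1 := hv
      have w7 : f (-7) = 1 := hvn
      have v10 : f 10 = 1 := by rw [show (10:ℤ) = 2 * 5 by norm_num, fm, h2, v5]; rfl
      rcases h3 with h3 | h3
      · exact ⟨-2, 3, 1, by norm_num [*]⟩
      · have w3 : f (-3) = 1 := by rw [show (-3:ℤ) = -1 * 3 by norm_num, fm, hm1, h3]; rfl
        exact ⟨-7, 2, 1, by norm_num [*]⟩
    · have w11 : f (-11) = -1 := hvn
      have w10 : f (-10) = -1 := ag (-10) (by norm_num) (by norm_num) (by decide)
      have w8 : f (-8) = 1 := ag (-8) (by norm_num) (by norm_num) (by decide)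
      have w7 : f (-7) = -1 := ag (-7) (by norm_num) (by norm_num) (by decide)
      have w9 : f (-9) = -1 := by
        rw [show (-9:ℤ) = -1 * (3 * 3) by norm_num, fm, fm, hm1]
        rcases h3 with h3 | h3 <;> rw [h3] <;> rfl
      exact ⟨-11, 1, -1, by norm_num [*]⟩
    · have w13 : f (-13) = 1 := hvn
      have w8 : f (-8) = 1 := ag (-8) (by norm_num) (by norm_num) (by decide)
      have v7 : f 7 = 1 := ag 7 (by norm_num) (by norm_num) (by decide)
      have w7 : f (-7) = -1 := ag (-7) (by norm_num) (by norm_num) (by decide)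
      have w5 : f (-5) = 1 := ag (-5) (by norm_num) (by norm_num) (by decide)
      have w4 : f (-4) = -1 := ag (-4) (by norm_num) (by norm_num) (by decide)
      have w11 : f (-11) = 1 := ag (-11) (by norm_num) (by norm_num) (by decide)
      have w14 : f (-14) = 1 := by rw [show (-14:ℤ) = 2 * (-7) by norm_num, fm, h2, w7]; rfl
      rcases h3 with h3 | h3
      · have w15 : f (-15) = 1 := by rw [show (-15:ℤ) = 3 * (-5) by norm_num, fm, h3, w5]; rfl
        have w12 : f (-12) = -1 := by rw [show (-12:ℤ) = 3 * (-4) by norm_num, fm, h3, w4]; rfl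
        exact ⟨-15, 1, 1, by norm_num [*]⟩
      · have w3 : f (-3) = 1 := by rw [show (-3:ℤ) = -1 * 3 by norm_num, fm, hm1, h3]; rfl
        exact ⟨-13, 5, 1, by norm_num [*]⟩
  · have hodd : n % 2 = 1 := hp.eq_two_or_odd.resolve_left (by omega)
    have h15 : n ≠ 15 := by omega
    have agv : ∀ m : ℤ, -n < m → m < n → (m % 3 = 1 → f m = 1) ∧ (m % 3 = 2 → f m = -1) := by
      intro m ha hb
      constructor
      · intro h
        have e : CDg3 m = 1 := by simp [CDg3, h]
        rw [ag m ha hb (by rw [e]; norm_num), e]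
      · intro h
        have e : CDg3 m = -1 := by simp [CDg3, h]
        rw [ag m ha hb (by rw [e]; norm_num), e]
    have main : ∀ (e M s : ℤ), 0 < e → 2 * e < n → (n : ℤ) - 2 * e = 3 * M →
        ((n : ℤ) % 3 = 1 ∧ s = -1 ∨ (n : ℤ) % 3 = 2 ∧ s = 1) → f (3 * M) = s → CDPat f := by
      intro e M s he hen hM hs hf
      have t2 : f (n + 2 * -e) = s := by rw [← hf, ← hM]; congr 1; ring
      have x1 := agv (n + -e) (by omega) (by omega)
      have x3 := agv (n + 3 * -e) (by omega) (by omega)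
      have x4 := agv (n + 4 * -e) (by omega) (by omega)
      rcases hs with ⟨hs, rfl⟩ | ⟨hs, rfl⟩
      · have hv' : f n = -1 := by rw [hv]; simp [CDg3, hs]
        exact ⟨n, -e, -1, Or.inr rfl, Or.inr hv', Or.inr (x1.2 (by omega)), Or.inr t2,
          by rw [x3.1 (by omega)]; rfl, Or.inr (x4.2 (by omega))⟩
      · have hv' : f n = 1 := by rw [hv]; simp [CDg3, hs]
        exact ⟨n, -e, 1, Or.inl rfl, Or.inr hv', Or.inr (x1.1 (by omega)), Or.inr t2,
          by rw [x3.2 (by omega)], Or.inr (x4.1 (by omega))⟩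
    have hn3 : (n : ℤ) % 3 = 1 ∨ (n : ℤ) % 3 = 2 := by
      by_contra hcon
      exact hgn (by simp [CDg3]; omega)
    have h5 : f 5 = -1 := ag 5 (by omega) (by omega) (by decide)
    have f31 : f (3 * 1) = f 3 := by norm_num
    have f35 : f (3 * 5) = - f 3 := by rw [fm, h5]; ring
    have E1 := main ((n - 3) / 2) 1
    have E2 := main ((n - 15) / 2) 5
    rw [f31] at E1
    rw [f35] at E2
    rcases h3 with h3 | h3 <;> rcases hn3 with h | h <;> rw [h3] at E1 E2
    · exact E2 (-1) (by omega) (by omega) (by omega) (by omega) rfl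
    · exact E1 1 (by omega) (by omega) (by omega) (by omega) rfl
    · exact E1 (-1) (by omega) (by omega) (by omega) (by omega) rfl
    · exact E2 1 (by omega) (by omega) (by omega) (by omega) rfl

/-- Case 3: `-1` residue, `2` nonresidue; compare with the character mod 5. -/
lemma CD_case3 (f : ℤ → ℤ) (fm : ∀ a b, f (a * b) = f a * f b) (f1 : f 1 = 1) (h2 : f 2 = -1)
    (hm1 : f (-1) = 1)
    (k : ℕ) (hk : 0 < k) (hfk : ∀ m : ℤ, 0 < m → m ≤ k → f m = 1 ∨ f m = -1)
    (h3 : f 3 = 1 ∨ f 3 = -1) (h5 : f 5 = 1 ∨ f 5 = -1)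
    (hgk : CDg5 k ≠ 0) (hk1 : f k ≠ CDg5 k) : CDPat f := by
  rcases h3 with h3 | h3
  · exact ⟨-1, 1, 1, by norm_num [*]⟩
  obtain ⟨n, hnk, hp, hgn, hn, hmin⟩ := CD_exists_min f CDg5 fm CDg5_mul f1 rfl k hk hgk hk1
  have fneg : ∀ m, f (-m) = f m := by
    intro m
    rw [show -m = -1 * m by ring, fm, hm1, one_mul]
  have ag : ∀ m : ℤ, -n < m → m < n → CDg5 m ≠ 0 → f m = CDg5 m := by
    intro m h1 h2 h3
    rcases lt_trichotomy m 0 with h | h | h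
    · have e : m = (-1) * (-m) := by ring
      rw [e, fm, CDg5_mul, hm1, hmin (-m) (by omega) (by omega)]
      · rfl
      · intro h0
        rw [e, CDg5_mul, h0] at h3
        simp at h3
    · subst h; exact absurd rfl h3
    · exact hmin m h h2 h3
  have hn0 := hp.two_le
  have hv : f n = -CDg5 n := by
    rcases hfk n (by omega) (by omega) with h | h <;> rw [h] at hn ⊢ <;>
    · unfold CDg5 at hn hgn ⊢
      split_ifs at hn hgn ⊢ <;> simp_all
  have agv : ∀ m : ℤ, -n < m → m < n →
      ((m % 5 = 1 ∨ m % 5 = 4) → f m = 1) ∧ ((m % 5 = 2 ∨ m % 5 = 3) → f m = -1) := by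
    intro m ha hb
    constructor
    · intro h
      have e : CDg5 m = 1 := by unfold CDg5; rw [if_neg (by omega), if_pos h]
      rw [ag m ha hb (by rw [e]; norm_num), e]
    · intro h
      have e : CDg5 m = -1 := by unfold CDg5; rw [if_neg (by omega), if_neg (by omega)]
      rw [ag m ha hb (by rw [e]; norm_num), e]
  rcases lt_or_ge n 31 with hlt | hge
  · have A : ∀ m : ℤ, -n < m → m < n → (m % 5 = 1 ∨ m % 5 = 4) → f m = 1 :=
      fun m ha hb => (agv m ha hb).1
    have B : ∀ m : ℤ, -n < m → m < n → (m % 5 = 2 ∨ m % 5 = 3) → f m = -1 :=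
      fun m ha hb => (agv m ha hb).2
    have v4 : f 4 = 1 := by rw [show (4:ℤ) = 2 * 2 by norm_num, fm, h2]; rfl
    have v8 : f 8 = -1 := by rw [show (8:ℤ) = 2 * 4 by norm_num, fm, h2, v4]; rfl
    have v9 : f 9 = 1 := by rw [show (9:ℤ) = 3 * 3 by norm_num, fm, h3]; rfl
    have v12 : f 12 = -1 := by rw [show (12:ℤ) = 3 * 4 by norm_num, fm, h3, v4]; rfl
    have v18 : f 18 = -1 := by rw [show (18:ℤ) = 2 * 9 by norm_num, fm, h2, v9]; rfl
    have v16 : f 16 = 1 := by rw [show (16:ℤ) = 4 * 4 by norm_num, fm, v4]; rfl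
    have v10 : f 10 = - f 5 := by rw [show (10:ℤ) = 2 * 5 by norm_num, fm, h2]; ring
    have v15 : f 15 = - f 5 := by rw [show (15:ℤ) = 3 * 5 by norm_num, fm, h3]; ring
    have v20 : f 20 = f 5 := by rw [show (20:ℤ) = 4 * 5 by norm_num, fm, v4]; ring
    interval_cases n <;> first | (exfalso; norm_num at hp; done) | skip
    · exact absurd h2 (by simpa [CDg5] using hn)
    · exact absurd h3 (by simpa [CDg5] using hn)
    · exact absurd rfl hgn
    · have v7 : f 7 = 1 := hv
      rcases h5 with h5 | h5
      · exact ⟨-7, 3, 1, by norm_num [*]⟩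
      · exact ⟨-8, 5, -1, by norm_num [*]⟩
    · have v11 : f 11 = -1 := hv
      have v7 : f 7 = -1 := B 7 (by norm_num) (by norm_num) (by norm_num)
      rcases h5 with h5 | h5
      · exact ⟨-12, 1, -1, by norm_num [*]⟩
      · exact ⟨3, 2, -1, by norm_num [*]⟩
    · have v13 : f 13 = 1 := hv
      have v7 : f 7 = -1 := B 7 (by norm_num) (by norm_num) (by norm_num)
      have v11 : f 11 = 1 := A 11 (by norm_num) (by norm_num) (by norm_num)
      rcases h5 with h5 | h5
      · exact ⟨-13, 2, 1, by norm_num [*]⟩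
      · exact ⟨9, 1, 1, by norm_num [*]⟩
    · have v17 : f 17 = 1 := hv
      have v7 : f 7 = -1 := B 7 (by norm_num) (by norm_num) (by norm_num)
      have v11 : f 11 = 1 := A 11 (by norm_num) (by norm_num) (by norm_num)
      have v14 : f 14 = 1 := A 14 (by norm_num) (by norm_num) (by norm_num)
      rcases h5 with h5 | h5
      · exact ⟨-17, 3, 1, by norm_num [*]⟩
      · exact ⟨-17, 8, 1, by norm_num [*]⟩
    · have v19 : f 19 = -1 := hv
      have v7 : f 7 = -1 := B 7 (by norm_num) (by norm_num) (by norm_num)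
      have v13 : f 13 = -1 := B 13 (by norm_num) (by norm_num) (by norm_num)
      have v17 : f 17 = -1 := B 17 (by norm_num) (by norm_num) (by norm_num)
      rcases h5 with h5 | h5
      · exact ⟨-19, 1, -1, by norm_num [*]⟩
      · exact ⟨-19, 6, -1, by norm_num [*]⟩
    · have v23 : f 23 = 1 := hv
      have v19 : f 19 = 1 := A 19 (by norm_num) (by norm_num) (by norm_num)
      have v21 : f 21 = 1 := A 21 (by norm_num) (by norm_num) (by norm_num)
      have v22 : f 22 = -1 := B 22 (by norm_num) (by norm_num) (by norm_num)
      have v17 : f 17 = -1 := B 17 (by norm_num) (by norm_num) (by norm_num)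
      rcases h5 with h5 | h5
      · exact ⟨19, 1, 1, by norm_num [*]⟩
      · exact ⟨-23, 2, 1, by norm_num [*]⟩
    · have v29 : f 29 = -1 := hv
      have v7 : f 7 = -1 := B 7 (by norm_num) (by norm_num) (by norm_num)
      have v17 : f 17 = -1 := B 17 (by norm_num) (by norm_num) (by norm_num)
      have v23 : f 23 = -1 := B 23 (by norm_num) (by norm_num) (by norm_num)
      have v26 : f 26 = 1 := A 26 (by norm_num) (by norm_num) (by norm_num)
      rcases h5 with h5 | h5
      · exact ⟨-29, 11, -1, by norm_num [*]⟩
      · exact ⟨17, 3, -1, by norm_num [*]⟩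
  · have main : ∀ (M s : ℤ), (M % 4 = n % 4 ∧ 5 * M < n ∧ -n < 3 * M) →
        (((n : ℤ) % 5 = 1 ∨ (n : ℤ) % 5 = 4) ∧ s = -1 ∨
          ((n : ℤ) % 5 = 2 ∨ (n : ℤ) % 5 = 3) ∧ s = 1) → f 5 * f M = s → CDPat f := by
      intro M s hM hs hf
      rw [← fm] at hf
      obtain ⟨e, he⟩ : ∃ e : ℤ, n - 4 * e = 5 * M := ⟨(n - 5 * M) / 4, by omega⟩
      have t4 : f (n + 4 * -e) = s := by rw [← hf, ← he]; congr 1; ring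
      have x1 := agv (n + -e) (by omega) (by omega)
      have x2 := agv (n + 2 * -e) (by omega) (by omega)
      have x3 := agv (n + 3 * -e) (by omega) (by omega)
      rcases hs with ⟨hs, rfl⟩ | ⟨hs, rfl⟩
      · have hv' : f n = -1 := by
          rw [hv]; unfold CDg5; rw [if_neg (by omega), if_pos hs]
        exact ⟨n, -e, -1, Or.inr rfl, Or.inr hv', Or.inr (x1.2 (by omega)),
          Or.inr (x2.2 (by omega)), by rw [x3.1 (by omega)]; rfl, Or.inr t4⟩
      · have hv' : f n = 1 := by
          rw [hv]; unfold CDg5; rw [if_neg (by omega), if_neg (by omega)]; rfl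
        exact ⟨n, -e, 1, Or.inl rfl, Or.inr hv', Or.inr (x1.1 (by omega)),
          Or.inr (x2.1 (by omega)), by rw [x3.2 (by omega)], Or.inr t4⟩
    have hn5 : ((n : ℤ) % 5 = 1 ∨ (n : ℤ) % 5 = 4) ∨ ((n : ℤ) % 5 = 2 ∨ (n : ℤ) % 5 = 3) := by
      by_contra hcon
      exact hgn (by unfold CDg5; rw [if_pos (by omega)])
    obtain ⟨M0, hM4, hMu, hMl⟩ : ∃ M : ℤ, M % 4 = n % 4 ∧ 5 * M < n ∧ (n : ℤ) - 20 ≤ 5 * M :=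
      ⟨(n - 1) / 5 - (((n - 1) / 5 - n) % 4), by omega, by omega, by omega⟩
    have cand : ∀ j : ℤ, 0 ≤ j → j ≤ 3 →
        ((M0 - 4 * j) % 4 = n % 4 ∧ 5 * (M0 - 4 * j) < n ∧ -n < 3 * (M0 - 4 * j)) := by
      intro j h0 h1
      omega
    have exP : ∃ M : ℤ, (M % 4 = n % 4 ∧ 5 * M < n ∧ -n < 3 * M) ∧ f M = 1 := by
      obtain ⟨j, h0, h1, c⟩ : ∃ j : ℤ, 0 ≤ j ∧ j ≤ 3 ∧
          ((M0 - 4 * j) % 5 = 1 ∨ (M0 - 4 * j) % 5 = 4) := by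
        have : M0 % 5 = 0 ∨ M0 % 5 = 1 ∨ M0 % 5 = 2 ∨ M0 % 5 = 3 ∨ M0 % 5 = 4 := by omega
        rcases this with h | h | h | h | h
        · exact ⟨1, by omega⟩
        · exact ⟨0, by omega⟩
        · exact ⟨2, by omega⟩
        · exact ⟨1, by omega⟩
        · exact ⟨0, by omega⟩
      have := cand j h0 h1
      exact ⟨_, this, (agv _ (by omega) (by omega)).1 c⟩
    have exN : ∃ M : ℤ, (M % 4 = n % 4 ∧ 5 * M < n ∧ -n < 3 * M) ∧ f M = -1 := by
      obtain ⟨j, h0, h1, c⟩ : ∃ j : ℤ, 0 ≤ j ∧ j ≤ 3 ∧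
          ((M0 - 4 * j) % 5 = 2 ∨ (M0 - 4 * j) % 5 = 3) := by
        have : M0 % 5 = 0 ∨ M0 % 5 = 1 ∨ M0 % 5 = 2 ∨ M0 % 5 = 3 ∨ M0 % 5 = 4 := by omega
        rcases this with h | h | h | h | h
        · exact ⟨2, by omega⟩
        · exact ⟨1, by omega⟩
        · exact ⟨0, by omega⟩
        · exact ⟨0, by omega⟩
        · exact ⟨3, by omega⟩
      have := cand j h0 h1
      exact ⟨_, this, (agv _ (by omega) (by omega)).2 c⟩
    obtain ⟨M, a, c⟩ := exP
    obtain ⟨M', a', c'⟩ := exN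
    rcases h5 with h5 | h5 <;> rcases hn5 with h | h
    · exact main M' (-1) a' (Or.inl ⟨h, rfl⟩) (by rw [h5, c']; rfl)
    · exact main M 1 a (Or.inr ⟨h, rfl⟩) (by rw [h5, c]; rfl)
    · exact main M (-1) a (Or.inl ⟨h, rfl⟩) (by rw [h5, c]; rfl)
    · exact main M' 1 a' (Or.inr ⟨h, rfl⟩) (by rw [h5, c']; rfl)

lemma CD_pat (p : ℕ) [hF : Fact p.Prime] (hp : 5 < p) (D : ℤ) (hD : legendreSym p D = -1) :
    CDPat (legendreSym p) := by
  have fm := legendreSym.mul p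
  have f1 := legendreSym.at_one p
  have nz : ∀ m : ℤ, 0 < m → m < p → (m : ZMod p) ≠ 0 := by
    intro m h0 h1 h
    rw [ZMod.intCast_zmod_eq_zero_iff_dvd] at h
    exact absurd (Int.le_of_dvd h0 h) (by omega)
  have fv : ∀ m : ℤ, 0 < m → m < p → legendreSym p m = 1 ∨ legendreSym p m = -1 :=
    fun m h0 h1 => legendreSym.eq_one_or_neg_one p (nz m h0 h1)
  have fv' : ∀ k : ℕ, k < p → ∀ m : ℤ, 0 < m → m ≤ k →
      legendreSym p m = 1 ∨ legendreSym p m = -1 :=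
    fun k hk m h0 h1 => fv m h0 (by omega)
  have fsub : ∀ k : ℤ, legendreSym p (p - k) = legendreSym p (-1) * legendreSym p k := by
    intro k
    rw [← fm]
    simp [legendreSym]
  have hm1 : legendreSym p (-1) = 1 ∨ legendreSym p (-1) = -1 := by
    apply legendreSym.eq_one_or_neg_one
    simp
  rcases fv 2 (by norm_num) (by omega) with h2 | h2
  · have hpos : (0 : ℤ) < p := by omega
    obtain ⟨k, hk⟩ := Int.eq_ofNat_of_zero_le (Int.emod_nonneg D hpos.ne')
    have hlt := Int.emod_lt_of_pos D hpos
    have hk1 : legendreSym p k = -1 := by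
      rw [← hD, legendreSym.mod p D, hk]
    refine CD_case1 _ fm f1 h2 k ?_ (fv' k (by omega)) (by rw [hk1]; norm_num)
    rcases Nat.eq_zero_or_pos k with h | h
    · subst h; simp at hk1
    · exact h
  have h3 := fv 3 (by norm_num) (by omega)
  have h5 := fv 5 (by norm_num) (by omega)
  have hp3 : p % 3 ≠ 0 := by
    intro h
    have := (Nat.prime_dvd_prime_iff_eq Nat.prime_three hF.out).1 (Nat.dvd_of_mod_eq_zero h)
    omega
  have hp5 : p % 5 ≠ 0 := by
    intro h
    have := (Nat.prime_dvd_prime_iff_eq Nat.prime_five hF.out).1 (Nat.dvd_of_mod_eq_zero h)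
    omega
  have cast : ∀ j : ℕ, j < p → ((p - j : ℕ) : ℤ) = (p : ℤ) - (j : ℤ) := by
    intro j hj; omega
  rcases hm1 with hm1 | hm1
  · by_contra hno
    have key : ∀ k : ℕ, 0 < k → k < p → CDg5 k ≠ 0 → legendreSym p k = CDg5 k := by
      intro k h0 hk hg
      by_contra hne
      exact hno (CD_case3 _ fm f1 h2 hm1 k h0 (fv' k hk) h3 h5 hg hne)
    have k2 : ∀ j : ℕ, 0 < j → j < p → CDg5 j ≠ 0 → CDg5 ((p : ℤ) - j) ≠ 0 →
        CDg5 ((p : ℤ) - j) = CDg5 j := by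
      intro j h0 hj hg hg'
      have a := key j h0 hj hg
      have b := key (p - j) (by omega) (by omega) (by rw [cast j hj]; exact hg')
      rw [cast j hj, fsub, hm1, a] at b
      rw [← b]; ring
    have : p % 5 = 1 ∨ p % 5 = 2 ∨ p % 5 = 3 ∨ p % 5 = 4 := by omega
    have val1 : ∀ m : ℤ, (m % 5 = 1 ∨ m % 5 = 4) → CDg5 m = 1 := by
      intro m h; unfold CDg5; rw [if_neg (by omega), if_pos h]
    have val2 : ∀ m : ℤ, (m % 5 = 2 ∨ m % 5 = 3) → CDg5 m = -1 := by
      intro m h; unfold CDg5; rw [if_neg (by omega), if_neg (by omega)]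
    rcases this with h | h | h | h
    · have := k2 2 (by omega) (by omega) (by decide)
      rw [val1 (p - (2 : ℕ)) (by omega)] at this
      exact absurd (this (by norm_num)) (by decide)
    · have := k2 3 (by omega) (by omega) (by decide)
      rw [val1 (p - (3 : ℕ)) (by omega)] at this
      exact absurd (this (by norm_num)) (by decide)
    · have := k2 1 (by omega) (by omega) (by decide)
      rw [val2 (p - (1 : ℕ)) (by omega)] at this
      exact absurd (this (by norm_num)) (by decide)
    · have := k2 1 (by omega) (by omega) (by decide)
      rw [val2 (p - (1 : ℕ)) (by omega)] at this
      exact absurd (this (by norm_num)) (by decide)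
  · by_contra hno
    have key : ∀ k : ℕ, 0 < k → k < p → CDg3 k ≠ 0 → legendreSym p k = CDg3 k := by
      intro k h0 hk hg
      by_contra hne
      exact hno (CD_case2 _ fm f1 h2 hm1 k h0 (fv' k hk) h3 hg hne)
    have k2 : ∀ j : ℕ, 0 < j → j < p → CDg3 j ≠ 0 → CDg3 ((p : ℤ) - j) ≠ 0 →
        CDg3 ((p : ℤ) - j) = - CDg3 j := by
      intro j h0 hj hg hg'
      have a := key j h0 hj hg
      have b := key (p - j) (by omega) (by omega) (by rw [cast j hj]; exact hg')
      rw [cast j hj, fsub, hm1, a] at b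
      rw [← b]; ring
    have : p % 3 = 1 ∨ p % 3 = 2 := by omega
    have val1 : ∀ m : ℤ, m % 3 = 1 → CDg3 m = 1 := by
      intro m h; unfold CDg3; rw [if_neg (by omega), if_pos h]
    have val2 : ∀ m : ℤ, m % 3 = 2 → CDg3 m = -1 := by
      intro m h; unfold CDg3; rw [if_neg (by omega), if_neg (by omega)]
    rcases this with h | h
    · have := k2 2 (by omega) (by omega) (by decide)
      rw [val2 (p - (2 : ℕ)) (by omega)] at this
      exact absurd (this (by norm_num)) (by decide)
    · have := k2 1 (by omega) (by omega) (by decide)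
      rw [val1 (p - (1 : ℕ)) (by omega)] at this
      exact absurd (this (by norm_num)) (by decide)

/-- Hensel: an integer with Legendre symbol one is a square in `ℚ_p`. -/
lemma CD_sqrt (p : ℕ) [hF : Fact p.Prime] (hp : 5 < p) (m : ℤ) (hm : legendreSym p m = 1) :
    ∃ y : ℚ_[p], y ^ 2 = m := by
  have hm0 : (m : ZMod p) ≠ 0 := by
    intro h
    rw [(legendreSym.eq_zero_iff p m).2 h] at hm
    norm_num at hm
  obtain ⟨r, hr⟩ := (legendreSym.eq_one_iff p hm0).1 hm
  obtain ⟨b, rfl⟩ := ZMod.intCast_surjective r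
  have hdvd : (p : ℤ) ∣ b ^ 2 - m := by
    rw [← ZMod.intCast_zmod_eq_zero_iff_dvd]
    push_cast
    rw [hr]; ring
  have hb : ¬ (p : ℤ) ∣ 2 * b := by
    rw [← ZMod.intCast_zmod_eq_zero_iff_dvd]
    push_cast
    intro h
    rcases mul_eq_zero.1 h with h | h
    · have : ((2 : ℕ) : ZMod p) = 0 := by exact_mod_cast h
      rw [ZMod.natCast_eq_zero_iff] at this
      exact absurd (Nat.le_of_dvd (by norm_num) this) (by omega)
    · rw [h] at hr
      exact hm0 (by simpa using hr)
  have n1 : ‖((b ^ 2 - m : ℤ) : ℤ_[p])‖ < 1 := (PadicInt.norm_int_lt_one_iff_dvd _).2 hdvd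
  have n2 : ‖((2 * b : ℤ) : ℤ_[p])‖ = 1 := by
    refine le_antisymm (PadicInt.norm_le_one _) (not_lt.1 ?_)
    rw [PadicInt.norm_int_lt_one_iff_dvd]
    exact hb
  let F : Polynomial ℤ := Polynomial.X ^ 2 - Polynomial.C m
  have e1 : F.aeval (b : ℤ_[p]) = ((b ^ 2 - m : ℤ) : ℤ_[p]) := by simp [F]
  have e2 : F.derivative.aeval (b : ℤ_[p]) = ((2 * b : ℤ) : ℤ_[p]) := by
    simp only [F, Polynomial.derivative_sub, Polynomial.derivative_X_pow, Polynomial.derivative_C]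
    simp [-eq_intCast, -map_ofNat]
    try exact Or.inl (map_ofNat _ 2)
  obtain ⟨z, hz, -⟩ := hensels_lemma (p := p) (F := F) (a := (b : ℤ_[p]))
    (by rw [e1, e2, n2]; simpa using n1)
  refine ⟨(z : ℚ_[p]), ?_⟩
  have : z ^ 2 = (m : ℤ_[p]) := by
    have h : F.aeval z = z ^ 2 - (m : ℤ_[p]) := by simp [F]
    rw [h] at hz
    exact sub_eq_zero.1 hz
  exact_mod_cast congrArg (fun t : ℤ_[p] => (t : ℚ_[p])) this

/-- **`C_D` has `p`-adic points for all primes `p > 5` not dividing `D`.**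
For a prime `p > 5` not dividing `D`, there is a nonzero tuple `(x₀,…,x₄) ∈ ℚ_p⁵` satisfying
the three equations defining `C_D`. -/
theorem CD_has_Qp_point_of_good_reduction
    (D : ℤ) (p : ℕ) [Fact p.Prime] (hp : 5 < p) (hpD : ¬ (p : ℤ) ∣ D) :
    ∃ x : Fin 5 → ℚ_[p], x ≠ 0 ∧
      x 0 ^ 2 - 2 * x 1 ^ 2 + x 2 ^ 2 = 0 ∧
      x 1 ^ 2 - 2 * x 2 ^ 2 + (D : ℚ_[p]) * x 3 ^ 2 = 0 ∧
      x 2 ^ 2 - 2 * (D : ℚ_[p]) * x 3 ^ 2 + x 4 ^ 2 = 0 := by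
  have hD0 : (D : ZMod p) ≠ 0 := by
    rwa [Ne, ZMod.intCast_zmod_eq_zero_iff_dvd]
  have hDne : (D : ℚ_[p]) ≠ 0 := by
    intro h
    have : D = 0 := by exact_mod_cast h
    exact hpD (this ▸ dvd_zero _)
  rcases legendreSym.eq_one_or_neg_one p hD0 with h | h
  · obtain ⟨y, hy⟩ := CD_sqrt p hp D h
    refine ⟨![y, y, y, 1, y], ?_, ?_, ?_, ?_⟩
    · intro h0
      simpa using congrFun h0 3
    all_goals simp [hy]
    all_goals ring
  · obtain ⟨a, d, s, hs, q0, q1, q2, q3, q4⟩ := CD_pat p hp D h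
    -- scaling factor
    obtain ⟨l, hl, hl3⟩ : ∃ l : ℤ, legendreSym p l = s ∧ l ≠ 0 := by
      rcases hs with rfl | rfl
      · exact ⟨1, legendreSym.at_one p, one_ne_zero⟩
      · exact ⟨D, h, by rintro rfl; exact hpD (dvd_zero _)⟩
    have hss : s * s = 1 := by rcases hs with rfl | rfl <;> rfl
    have root : ∀ m : ℤ, (m = 0 ∨ legendreSym p m = s) → ∃ y : ℚ_[p], y ^ 2 = (l : ℚ_[p]) * m := by
      intro m hm
      rcases hm with rfl | hm
      · exact ⟨0, by simp⟩
      · obtain ⟨y, hy⟩ := CD_sqrt p hp (l * m) (by rw [legendreSym.mul, hl, hm, hss])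
        exact ⟨y, by rw [hy]; push_cast; ring⟩
    obtain ⟨y0, e0⟩ := root _ q0
    obtain ⟨y1, e1⟩ := root _ q1
    obtain ⟨y2, e2⟩ := root _ q2
    obtain ⟨y4, e4⟩ := root _ q4
    obtain ⟨w, hw⟩ := CD_sqrt p hp (D * (l * (a + 3 * d))) (by
      rw [legendreSym.mul, legendreSym.mul, hl, q3, h]; linarith)
    have e3 : (D : ℚ_[p]) * (w / D) ^ 2 = (l : ℚ_[p]) * ((a + 3 * d : ℤ) : ℚ_[p]) := by
      rw [div_pow, hw]; push_cast; field_simp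
    have hne : (l : ℚ_[p]) * ((a + 3 * d : ℤ) : ℚ_[p]) ≠ 0 := by
      apply mul_ne_zero
      · exact_mod_cast hl3
      · intro h0
        have h1 : a + 3 * d = 0 := by exact_mod_cast h0
        rw [h1, legendreSym.at_zero] at q3
        rcases hs with rfl | rfl <;> norm_num at q3
    obtain ⟨y3, hy3⟩ : ∃ y3 : ℚ_[p], y3 = w / D := ⟨_, rfl⟩
    rw [← hy3] at e3
    push_cast at e0 e1 e2 e3 e4
    refine ⟨![y0, y1, y2, y3, y4], ?_, ?_, ?_, ?_⟩
    · intro h0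
      have : y3 = 0 := by simpa using congrFun h0 3
      apply hne
      push_cast
      rw [← e3, this]; ring
    · show y0 ^ 2 - 2 * y1 ^ 2 + y2 ^ 2 = 0
      linear_combination e0 - 2 * e1 + e2
    · show y1 ^ 2 - 2 * y2 ^ 2 + D * y3 ^ 2 = 0
      linear_combination e1 - 2 * e2 + e3
    · show y2 ^ 2 - 2 * D * y3 ^ 2 + y4 ^ 2 = 0
      linear_combination e2 - 2 * e3 + e4
end

section
/- Let D be a squarefree integer and p > 3 a prime dividing D. Then there exists a nonzero tuple (x₀,…,x₄) ∈ ℚ_p⁵ satisfying x₀² − 2x₁² + x₂² = 0, x₁² − 2x₂² + D·x₃² = 0 and x₂² − 2D·x₃² + x₄² = 0 if and only if p ≡ 1 (mod 24). -/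
lemma CD_aux_toZMod_dvd {p : ℕ} [Fact p.Prime] (x : ℤ_[p]) :
    PadicInt.toZMod x = 0 ↔ (p : ℤ_[p]) ∣ x := by
  rw [← RingHom.mem_ker, PadicInt.ker_toZMod, PadicInt.maximalIdeal_eq_span_p,
    Ideal.mem_span_singleton]

lemma CD_aux_sqrt {p : ℕ} [Fact p.Prime] (hp : 3 < p) (a : ℤ) (ha : ((a : ℤ) : ZMod p) ≠ 0)
    (h : IsSquare ((a : ℤ) : ZMod p)) : ∃ z : ℚ_[p], z ^ 2 = a := by
  obtain ⟨r, hr⟩ := h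
  obtain ⟨b, hb⟩ := ZMod.ringHom_surjective (PadicInt.toZMod (p := p)) r
  have h2 : (2 : ZMod p) ≠ 0 := by
    intro h
    have : ((2 : ℕ) : ZMod p) = 0 := by exact_mod_cast h
    rw [ZMod.natCast_eq_zero_iff] at this
    have := Nat.le_of_dvd (by norm_num) this
    omega
  have hr0 : r ≠ 0 := by
    rintro rfl
    simp at hr
    exact ha hr
  have hu : ‖(2 * b : ℤ_[p])‖ = 1 := by
    by_contra hne
    have hlt : ‖(2 * b : ℤ_[p])‖ < 1 := lt_of_le_of_ne (PadicInt.norm_le_one _) hne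
    rw [PadicInt.norm_lt_one_iff_dvd, ← CD_aux_toZMod_dvd, map_mul, hb, map_ofNat] at hlt
    exact mul_ne_zero h2 hr0 hlt
  have hl : ‖(b ^ 2 - (a : ℤ_[p]))‖ < 1 := by
    rw [PadicInt.norm_lt_one_iff_dvd, ← CD_aux_toZMod_dvd, map_sub, map_pow, hb, map_intCast, hr]
    ring
  let F : Polynomial ℤ_[p] := Polynomial.X ^ 2 - Polynomial.C (a : ℤ_[p])
  have hd : F.derivative.aeval b = 2 * b := by
    simp [F, Polynomial.derivative_pow]
  have hF : ∀ z : ℤ_[p], F.aeval z = z ^ 2 - (a : ℤ_[p]) := by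
    intro z
    simp [F]
  obtain ⟨z, hz, -⟩ := hensels_lemma (F := F) (a := b) (by
    rw [hd, hu, hF]; simpa using hl)
  rw [hF, sub_eq_zero] at hz
  exact ⟨z, by exact_mod_cast congrArg (fun t : ℤ_[p] => (t : ℚ_[p])) hz⟩

lemma CD_aux_two : ¬ IsSquare ((2 : ℕ) : ZMod 3) := by decide

lemma CD_aux_mod {p : ℕ} [Fact p.Prime] (hp : 3 < p) :
    (IsSquare (-1 : ZMod p) ∧ IsSquare (2 : ZMod p) ∧ IsSquare (3 : ZMod p)) ↔ p % 24 = 1 := by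
  have : Fact (Nat.Prime 3) := ⟨Nat.prime_three⟩
  have hpp : p.Prime := Fact.out
  rw [ZMod.exists_sq_eq_neg_one_iff, ZMod.exists_sq_eq_two_iff (by omega)]
  have key : p % 4 = 1 → (IsSquare (3 : ZMod p) ↔ p % 3 = 1) := by
    intro h4
    have h := ZMod.exists_sq_eq_prime_iff_of_mod_four_eq_one (p := p) (q := 3) h4 (by norm_num)
    have h3 : p % 3 ≠ 0 := by
      intro h0
      have := (Nat.prime_dvd_prime_iff_eq Nat.prime_three hpp).1 (Nat.dvd_of_mod_eq_zero h0)
      omega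
    rw [Nat.cast_ofNat] at h
    rw [h, ← ZMod.natCast_mod p 3]
    have : p % 3 = 1 ∨ p % 3 = 2 := by omega
    rcases this with h | h <;> rw [h]
    · simp
    · simp only [Nat.reduceEqDiff, iff_false]
      exact CD_aux_two
  constructor
  · rintro ⟨h1, h2, h3⟩
    have := (key (by omega)).1 h3
    omega
  · intro h
    exact ⟨by omega, by omega, (key (by omega)).2 (by omega)⟩

lemma CD_aux_forward {D : ℤ} (hD : Squarefree D) {p : ℕ} [Fact p.Prime]
    (hpD : (p : ℤ) ∣ D) (y : Fin 5 → ℤ_[p]) (i : Fin 5) (hi : y i = 1)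
    (e1 : y 0 ^ 2 - 2 * y 1 ^ 2 + y 2 ^ 2 = 0)
    (e2 : y 1 ^ 2 - 2 * y 2 ^ 2 + (D : ℤ_[p]) * y 3 ^ 2 = 0)
    (e3 : y 2 ^ 2 - 2 * (D : ℤ_[p]) * y 3 ^ 2 + y 4 ^ 2 = 0) :
    IsSquare (-1 : ZMod p) ∧ IsSquare (2 : ZMod p) ∧ IsSquare (3 : ZMod p) := by
  have hpp : p.Prime := Fact.out
  obtain ⟨E, rfl⟩ := hpD
  have hE : ((E : ℤ) : ZMod p) ≠ 0 := by
    intro h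
    rw [ZMod.intCast_zmod_eq_zero_iff_dvd] at h
    have := hD p (mul_dvd_mul_left _ h)
    exact (Nat.prime_iff_prime_int.1 hpp).not_isUnit this
  have f1 := congrArg PadicInt.toZMod e1
  have f2 := congrArg PadicInt.toZMod e2
  have f3 := congrArg PadicInt.toZMod e3
  simp only [map_add, map_sub, map_mul, map_pow, map_ofNat, map_intCast, map_zero, Int.cast_mul,
    Int.cast_natCast, map_natCast, CharP.cast_eq_zero, zero_mul, mul_zero, add_zero, sub_zero]
    at f1 f2 f3
  by_cases h2 : PadicInt.toZMod (y 2) = 0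
  · exfalso
    rw [h2] at f1 f2 f3
    have h1 : PadicInt.toZMod (y 1) = 0 := by simpa using f2
    have h4 : PadicInt.toZMod (y 4) = 0 := by simpa using f3
    have h0 : PadicInt.toZMod (y 0) = 0 := by rw [h1] at f1; simpa using f1
    have h3 : PadicInt.toZMod (y 3) = 0 := by
      obtain ⟨z1, hz1⟩ := (CD_aux_toZMod_dvd _).1 h1
      obtain ⟨z2, hz2⟩ := (CD_aux_toZMod_dvd _).1 h2
      have hp0 : (p : ℤ_[p]) ≠ 0 := by exact_mod_cast hpp.ne_zero
      have : (E : ℤ_[p]) * y 3 ^ 2 = p * (2 * z2 ^ 2 - z1 ^ 2) := by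
        apply mul_left_cancel₀ hp0
        rw [hz1, hz2] at e2
        push_cast at e2
        linear_combination e2
      have := congrArg PadicInt.toZMod this
      simp only [map_mul, map_pow, map_intCast, map_natCast, CharP.cast_eq_zero, zero_mul] at this
      simpa [hE] using this
    have hone : PadicInt.toZMod (y i) = 1 := by rw [hi, map_one]
    fin_cases i <;> simp_all
  · set a := PadicInt.toZMod (y 0)
    set b := PadicInt.toZMod (y 1)
    set c := PadicInt.toZMod (y 2)
    set d := PadicInt.toZMod (y 4)
    refine ⟨⟨d / c, ?_⟩, ⟨b / c, ?_⟩, ⟨a / c, ?_⟩⟩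
    · field_simp
      linear_combination -f3
    · field_simp
      linear_combination -f2
    · field_simp
      linear_combination -f1 - 2 * f2

/-- **Local solubility of `C_D` at primes `p > 3` dividing `D`.**
For a squarefree integer `D` and a prime `p > 3` dividing `D`, the curve `C_D` has a point
over `ℚ_p` (a nonzero tuple satisfying the three defining equations) if and only if
`p ≡ 1 (mod 24)`. -/
theorem CD_has_Qp_point_iff_of_dvd
    (D : ℤ) (hD : Squarefree D) (p : ℕ) [Fact p.Prime] (hp : 3 < p) (hpD : (p : ℤ) ∣ D) :
    (∃ x : Fin 5 → ℚ_[p], x ≠ 0 ∧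
      x 0 ^ 2 - 2 * x 1 ^ 2 + x 2 ^ 2 = 0 ∧
      x 1 ^ 2 - 2 * x 2 ^ 2 + (D : ℚ_[p]) * x 3 ^ 2 = 0 ∧
      x 2 ^ 2 - 2 * (D : ℚ_[p]) * x 3 ^ 2 + x 4 ^ 2 = 0) ↔ p % 24 = 1 := by
  rw [← CD_aux_mod hp]
  constructor
  · rintro ⟨x, hx, e1, e2, e3⟩
    obtain ⟨i, hi⟩ := Finite.exists_max (fun j => ‖x j‖)
    have hi0 : x i ≠ 0 := by
      intro h
      apply hx
      funext j
      have := hi j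
      simpa [h] using this
    have hn : ∀ j, ‖x j / x i‖ ≤ 1 := by
      intro j
      rw [norm_div]
      exact div_le_one_of_le₀ (hi j) (norm_nonneg _)
    have hex : ∀ j, ∃ z : ℤ_[p], (z : ℚ_[p]) = x j / x i := fun j => ⟨⟨x j / x i, hn j⟩, rfl⟩
    choose y hy using hex
    refine CD_aux_forward hD hpD y i ?_ ?_ ?_ ?_
    · apply PadicInt.ext
      simp [hy, hi0]
    · apply PadicInt.ext
      simp only [PadicInt.coe_add, PadicInt.coe_sub, PadicInt.coe_mul, PadicInt.coe_pow,
        PadicInt.coe_zero, hy]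
      rw [show ((2 : ℤ_[p]) : ℚ_[p]) = 2 from rfl]
      field_simp
      linear_combination e1
    · apply PadicInt.ext
      simp only [PadicInt.coe_add, PadicInt.coe_sub, PadicInt.coe_mul, PadicInt.coe_pow,
        PadicInt.coe_zero, PadicInt.coe_intCast, hy]
      rw [show ((2 : ℤ_[p]) : ℚ_[p]) = 2 from rfl]
      field_simp
      linear_combination e2
    · apply PadicInt.ext
      simp only [PadicInt.coe_add, PadicInt.coe_sub, PadicInt.coe_mul, PadicInt.coe_pow,
        PadicInt.coe_zero, PadicInt.coe_intCast, hy]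
      rw [show ((2 : ℤ_[p]) : ℚ_[p]) = 2 from rfl]
      field_simp
      linear_combination e3
  · rintro ⟨h1, h2, h3⟩
    have hne : ∀ n : ℕ, 0 < n → n ≤ 3 → ((n : ℕ) : ZMod p) ≠ 0 := by
      intro n hn hn3 h
      rw [ZMod.natCast_eq_zero_iff] at h
      have := Nat.le_of_dvd hn h
      omega
    obtain ⟨d, hd⟩ := CD_aux_sqrt hp (-1) (by simp) (by simpa using h1)
    obtain ⟨b, hb⟩ := CD_aux_sqrt hp 2 (by simpa using hne 2 (by norm_num) (by norm_num))
      (by simpa using h2)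
    obtain ⟨a, ha⟩ := CD_aux_sqrt hp 3 (by simpa using hne 3 (by norm_num) (by norm_num))
      (by simpa using h3)
    push_cast at hd hb ha
    refine ⟨![a, b, 1, 0, d], ?_, ?_, ?_, ?_⟩
    · intro h
      simpa using congrFun h 2
    · simp [ha, hb]; norm_num
    · simp [hb]
    · simp [hd]
end

section
/- Let D be a squarefree integer. The curve C_D has points in ℝ and in ℚ_p for every prime p (i.e. for each of these fields L there is a nonzero tuple in L⁵ satisfying the three defining equations) if and only if D > 0, D ≡ 1 (mod 24), D ≡ ±1 (mod 5), and every prime p dividing D satisfies p ≡ 1 (mod 24). -/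
/-- The curve `C_D` has a point over a field `F`: there is a nonzero tuple `(x₀,…,x₄) ∈ F⁵`
satisfying `x₀² − 2x₁² + x₂² = 0`, `x₁² − 2x₂² + D·x₃² = 0` and `x₂² − 2D·x₃² + x₄² = 0`. -/
def CDHasPoint (F : Type*) [Field F] (D : ℤ) : Prop :=
  ∃ x : Fin 5 → F, x ≠ 0 ∧
    x 0 ^ 2 - 2 * x 1 ^ 2 + x 2 ^ 2 = 0 ∧
    x 1 ^ 2 - 2 * x 2 ^ 2 + (D : F) * x 3 ^ 2 = 0 ∧
    x 2 ^ 2 - 2 * (D : F) * x 3 ^ 2 + x 4 ^ 2 = 0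


/-- Two-parameter form of the curve: five terms of an arithmetic progression. -/
lemma CD_of_AP {F : Type*} [Field F] (D : ℤ) (hD : (D : F) ≠ 0) (a r : F)
    (hne : a ≠ 0 ∨ r ≠ 0) (h0 : IsSquare a) (h1 : IsSquare (a + r)) (h2 : IsSquare (a + 2 * r))
    (h3 : IsSquare ((a + 3 * r) * D)) (h4 : IsSquare (a + 4 * r)) : CDHasPoint F D := by
  obtain ⟨x0, e0⟩ := h0
  obtain ⟨x1, e1⟩ := h1
  obtain ⟨x2, e2⟩ := h2
  obtain ⟨x3, e3⟩ := h3
  obtain ⟨x4, e4⟩ := h4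
  have e3' : (D : F) * (x3 / D) ^ 2 = a + 3 * r := by
    field_simp
    linear_combination -e3
  refine ⟨![x0, x1, x2, x3 / D, x4], ?_, ?_, ?_, ?_⟩
  · intro h
    have z0 : x0 = 0 := by simpa using congrFun h 0
    have z1 : x1 = 0 := by simpa using congrFun h 1
    have ha : a = 0 := by rw [e0, z0, mul_zero]
    have hr : r = 0 := by rw [ha, z1] at e1; simpa using e1
    exact hne.elim (fun h => h ha) (fun h => h hr)
  · show x0 ^ 2 - 2 * x1 ^ 2 + x2 ^ 2 = 0
    linear_combination -e0 + 2 * e1 - e2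
  · show x1 ^ 2 - 2 * x2 ^ 2 + (D : F) * (x3 / D) ^ 2 = 0
    rw [e3']; linear_combination -e1 + 2 * e2
  · show x2 ^ 2 - 2 * (D : F) * (x3 / D) ^ 2 + x4 ^ 2 = 0
    rw [mul_assoc, e3']; linear_combination -e2 - e4

lemma CD_of_isSquare {F : Type*} [Field F] (D : ℤ) (hD : (D : F) ≠ 0) (h : IsSquare (D : F)) :
    CDHasPoint F D := by
  apply CD_of_AP D hD 1 0 (Or.inl one_ne_zero) <;> simp [h]

lemma padic_sq_of_hensel (p : ℕ) [Fact p.Prime] (n : ℤ) (a : ℤ_[p])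
    (h : ‖a ^ 2 - (n : ℤ_[p])‖ < ‖2 * a‖ ^ 2) : IsSquare (n : ℚ_[p]) := by
  have := hensels_lemma (p := p) (F := (Polynomial.X ^ 2 - Polynomial.C n : Polynomial ℤ)) (a := a)
    (by
      have e1 : Polynomial.aeval a (Polynomial.X ^ 2 - Polynomial.C n : Polynomial ℤ)
          = a ^ 2 - (n : ℤ_[p]) := by simp
      have e2 : Polynomial.aeval a
          (Polynomial.derivative (Polynomial.X ^ 2 - Polynomial.C n : Polynomial ℤ))
          = 2 * a := by
        simp [Polynomial.derivative_pow, Polynomial.aeval_def, Polynomial.eval₂_mul]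
      rw [e1, e2]; exact h)
  obtain ⟨z, hz, -⟩ := this
  refine ⟨(z : ℚ_[p]), ?_⟩
  have hz' : z ^ 2 = (n : ℤ_[p]) := by
    have : z ^ 2 - (n : ℤ_[p]) = 0 := by simpa using hz
    exact sub_eq_zero.mp this
  have := congrArg (fun t : ℤ_[p] => (t : ℚ_[p])) hz'
  simp only [PadicInt.coe_pow, PadicInt.coe_intCast] at this
  rw [← this, sq]

lemma padic_sq_of_legendre (p : ℕ) [Fact p.Prime] (hp : p ≠ 2) (n : ℤ)
    (h : legendreSym p n = 1) : IsSquare (n : ℚ_[p]) := by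
  have hn0 : ((n : ℤ) : ZMod p) ≠ 0 := by
    intro h0
    rw [(legendreSym.eq_zero_iff p n).2 h0] at h
    exact zero_ne_one h
  obtain ⟨y, hy⟩ := (legendreSym.eq_one_iff p hn0).1 h
  obtain ⟨b, rfl⟩ := ZMod.intCast_surjective y
  have hb : ((b : ℤ) : ZMod p) ≠ 0 := by
    rintro h0
    rw [h0, mul_zero] at hy
    exact hn0 hy
  apply padic_sq_of_hensel p n (b : ℤ_[p])
  have e1 : ‖((b : ℤ_[p])) ^ 2 - (n : ℤ_[p])‖ < 1 := by
    have : ((b ^ 2 - n : ℤ) : ZMod p) = 0 := by push_cast; rw [hy]; ring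
    rw [ZMod.intCast_zmod_eq_zero_iff_dvd _ p] at this
    have := (PadicInt.norm_int_lt_one_iff_dvd (p := p) (b ^ 2 - n)).2 this
    simpa using this
  have e2 : ‖2 * (b : ℤ_[p])‖ = 1 := by
    have : ¬ (p : ℤ) ∣ 2 * b := by
      intro hd
      have hpp : Prime (p : ℤ) := Nat.prime_iff_prime_int.1 Fact.out
      rcases hpp.dvd_or_dvd hd with h2 | h2
      · have : p ∣ 2 := by exact_mod_cast h2
        exact hp ((Nat.prime_dvd_prime_iff_eq Fact.out Nat.prime_two).1 this)
      · exact hb ((ZMod.intCast_zmod_eq_zero_iff_dvd _ p).2 h2)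
    rw [← PadicInt.norm_int_lt_one_iff_dvd (p := p)] at this
    have h1 := PadicInt.norm_le_one (2 * (b : ℤ_[p]))
    push_cast at this
    exact le_antisymm h1 (not_lt.1 this)
  rw [e2]; simpa using e1

lemma padic_two_sq (n : ℤ) (h : n % 8 = 1) : IsSquare (n : ℚ_[2]) := by
  apply padic_sq_of_hensel 2 n 1
  have h8 : ((2 : ℕ) ^ 3 : ℤ) ∣ 1 - n := by norm_num; omega
  have h8' := (PadicInt.norm_int_le_pow_iff_dvd (p := 2) (k := 1 - n) (n := 3)).2 h8
  have e2 : ‖(2 : ℤ_[2])‖ = 1 / 2 := by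
    have := PadicInt.norm_p (p := 2)
    simpa using this
  rw [mul_one, e2]
  push_cast at h8'
  rw [one_pow]
  refine lt_of_le_of_lt h8' ?_
  norm_num [zpow_neg]

/-- The sign pattern used to produce points at primes where `D` is a non-residue. -/
def GoodPat (p : ℕ) [Fact p.Prime] : Prop :=
  ∃ a r e : ℤ, r ≠ 0 ∧ (e = 1 ∨ e = -1) ∧ (legendreSym p a = e ∨ a = 0) ∧
    (legendreSym p (a + r) = e ∨ a + r = 0) ∧ legendreSym p (a + 2 * r) = e ∧
    legendreSym p (a + 3 * r) = -e ∧ legendreSym p (a + 4 * r) = e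

lemma CD_of_pat (p : ℕ) [Fact p.Prime] (hp : p ≠ 2) (D : ℤ) (hD : legendreSym p D = -1)
    (h : GoodPat p) : CDHasPoint ℚ_[p] D := by
  obtain ⟨a, r, e, hr, he, h0, h1, h2, h3, h4⟩ := h
  have hD0 : D ≠ 0 := by rintro rfl; simp at hD
  have hDF : (D : ℚ_[p]) ≠ 0 := by exact_mod_cast hD0
  obtain ⟨c, hc0, hc⟩ : ∃ c : ℤ, c ≠ 0 ∧ legendreSym p c = e := by
    rcases he with rfl | rfl
    · exact ⟨1, one_ne_zero, legendreSym.at_one p⟩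
    · exact ⟨D, hD0, hD⟩
  have hee : e * e = 1 := by rcases he with rfl | rfl <;> norm_num
  have key : ∀ v : ℤ, legendreSym p v = e ∨ v = 0 → IsSquare ((c * v : ℤ) : ℚ_[p]) := by
    rintro v (hv | rfl)
    · apply padic_sq_of_legendre p hp
      rw [legendreSym.mul, hc, hv, hee]
    · simp
  have k0 := key _ h0
  have k1 := key _ h1
  have k2 := key _ (Or.inl h2)
  have k4 := key _ (Or.inl h4)
  have k3 : IsSquare ((c * (a + 3 * r) * D : ℤ) : ℚ_[p]) := by
    apply padic_sq_of_legendre p hp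
    rw [legendreSym.mul, legendreSym.mul, hc, h3, hD]; linear_combination hee
  refine CD_of_AP D hDF ((c * a : ℤ) : ℚ_[p]) ((c * r : ℤ) : ℚ_[p])
    (Or.inr (by exact_mod_cast mul_ne_zero hc0 hr)) k0 ?_ ?_ ?_ ?_
  · rwa [show ((c * a : ℤ) : ℚ_[p]) + ((c * r : ℤ) : ℚ_[p]) = ((c * (a + r) : ℤ) : ℚ_[p]) by
      push_cast; ring]
  · rwa [show ((c * a : ℤ) : ℚ_[p]) + 2 * ((c * r : ℤ) : ℚ_[p]) = ((c * (a + 2 * r) : ℤ) : ℚ_[p]) by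
      push_cast; ring]
  · rwa [show (((c * a : ℤ) : ℚ_[p]) + 3 * ((c * r : ℤ) : ℚ_[p])) * D
        = ((c * (a + 3 * r) * D : ℤ) : ℚ_[p]) by push_cast; ring]
  · rwa [show ((c * a : ℤ) : ℚ_[p]) + 4 * ((c * r : ℤ) : ℚ_[p]) = ((c * (a + 4 * r) : ℤ) : ℚ_[p]) by
      push_cast; ring]

lemma legendre_congr (m : ℕ) [Fact m.Prime] (a b : ℤ) (h : (m : ℤ) ∣ a - b) :
    legendreSym m a = legendreSym m b := by
  rw [legendreSym.mod m a, legendreSym.mod m b]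
  congr 1
  exact Int.emod_eq_emod_iff_emod_sub_eq_zero.2 (Int.emod_eq_zero_of_dvd h)

lemma legendre_pm (m : ℕ) [Fact m.Prime] (a : ℤ) (h : ¬ (m : ℤ) ∣ a) :
    legendreSym m a = 1 ∨ legendreSym m a = -1 :=
  legendreSym.eq_one_or_neg_one m
    (fun h0 => h ((ZMod.intCast_zmod_eq_zero_iff_dvd _ m).1 h0))

lemma family (p : ℕ) [Fact p.Prime] (m : ℕ) [Fact m.Prime] (hm : 3 ≤ m)
    (hneg : legendreSym p (-1) = legendreSym m (-1))
    (hbase : ∀ n : ℕ, 0 < n → n < m → legendreSym p n = legendreSym m n)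
    (H : ¬ GoodPat p) :
    ∀ n : ℕ, 0 < n → n < p → ¬ m ∣ n → legendreSym p n = legendreSym m n := by
  have hmodd : m % 2 = 1 := by
    rcases (Fact.out : m.Prime).eq_two_or_odd with h | h <;> omega
  intro n
  induction n using Nat.strong_induction_on with
  | _ n ih =>
  intro hn0 hnp hmn
  by_cases hlt : n < m
  · exact hbase n hn0 hlt
  have hnm : m < n := by
    rcases Nat.lt_or_eq_of_le (not_lt.1 hlt) with h | h
    · exact h
    · exact absurd (h ▸ dvd_refl _) hmn
  by_cases hpr : n.Prime
  swap
  · obtain ⟨a, had, ha2, han⟩ := Nat.exists_dvd_of_not_prime2 (by omega) hpr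
    obtain ⟨b, rfl⟩ := had
    have hb0 : 0 < b := by
      rcases Nat.eq_zero_or_pos b with rfl | h
      · simp at hn0
      · exact h
    have hbn : b < a * b := by nlinarith
    have ia := ih a han (by omega) (by omega) (fun h => hmn (h.mul_right _))
    have ib := ih b hbn hb0 (by omega) (fun h => hmn (h.mul_left _))
    push_cast
    rw [legendreSym.mul, legendreSym.mul, ia, ib]
  have hnodd : n % 2 = 1 := by
    rcases hpr.eq_two_or_odd with h | h <;> omega
  by_contra hne
  have hmz : ¬ (m : ℤ) ∣ (n : ℤ) := by exact_mod_cast hmn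
  have hpz : ¬ (p : ℤ) ∣ (n : ℤ) := by
    intro h
    have : p ∣ n := by exact_mod_cast h
    exact absurd (Nat.le_of_dvd hn0 this) (by omega)
  have pm1 := legendre_pm m n hmz
  have pm2 := legendre_pm p n hpz
  have hint : ∀ z : ℤ, z < n → -z < n → ¬ (m : ℤ) ∣ z → legendreSym p z = legendreSym m z := by
    intro z hz hz' hmz
    have hz0 : z ≠ 0 := by rintro rfl; simp at hmz
    rcases Int.natAbs_eq z with h | h
    · rw [h] at hmz ⊢
      exact ih z.natAbs (by omega) (by omega) (by omega) (by exact_mod_cast hmz)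
    · have h' : z = (-1) * (z.natAbs : ℤ) := by omega
      have hmz' : ¬ m ∣ z.natAbs := by rwa [← Int.natCast_dvd]
      rw [h', legendreSym.mul, legendreSym.mul, hneg,
        ih z.natAbs (by omega) (by omega) (by omega) hmz']
  have hint2 : ∀ z w : ℤ, z = 2 * w → z < 2 * n → -z < 2 * n → ¬ (m : ℤ) ∣ z →
      legendreSym p z = legendreSym m z := by
    rintro z w rfl h1 h2 h3
    have := hbase 2 (by norm_num) (by omega)
    push_cast at this
    rw [legendreSym.mul, legendreSym.mul, this,
      hint w (by omega) (by omega) (fun h => h3 (h.mul_left _))]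
  have hper : ∀ k : ℤ, legendreSym m (n + k * m) = legendreSym m n ∧ ¬ (m : ℤ) ∣ n + k * m := by
    intro k
    refine ⟨legendre_congr m _ _ ⟨k, by ring⟩, fun h => hmz ?_⟩
    exact (dvd_add_left (Dvd.intro_left k rfl)).1 h
  apply H
  refine ⟨n + (-3) * m, m, legendreSym m n, by omega, pm1, Or.inl ?_, Or.inl ?_, ?_, ?_, ?_⟩
  · rw [← (hper (-3)).1]
    exact hint2 _ (((n : ℤ) + (-3) * m) / 2) (by omega) (by omega) (by omega) (hper (-3)).2
  · rw [show (n : ℤ) + (-3) * m + m = n + (-2) * m by ring, ← (hper (-2)).1]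
    exact hint _ (by omega) (by omega) (hper (-2)).2
  · rw [show (n : ℤ) + (-3) * m + 2 * m = n + (-1) * m by ring, ← (hper (-1)).1]
    exact hint _ (by omega) (by omega) (hper (-1)).2
  · rw [show (n : ℤ) + (-3) * m + 3 * m = n by ring]
    rcases pm1 with h | h <;> rcases pm2 with h' | h' <;> rw [h, h'] at hne ⊢ <;>
      first | exact absurd rfl hne | norm_num
  · rw [show (n : ℤ) + (-3) * m + 4 * m = n + 1 * m by ring, ← (hper 1).1]
    exact hint2 _ (((n : ℤ) + 1 * m) / 2) (by omega) (by omega) (by omega) (hper 1).2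

lemma family_one (p : ℕ) [Fact p.Prime] (h2 : legendreSym p 2 = 1) (H : ¬ GoodPat p) :
    ∀ n : ℕ, 0 < n → n < p → legendreSym p n = 1 := by
  intro n
  induction n using Nat.strong_induction_on with
  | _ n ih =>
  intro hn0 hnp
  by_cases h1 : n = 1
  · subst h1; simp
  by_cases h2' : n = 2
  · subst h2'; exact_mod_cast h2
  by_cases hpr : n.Prime
  swap
  · obtain ⟨a, had, ha2, han⟩ := Nat.exists_dvd_of_not_prime2 (by omega) hpr
    obtain ⟨b, rfl⟩ := had
    have hb0 : 0 < b := by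
      rcases Nat.eq_zero_or_pos b with rfl | h
      · simp at hn0
      · exact h
    have hbn : b < a * b := by nlinarith
    push_cast
    rw [legendreSym.mul, ih a han (by omega) (by omega), ih b hbn hb0 (by omega), mul_one]
  have hnodd : n % 2 = 1 := by
    rcases hpr.eq_two_or_odd with h | h <;> omega
  by_contra hne
  have hpz : ¬ (p : ℤ) ∣ (n : ℤ) := by
    intro h
    have : p ∣ n := by exact_mod_cast h
    exact absurd (Nat.le_of_dvd hn0 this) (by omega)
  have hm1 := (legendre_pm p n hpz).resolve_left hne
  have hint : ∀ z : ℤ, 0 < z → z < n → legendreSym p z = 1 := by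
    intro z hz hz'
    lift z to ℕ using hz.le
    exact ih z (by omega) (by omega) (by omega)
  apply H
  refine ⟨n - 3, 1, 1, one_ne_zero, Or.inl rfl, ?_, Or.inl ?_, ?_, ?_, ?_⟩
  · by_cases h3 : n = 3
    · right; omega
    · left; exact hint _ (by omega) (by omega)
  · exact hint _ (by omega) (by omega)
  · exact hint _ (by omega) (by omega)
  · rw [show (n : ℤ) - 3 + 3 * 1 = n by ring, hm1]
  · rw [show (n : ℤ) - 3 + 4 * 1 = 2 * (((n : ℤ) + 1) / 2) by omega, legendreSym.mul, h2,
      hint _ (by omega) (by omega), mul_one]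

instance fact_prime_five_aux : Fact (Nat.Prime 5) := ⟨by norm_num⟩

lemma goodPat_of_seven_le (p : ℕ) [Fact p.Prime] (hp : 7 ≤ p) (D : ℤ)
    (hD : legendreSym p D = -1) : GoodPat p := by
  by_contra H
  have hnd : ∀ k : ℤ, 0 < k → k < p → ¬ (p : ℤ) ∣ k := fun k h1 h2 h =>
    absurd (Int.le_of_dvd h1 h) (by omega)
  have hnd' : ¬ (p : ℤ) ∣ -1 := by
    rw [dvd_neg]; exact hnd 1 (by omega) (by omega)
  rcases legendre_pm p 2 (hnd 2 (by omega) (by omega)) with h2 | h2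
  · have hf := family_one p h2 H
    have hDp : ¬ (p : ℤ) ∣ D := by
      intro h
      rw [(legendreSym.eq_zero_iff p D).2 ((ZMod.intCast_zmod_eq_zero_iff_dvd _ p).2 h)] at hD
      norm_num at hD
    rw [legendreSym.mod] at hD
    have h0 : 0 ≤ D % p := Int.emod_nonneg _ (by omega)
    have h1 : D % p < p := Int.emod_lt_of_pos _ (by omega)
    have h3 : D % p ≠ 0 := fun h => hDp (Int.dvd_of_emod_eq_zero h)
    have := hf (D % p).toNat (by omega) (by omega)
    rw [Int.toNat_of_nonneg h0, hD] at this
    norm_num at this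
  have hpk : ∀ k : ℕ, k < p → legendreSym p ((p - k : ℕ) : ℤ) = legendreSym p (-1) * legendreSym p k := by
    intro k hk
    rw [← legendreSym.mul]
    apply legendre_congr
    exact ⟨1, by omega⟩
  rcases legendre_pm p (-1) hnd' with hm | hm
  · rcases legendre_pm p 3 (hnd 3 (by omega) (by omega)) with h3 | h3
    · exact H ⟨-1, 1, 1, one_ne_zero, Or.inl rfl, Or.inl hm, Or.inr (by norm_num),
        by norm_num, by norm_num [h2], by norm_num [h3]⟩
    · have t1 : legendreSym 5 1 = 1 := by decide
      have t2 : legendreSym 5 2 = -1 := by decide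
      have t3 : legendreSym 5 3 = -1 := by decide
      have t4 : legendreSym 5 4 = 1 := by decide
      have tm : legendreSym 5 (-1) = 1 := by decide
      have hf := family p 5 (by norm_num) (by rw [hm, tm]) (by
        intro n h0 h5
        interval_cases n
        · simp
        · push_cast; rw [h2, t2]
        · push_cast; rw [h3, t3]
        · push_cast; rw [t4, show (4 : ℤ) = 2 * 2 by norm_num, legendreSym.mul, h2]; norm_num) H
      have h5 : p % 5 ≠ 0 := by
        intro h
        have := (Nat.prime_dvd_prime_iff_eq (by norm_num) (Fact.out : p.Prime)).1 (Nat.dvd_of_mod_eq_zero h)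
        omega
      have c2 := hpk 2 (by omega)
      have c3 := hpk 3 (by omega)
      push_cast at c2 c3
      rw [hm, h2] at c2
      rw [hm, h3] at c3
      have : p % 5 = 1 ∨ p % 5 = 2 ∨ p % 5 = 3 ∨ p % 5 = 4 := by omega
      rcases this with h | h | h | h
      · rw [hf (p - 2) (by omega) (by omega) (by omega),
          legendre_congr 5 _ 4 (by omega), t4] at c2
        norm_num at c2
      · rw [hf (p - 3) (by omega) (by omega) (by omega),
          legendre_congr 5 _ 4 (by omega), t4] at c3
        norm_num at c3
      · rw [hf (p - 2) (by omega) (by omega) (by omega),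
          legendre_congr 5 _ 1 (by omega), t1] at c2
        norm_num at c2
      · rw [hf (p - 3) (by omega) (by omega) (by omega),
          legendre_congr 5 _ 1 (by omega), t1] at c3
        norm_num at c3
  · have t1 : legendreSym 3 1 = 1 := by decide
    have t2 : legendreSym 3 2 = -1 := by decide
    have tm : legendreSym 3 (-1) = -1 := by decide
    have hf := family p 3 (by norm_num) (by rw [hm, tm]) (by
      intro n h0 h5
      interval_cases n
      · simp
      · push_cast; rw [h2, t2]) H
    have h5 : p % 3 ≠ 0 := by
      intro h
      have := (Nat.prime_dvd_prime_iff_eq (by norm_num) (Fact.out : p.Prime)).1 (Nat.dvd_of_mod_eq_zero h)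
      omega
    have c1 := hpk 1 (by omega)
    have c2 := hpk 2 (by omega)
    push_cast at c1 c2
    rw [hm, legendreSym.at_one] at c1
    rw [hm, h2] at c2
    have : p % 3 = 1 ∨ p % 3 = 2 := by omega
    rcases this with h | h
    · rw [hf (p - 2) (by omega) (by omega) (by omega),
        legendre_congr 3 _ 2 (by omega), t2] at c2
      norm_num at c2
    · rw [hf (p - 1) (by omega) (by omega) (by omega),
        legendre_congr 3 _ 1 (by omega), t1] at c1
      norm_num at c1

lemma CD_primitive (p : ℕ) [Fact p.Prime] (D : ℤ) (h : CDHasPoint ℚ_[p] D) :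
    ∃ y : Fin 5 → ℤ_[p], (∃ i, IsUnit (y i)) ∧
      y 0 ^ 2 - 2 * y 1 ^ 2 + y 2 ^ 2 = 0 ∧
      y 1 ^ 2 - 2 * y 2 ^ 2 + (D : ℤ_[p]) * y 3 ^ 2 = 0 ∧
      y 2 ^ 2 - 2 * (D : ℤ_[p]) * y 3 ^ 2 + y 4 ^ 2 = 0 := by
  obtain ⟨x, hx, e1, e2, e3⟩ := h
  obtain ⟨i, hi⟩ := Finite.exists_max (fun i => ‖x i‖)
  have hxi : x i ≠ 0 := by
    intro h0
    apply hx
    funext j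
    have := hi j
    simp only [h0, norm_zero] at this
    exact norm_le_zero_iff.1 this
  have hle : ∀ j, ‖x j / x i‖ ≤ 1 := by
    intro j
    rw [norm_div]
    exact div_le_one_of_le₀ (hi j) (norm_nonneg _)
  obtain ⟨y, hy⟩ : ∃ y : Fin 5 → ℤ_[p], ∀ j, (y j : ℚ_[p]) = x j / x i :=
    ⟨fun j => ⟨x j / x i, hle j⟩, fun j => rfl⟩
  refine ⟨y, ⟨i, ?_⟩, ?_, ?_, ?_⟩
  · have : y i = 1 := by
      apply PadicInt.ext
      rw [hy, div_self hxi, PadicInt.coe_one]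
    rw [this]; exact isUnit_one
  · apply PadicInt.ext
    have h2 : ((2 : ℤ_[p]) : ℚ_[p]) = 2 := rfl
    push_cast
    rw [hy, hy, hy, h2]
    field_simp
    linear_combination e1
  · apply PadicInt.ext
    have h2 : ((2 : ℤ_[p]) : ℚ_[p]) = 2 := rfl
    push_cast
    rw [hy, hy, hy, h2]
    field_simp
    linear_combination e2
  · apply PadicInt.ext
    have h2 : ((2 : ℤ_[p]) : ℚ_[p]) = 2 := rfl
    push_cast
    rw [hy, hy, hy, h2]
    field_simp
    linear_combination e3

lemma toZMod_unit_ne (p : ℕ) [Fact p.Prime] (y : ℤ_[p]) (h : IsUnit y) :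
    PadicInt.toZMod y ≠ 0 := (h.map PadicInt.toZMod).ne_zero

lemma toZMod_eq_zero (p : ℕ) [Fact p.Prime] (y : ℤ_[p]) (h : PadicInt.toZMod y = 0) :
    (p : ℤ_[p]) ∣ y := by
  have : y ∈ RingHom.ker (PadicInt.toZMod (p := p)) := h
  rwa [PadicInt.ker_toZMod, PadicInt.maximalIdeal_eq_span_p, Ideal.mem_span_singleton] at this

lemma CD_mod_p (p : ℕ) [Fact p.Prime] (D : ℤ) (h : CDHasPoint ℚ_[p] D) :
    ∃ z : Fin 5 → ZMod p, (∃ i, z i ≠ 0) ∧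
      z 0 ^ 2 - 2 * z 1 ^ 2 + z 2 ^ 2 = 0 ∧
      z 1 ^ 2 - 2 * z 2 ^ 2 + (D : ZMod p) * z 3 ^ 2 = 0 ∧
      z 2 ^ 2 - 2 * (D : ZMod p) * z 3 ^ 2 + z 4 ^ 2 = 0 := by
  obtain ⟨y, ⟨i, hi⟩, e1, e2, e3⟩ := CD_primitive p D h
  refine ⟨fun j => PadicInt.toZMod (y j), ⟨i, toZMod_unit_ne p _ hi⟩, ?_, ?_, ?_⟩
  · simpa only [map_add, map_sub, map_mul, map_pow, map_intCast, map_ofNat, map_zero] using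
      congrArg (PadicInt.toZMod (p := p)) e1
  · simpa only [map_add, map_sub, map_mul, map_pow, map_intCast, map_ofNat, map_zero] using
      congrArg (PadicInt.toZMod (p := p)) e2
  · simpa only [map_add, map_sub, map_mul, map_pow, map_intCast, map_ofNat, map_zero] using
      congrArg (PadicInt.toZMod (p := p)) e3

lemma CD_dvd (p : ℕ) [Fact p.Prime] (D : ℤ) (hD : Squarefree D) (hpD : (p : ℤ) ∣ D)
    (h : CDHasPoint ℚ_[p] D) :
    IsSquare (-1 : ZMod p) ∧ IsSquare (2 : ZMod p) ∧ IsSquare (3 : ZMod p) := by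
  obtain ⟨y, ⟨i, hi⟩, e1, e2, e3⟩ := CD_primitive p D h
  have hD0 : (D : ZMod p) = 0 := (ZMod.intCast_zmod_eq_zero_iff_dvd _ p).2 hpD
  have f1 := congrArg (PadicInt.toZMod (p := p)) e1
  have f2 := congrArg (PadicInt.toZMod (p := p)) e2
  have f3 := congrArg (PadicInt.toZMod (p := p)) e3
  simp only [map_add, map_sub, map_mul, map_pow, map_intCast, map_ofNat, map_zero, hD0] at f1 f2 f3
  set z0 := PadicInt.toZMod (y 0) with hz0
  set z1 := PadicInt.toZMod (y 1) with hz1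
  set z2 := PadicInt.toZMod (y 2) with hz2
  set z4 := PadicInt.toZMod (y 4) with hz4
  by_cases h2 : z2 = 0
  · exfalso
    have h1 : z1 = 0 := by
      rw [h2] at f2
      exact pow_eq_zero_iff (two_ne_zero) |>.1 (by linear_combination f2)
    have h4 : z4 = 0 := by
      rw [h2] at f3
      exact pow_eq_zero_iff (two_ne_zero) |>.1 (by linear_combination f3)
    have h0 : z0 = 0 := by
      rw [h1, h2] at f1
      exact pow_eq_zero_iff (two_ne_zero) |>.1 (by linear_combination f1)
    obtain ⟨u1, hu1⟩ := toZMod_eq_zero p _ h1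
    obtain ⟨u2, hu2⟩ := toZMod_eq_zero p _ h2
    obtain ⟨d, rfl⟩ := hpD
    have hpp := PadicInt.prime_p (p := p)
    have hd : ¬ (p : ℤ) ∣ d := by
      intro hd
      have hu := hD (p : ℤ) (mul_dvd_mul_left _ hd)
      exact (Nat.prime_iff_prime_int.1 (Fact.out : p.Prime)).not_isUnit hu
    have hd' : ¬ (p : ℤ_[p]) ∣ (d : ℤ_[p]) := by
      rwa [← PadicInt.norm_lt_one_iff_dvd, PadicInt.norm_int_lt_one_iff_dvd]
    have h3 : (p : ℤ_[p]) ∣ y 3 := by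
      have : (p : ℤ_[p]) ∣ (d : ℤ_[p]) * y 3 ^ 2 := by
        refine ⟨2 * u2 ^ 2 - u1 ^ 2, mul_left_cancel₀ hpp.ne_zero ?_⟩
        rw [hu1, hu2] at e2
        push_cast at e2
        linear_combination e2
      exact hpp.dvd_of_dvd_pow ((hpp.dvd_or_dvd this).resolve_left hd')
    have hz3 : PadicInt.toZMod (y 3) = 0 := by
      obtain ⟨u, hu⟩ := h3
      rw [hu]; simp
    apply toZMod_unit_ne p _ hi
    fin_cases i
    · exact h0
    · exact h1
    · exact h2
    · exact hz3
    · exact h4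
  · refine ⟨⟨z4 / z2, ?_⟩, ⟨z1 / z2, ?_⟩, ⟨z0 / z2, ?_⟩⟩
    · field_simp; linear_combination -f3
    · field_simp; linear_combination -f2
    · field_simp; linear_combination -f1 - 2 * f2

lemma CD_real (D : ℤ) (h0 : D ≠ 0) (h : CDHasPoint ℝ D) : 0 < D := by
  obtain ⟨x, hx, e1, e2, e3⟩ := h
  by_contra hn
  have hneg : (D : ℝ) < 0 := by exact_mod_cast lt_of_le_of_ne (not_lt.1 hn) h0
  have h3 : x 3 = 0 := by
    by_contra h
    have : 0 < x 3 ^ 2 := by positivity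
    nlinarith [sq_nonneg (x 2), sq_nonneg (x 4)]
  rw [h3] at e2 e3
  have h2 : x 2 = 0 := by
    apply pow_eq_zero_iff two_ne_zero |>.1
    nlinarith [sq_nonneg (x 2), sq_nonneg (x 4)]
  have h4 : x 4 = 0 := by
    apply pow_eq_zero_iff two_ne_zero |>.1
    nlinarith [sq_nonneg (x 2), sq_nonneg (x 4)]
  rw [h2] at e2 e1
  have h1 : x 1 = 0 := by
    apply pow_eq_zero_iff two_ne_zero |>.1
    linear_combination e2
  rw [h1] at e1
  have h0 : x 0 = 0 := by
    apply pow_eq_zero_iff two_ne_zero |>.1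
    linear_combination e1
  apply hx
  funext j
  fin_cases j <;> simp [h0, h1, h2, h3, h4]

lemma CD_three (D : ℤ) (hD : Squarefree D) (h : CDHasPoint ℚ_[3] D) : D % 3 = 1 := by
  have h0 : D % 3 ≠ 0 := by
    intro h0
    have := (CD_dvd 3 D hD (by omega) h).1
    revert this; decide
  obtain ⟨z, ⟨i, hi⟩, e1, e2, e3⟩ := CD_mod_p 3 D h
  by_contra h1
  have hd : (D : ZMod 3) = 2 := by
    have : ((D : ℤ) : ZMod 3) = ((2 : ℤ) : ZMod 3) :=
      (ZMod.intCast_eq_intCast_iff_dvd_sub _ _ 3).2 (by omega)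
    simpa using this
  rw [hd] at e2 e3
  have key : ∀ a b c d e : ZMod 3, a ^ 2 - 2 * b ^ 2 + c ^ 2 = 0 → b ^ 2 - 2 * c ^ 2 + 2 * d ^ 2 = 0 →
      c ^ 2 - 2 * 2 * d ^ 2 + e ^ 2 = 0 → a = 0 ∧ b = 0 ∧ c = 0 ∧ d = 0 ∧ e = 0 := by decide
  obtain ⟨k0, k1, k2, k3, k4⟩ := key _ _ _ _ _ e1 e2 e3
  apply hi
  fin_cases i
  exacts [k0, k1, k2, k3, k4]

lemma key_five : ∀ D : ZMod 5, (D = 2 ∨ D = 3) → ∀ s0 s1 s2 s3 s4 : ZMod 5,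
    (s0 = 0 ∨ s0 = 1 ∨ s0 = 4) → (s1 = 0 ∨ s1 = 1 ∨ s1 = 4) → (s2 = 0 ∨ s2 = 1 ∨ s2 = 4) →
    (s3 = 0 ∨ s3 = 1 ∨ s3 = 4) → (s4 = 0 ∨ s4 = 1 ∨ s4 = 4) →
    s0 - 2 * s1 + s2 = 0 → s1 - 2 * s2 + D * s3 = 0 → s2 - 2 * D * s3 + s4 = 0 →
    s0 = 0 ∧ s1 = 0 ∧ s2 = 0 ∧ s3 = 0 ∧ s4 = 0 := by
  rintro D (rfl | rfl) s0 s1 s2 s3 s4 (rfl | rfl | rfl) (rfl | rfl | rfl) (rfl | rfl | rfl)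
    (rfl | rfl | rfl) (rfl | rfl | rfl) <;> decide

lemma CD_five (D : ℤ) (hD : Squarefree D) (h : CDHasPoint ℚ_[5] D) : D % 5 = 1 ∨ D % 5 = 4 := by
  have h0 : D % 5 ≠ 0 := by
    intro h0
    have := (CD_dvd 5 D hD (by omega) h).2.1
    revert this; decide
  obtain ⟨z, ⟨i, hi⟩, e1, e2, e3⟩ := CD_mod_p 5 D h
  by_contra h1
  have hd : (D : ZMod 5) = 2 ∨ (D : ZMod 5) = 3 := by
    have : D % 5 = 2 ∨ D % 5 = 3 := by omega
    rcases this with h | h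
    · left
      have : ((D : ℤ) : ZMod 5) = ((2 : ℤ) : ZMod 5) :=
        (ZMod.intCast_eq_intCast_iff_dvd_sub _ _ 5).2 (by omega)
      simpa using this
    · right
      have : ((D : ℤ) : ZMod 5) = ((3 : ℤ) : ZMod 5) :=
        (ZMod.intCast_eq_intCast_iff_dvd_sub _ _ 5).2 (by omega)
      simpa using this
  have sq : ∀ a : ZMod 5, a ^ 2 = 0 ∨ a ^ 2 = 1 ∨ a ^ 2 = 4 := by decide
  obtain ⟨k0, k1, k2, k3, k4⟩ := key_five _ hd _ _ _ _ _ (sq _) (sq _) (sq _) (sq _) (sq _) e1 e2 e3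
  apply hi
  apply pow_eq_zero_iff two_ne_zero |>.1
  fin_cases i
  exacts [k0, k1, k2, k3, k4]

lemma key_two : ∀ D : ZMod 8, (D ≠ 0 ∧ D ≠ 4 ∧ D ≠ 1) → ∀ s0 s1 s2 s3 s4 : ZMod 8,
    (s0 = 0 ∨ s0 = 1 ∨ s0 = 4) → (s1 = 0 ∨ s1 = 1 ∨ s1 = 4) → (s2 = 0 ∨ s2 = 1 ∨ s2 = 4) →
    (s3 = 0 ∨ s3 = 1 ∨ s3 = 4) → (s4 = 0 ∨ s4 = 1 ∨ s4 = 4) →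
    s0 - 2 * s1 + s2 = 0 → s1 - 2 * s2 + D * s3 = 0 → s2 - 2 * D * s3 + s4 = 0 →
    s0 ≠ 1 ∧ s1 ≠ 1 ∧ s2 ≠ 1 ∧ s3 ≠ 1 ∧ s4 ≠ 1 := by
  intro D hD s0 s1 s2 s3 s4 h0 h1 h2 h3 h4 e1
  have hD' : D = 2 ∨ D = 3 ∨ D = 5 ∨ D = 6 ∨ D = 7 := by
    revert D; decide
  rcases h0 with rfl | rfl | rfl <;> rcases h1 with rfl | rfl | rfl <;>
  rcases h2 with rfl | rfl | rfl <;>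
  first
  | exact absurd e1 (by decide)
  | (clear hD
     rcases hD' with rfl | rfl | rfl | rfl | rfl <;> rcases h3 with rfl | rfl | rfl <;>
     rcases h4 with rfl | rfl | rfl <;> decide)

lemma CD_two (D : ℤ) (hD : Squarefree D) (h : CDHasPoint ℚ_[2] D) : D % 8 = 1 := by
  have h4 : ¬ (4 : ℤ) ∣ D := by
    intro h4
    have := hD 2 (by norm_num; exact h4)
    rw [Int.isUnit_iff] at this
    omega
  by_contra h1
  obtain ⟨y, ⟨i, hi⟩, e1, e2, e3⟩ := CD_primitive 2 D h
  let f : ℤ_[2] →+* ZMod 8 := PadicInt.toZModPow (p := 2) 3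
  have g1 := congrArg f e1
  have g2 := congrArg f e2
  have g3 := congrArg f e3
  simp only [map_add, map_sub, map_mul, map_pow, map_intCast, map_ofNat, map_zero] at g1 g2 g3
  have sq : ∀ a : ZMod 8, a ^ 2 = 0 ∨ a ^ 2 = 1 ∨ a ^ 2 = 4 := by decide
  have hne : ∀ k : ℤ, ¬ (8 : ℤ) ∣ k - D → (D : ZMod 8) ≠ (k : ZMod 8) := by
    intro k hk he
    exact hk ((ZMod.intCast_eq_intCast_iff_dvd_sub _ _ 8).1 he)
  have hd : (D : ZMod 8) ≠ 0 ∧ (D : ZMod 8) ≠ 4 ∧ (D : ZMod 8) ≠ 1 := by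
    refine ⟨?_, ?_, ?_⟩
    · simpa using hne 0 (by omega)
    · simpa using hne 4 (by omega)
    · simpa using hne 1 (by omega)
  obtain ⟨k0, k1, k2, k3, k4⟩ := key_two _ hd _ _ _ _ _ (sq _) (sq _) (sq _) (sq _) (sq _) g1 g2 g3
  have hu : f (y i) ^ 2 = 1 := by
    have hu := hi.map f
    have : ∀ a b : ZMod 8, a * b = 1 → a ^ 2 = 1 := by decide
    obtain ⟨b, hb⟩ := hu.exists_right_inv
    exact this _ _ hb
  revert hu
  fin_cases i
  exacts [k0, k1, k2, k3, k4]

theorem CD_everywhere_locally_soluble_iff (D : ℤ) (hD : Squarefree D) :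
    (CDHasPoint ℝ D ∧ ∀ (p : ℕ) [Fact p.Prime], CDHasPoint ℚ_[p] D) ↔
      (0 < D ∧ D % 24 = 1 ∧ (D % 5 = 1 ∨ D % 5 = 4) ∧
        ∀ p : ℕ, p.Prime → (p : ℤ) ∣ D → p % 24 = 1) := by
  have hD0 : D ≠ 0 := hD.ne_zero
  constructor
  · rintro ⟨hR, hp⟩
    have d2 := CD_two D hD (hp 2)
    have d3 := CD_three D hD (hp 3)
    refine ⟨CD_real D hD0 hR, by omega, CD_five D hD (hp 5), ?_⟩
    intro p hpp hpD
    have : Fact p.Prime := ⟨hpp⟩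
    obtain ⟨s1, s2, s3⟩ := CD_dvd p D hD hpD (hp p)
    have hp2 : p ≠ 2 := by rintro rfl; push_cast at hpD; omega
    have hp3 : p ≠ 3 := by rintro rfl; push_cast at hpD; omega
    rw [ZMod.exists_sq_eq_neg_one_iff] at s1
    rw [ZMod.exists_sq_eq_two_iff hp2] at s2
    have hp4 : p % 4 = 1 := by omega
    have s3' := (ZMod.exists_sq_eq_prime_iff_of_mod_four_eq_one (p := p) (q := 3) hp4
      (by norm_num)).1 (by exact_mod_cast s3)
    have h3 : p % 3 = 1 := by
      by_contra h
      have h0 : p % 3 ≠ 0 := by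
        intro h0
        exact hp3 ((Nat.prime_dvd_prime_iff_eq Nat.prime_three hpp).1
          (Nat.dvd_of_mod_eq_zero h0)).symm
      have : (p : ZMod 3) = 2 := by
        have : ((p : ℕ) : ZMod 3) = ((2 : ℕ) : ZMod 3) :=
          (ZMod.natCast_eq_natCast_iff' _ _ 3).2 (by omega)
        simpa using this
      rw [this] at s3'
      revert s3'; decide
    omega
  · rintro ⟨hpos, h24, h5, hdiv⟩
    constructor
    · have : (0 : ℝ) < D := by exact_mod_cast hpos
      exact CD_of_isSquare D this.ne' ⟨√(D : ℝ), (Real.mul_self_sqrt this.le).symm⟩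
    intro p hp
    have hDp : (D : ℚ_[p]) ≠ 0 := by exact_mod_cast hD0
    by_cases hp2 : p = 2
    · subst hp2
      exact CD_of_isSquare D hDp (padic_two_sq D (by omega))
    by_cases hpD : (p : ℤ) ∣ D
    · have h1 := hdiv p hp.out hpD
      have hnd : ∀ k : ℤ, 0 < k → k < 5 → ¬ (p : ℤ) ∣ k := by
        intro k h1 h2 h
        have := Int.le_of_dvd h1 h
        have := hp.out.two_le
        omega
      have nz : ∀ k : ℤ, 0 < k → k < 5 → ((k : ℤ) : ZMod p) ≠ 0 := fun k h1 h2 h =>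
        hnd k h1 h2 ((ZMod.intCast_zmod_eq_zero_iff_dvd _ p).1 h)
      have n1 : legendreSym p (-1) = 1 := by
        refine (legendreSym.eq_one_iff p ?_).2 ?_
        · have := nz 1 (by norm_num) (by norm_num)
          simpa using this
        · have : IsSquare (-1 : ZMod p) := ZMod.exists_sq_eq_neg_one_iff.2 (by omega)
          simpa using this
      have n2 : legendreSym p 2 = 1 := by
        refine (legendreSym.eq_one_iff p (nz 2 (by norm_num) (by norm_num))).2 ?_
        have : IsSquare (2 : ZMod p) := (ZMod.exists_sq_eq_two_iff hp2).2 (by omega)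
        simpa using this
      have n3 : legendreSym p 3 = 1 := by
        refine (legendreSym.eq_one_iff p (nz 3 (by norm_num) (by norm_num))).2 ?_
        have h31 : (p : ZMod 3) = 1 := by
          have : ((p : ℕ) : ZMod 3) = ((1 : ℕ) : ZMod 3) :=
            (ZMod.natCast_eq_natCast_iff' _ _ 3).2 (by omega)
          simpa using this
        have : IsSquare ((3 : ℕ) : ZMod p) :=
          (ZMod.exists_sq_eq_prime_iff_of_mod_four_eq_one (p := p) (q := 3) (by omega)
            (by norm_num)).2 (by rw [h31]; exact IsSquare.one)
        simpa using this
      have q1 : IsSquare ((-1 : ℤ) : ℚ_[p]) := padic_sq_of_legendre p hp2 _ n1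
      have q2 : IsSquare ((-1 * 2 : ℤ) : ℚ_[p]) :=
        padic_sq_of_legendre p hp2 _ (by rw [legendreSym.mul, n1, n2, one_mul])
      have q3 : IsSquare ((-1 * 3 : ℤ) : ℚ_[p]) :=
        padic_sq_of_legendre p hp2 _ (by rw [legendreSym.mul, n1, n3, one_mul])
      push_cast at q1 q2 q3
      refine CD_of_AP D hDp (-3) 1 (Or.inr one_ne_zero) ?_ ?_ ?_ ?_ ?_
      · exact q3
      · rwa [show (-3 : ℚ_[p]) + 1 = -2 by norm_num]
      · rwa [show (-3 : ℚ_[p]) + 2 * 1 = -1 by norm_num]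
      · norm_num
      · norm_num
    rcases legendre_pm p D hpD with hl | hl
    · exact CD_of_isSquare D hDp (padic_sq_of_legendre p hp2 D hl)
    have hp3 : p ≠ 3 := by
      rintro rfl
      rw [legendre_congr 3 D 1 (by omega), legendreSym.at_one] at hl
      norm_num at hl
    have hp5 : p ≠ 5 := by
      rintro rfl
      rcases h5 with h | h
      · rw [legendre_congr 5 D 1 (by omega), legendreSym.at_one] at hl
        norm_num at hl
      · rw [legendre_congr 5 D (2 * 2) (by omega), legendreSym.mul] at hl
        nlinarith [mul_self_nonneg (legendreSym 5 2)]
    have hp7 : 7 ≤ p := by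
      by_contra h
      have := hp.out.two_le
      have h4 : p ≠ 4 := by rintro rfl; exact absurd hp.out (by norm_num)
      have h6 : p ≠ 6 := by rintro rfl; exact absurd hp.out (by norm_num)
      omega
    exact CD_of_pat p hp2 D hl (goodPat_of_seven_le p hp7 D hl)
end

section
/- Let D be a squarefree integer and q > 3 a prime dividing D. Let (x₀,…,x₄) ∈ ℤ⁵ be a tuple with gcd(x₀,…,x₄) = 1 satisfying x₀² − 2x₁² + x₂² = 0, x₁² − 2x₂² + D·x₃² = 0 and x₂² − 2D·x₃² + x₄² = 0. Then q does not divide x₄, and x₀² ≡ −3x₄², x₁² ≡ −2x₄², x₂² ≡ −x₄² (mod q); in particular the x-coordinate 6x₀²/x₄² of the associated point of E⁽¹⁾ : y² = x(x+2)(x+6) is a q-integral rational number congruent to −18 modulo q. -/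
/-- **Reduction of primitive integer points of `C_D` modulo a prime `q > 3` dividing `D`.**
If `q > 3` is a prime dividing the squarefree integer `D` and `(x₀,…,x₄) ∈ ℤ⁵` is a primitive
tuple satisfying the three equations of `C_D`, then `q ∤ x₄` and
`x₀² ≡ −3x₄²`, `x₁² ≡ −2x₄²`, `x₂² ≡ −x₄² (mod q)`; in particular the rational number
`6x₀²/x₄²` is `q`-integral and congruent to `−18` modulo `q`. -/
theorem CD_primitive_point_reduction_mod_q
    (D : ℤ) (hD : Squarefree D) (q : ℕ) (hq : q.Prime) (hq3 : 3 < q) (hqD : (q : ℤ) ∣ D)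
    (x : Fin 5 → ℤ) (hgcd : Finset.univ.gcd x = 1)
    (h1 : x 0 ^ 2 - 2 * x 1 ^ 2 + x 2 ^ 2 = 0)
    (h2 : x 1 ^ 2 - 2 * x 2 ^ 2 + D * x 3 ^ 2 = 0)
    (h3 : x 2 ^ 2 - 2 * D * x 3 ^ 2 + x 4 ^ 2 = 0) :
    ¬ (q : ℤ) ∣ x 4 ∧
      (q : ℤ) ∣ (x 0 ^ 2 + 3 * x 4 ^ 2) ∧
      (q : ℤ) ∣ (x 1 ^ 2 + 2 * x 4 ^ 2) ∧
      (q : ℤ) ∣ (x 2 ^ 2 + x 4 ^ 2) ∧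
      (¬ (q : ℤ) ∣ (((6 * x 0 ^ 2 : ℚ) / (x 4 ^ 2 : ℚ)).den : ℤ) ∧
        (q : ℤ) ∣ (((6 * x 0 ^ 2 : ℚ) / (x 4 ^ 2 : ℚ)).num +
          18 * (((6 * x 0 ^ 2 : ℚ) / (x 4 ^ 2 : ℚ)).den : ℤ))) := by
  have hp : Prime (q : ℤ) := Nat.prime_iff_prime_int.mp hq
  have e0 : (q : ℤ) ∣ (x 0 ^ 2 + 3 * x 4 ^ 2) := by
    have : x 0 ^ 2 + 3 * x 4 ^ 2 = D * (4 * x 3 ^ 2) := by linarith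
    rw [this]; exact hqD.mul_right _
  have e1 : (q : ℤ) ∣ (x 1 ^ 2 + 2 * x 4 ^ 2) := by
    have : x 1 ^ 2 + 2 * x 4 ^ 2 = D * (3 * x 3 ^ 2) := by linarith
    rw [this]; exact hqD.mul_right _
  have e2 : (q : ℤ) ∣ (x 2 ^ 2 + x 4 ^ 2) := by
    have : x 2 ^ 2 + x 4 ^ 2 = D * (2 * x 3 ^ 2) := by linarith
    rw [this]; exact hqD.mul_right _
  have h4 : ¬ (q : ℤ) ∣ x 4 := by
    intro h
    have hs : (q : ℤ) ∣ x 4 ^ 2 := dvd_pow h two_ne_zero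
    have d0 : (q : ℤ) ∣ x 0 :=
      hp.dvd_of_dvd_pow ((dvd_add_left (hs.mul_left 3)).mp e0)
    have d1 : (q : ℤ) ∣ x 1 :=
      hp.dvd_of_dvd_pow ((dvd_add_left (hs.mul_left 2)).mp e1)
    have d2 : (q : ℤ) ∣ x 2 := hp.dvd_of_dvd_pow ((dvd_add_left hs).mp e2)
    have d3 : (q : ℤ) ∣ x 3 := by
      obtain ⟨E, hE⟩ := hqD
      obtain ⟨a, ha⟩ := d1
      obtain ⟨b, hb⟩ := d2
      have key : (q : ℤ) * (E * x 3 ^ 2) = q * (q * (2 * b ^ 2 - a ^ 2)) := by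
        rw [ha, hb, hE] at h2
        linarith
      have key2 := mul_left_cancel₀ hp.ne_zero key
      rcases hp.dvd_or_dvd (Dvd.intro _ key2.symm) with hd | hd
      · exact absurd (hD q (by rw [hE]; exact mul_dvd_mul_left _ hd)) hp.not_unit
      · exact hp.dvd_of_dvd_pow hd
    have hg : (q : ℤ) ∣ Finset.univ.gcd x := by
      apply Finset.dvd_gcd
      intro i _
      fin_cases i
      · exact d0
      · exact d1
      · exact d2
      · exact d3
      · exact h
    rw [hgcd] at hg
    exact hp.not_unit (isUnit_of_dvd_one hg)
  refine ⟨h4, e0, e1, e2, ?_⟩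
  have hs4 : ¬ (q : ℤ) ∣ x 4 ^ 2 := fun h => h4 (hp.dvd_of_dvd_pow h)
  have hx4 : (x 4 : ℚ) ≠ 0 := by
    intro h
    apply h4
    have : x 4 = 0 := by exact_mod_cast h
    rw [this]; exact dvd_zero _
  generalize hr : ((6 * x 0 ^ 2 : ℚ) / (x 4 ^ 2 : ℚ)) = r
  have hden : (r.den : ℚ) ≠ 0 := by exact_mod_cast r.den_nz
  have cross : r.num * x 4 ^ 2 = 6 * x 0 ^ 2 * (r.den : ℤ) := by
    have h := hr
    rw [← Rat.num_div_den r, div_eq_div_iff (pow_ne_zero 2 hx4) hden] at h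
    exact_mod_cast h.symm
  have hnd : ¬ (q : ℤ) ∣ (r.den : ℤ) := by
    intro h
    have hn : (q : ℤ) ∣ r.num :=
      (hp.dvd_or_dvd (cross ▸ h.mul_left (6 * x 0 ^ 2) : (q : ℤ) ∣ r.num * x 4 ^ 2)).resolve_right hs4
    have hc := Nat.dvd_gcd (Int.natCast_dvd.mp hn) (Int.natCast_dvd_natCast.mp h)
    rw [r.reduced] at hc
    exact hq.one_lt.ne' (Nat.dvd_one.mp hc)
  refine ⟨hnd, (hp.dvd_or_dvd (b := x 4 ^ 2) ?_).resolve_right hs4⟩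
  have : (r.num + 18 * (r.den : ℤ)) * x 4 ^ 2
      = (x 0 ^ 2 + 3 * x 4 ^ 2) * (6 * (r.den : ℤ)) := by linear_combination cross
  rw [this]
  exact e0.mul_right _
end

section
/- Let D be a squarefree integer such that C_D(ℚ) ≠ ∅, i.e. there is a nonzero tuple (x₀,…,x₄) ∈ ℚ⁵ satisfying x₀² − 2x₁² + x₂² = 0, x₁² − 2x₂² + D·x₃² = 0 and x₂² − 2D·x₃² + x₄² = 0. Then, writing (D/p) for the Legendre symbol: (i) D is a square modulo each of 17, 23, 41, 191, 281, 2027 and 836477; (ii) (D/7) = (D/13), (D/11) = (D/19) = (D/241), (D/47) = (D/73), (D/149) = (D/673), (D/43) = (D/1723), (D/175673) = (D/2953), (D/97) = (D/5689) = (D/95737), (D/577) = (D/2281), (D/83) = (D/4391) = (D/27449), (D/67) = (D/136319), (D/2111) = (D/2521); (iii) if (D/29) = 1 then (D/11) = 1; if (D/149) = 1 then (D/31) = 1; if (D/7019) = 1 then (D/8123) = 1; if (D/617) = 1 then (D/37) = 1 and (D/7) = 1; (iv) if (D/83) = −1 then (D/11) = −1; if (D/2347) = −1 then (D/47) = −1;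 if (D/10369) = −1 then (D/47) = −1. -/
instance : Fact (Nat.Prime 7) := ⟨by norm_num⟩
instance : Fact (Nat.Prime 11) := ⟨by norm_num⟩
instance : Fact (Nat.Prime 13) := ⟨by norm_num⟩
instance : Fact (Nat.Prime 17) := ⟨by norm_num⟩
instance : Fact (Nat.Prime 19) := ⟨by norm_num⟩
instance : Fact (Nat.Prime 23) := ⟨by norm_num⟩
instance : Fact (Nat.Prime 29) := ⟨by norm_num⟩
instance : Fact (Nat.Prime 31) := ⟨by norm_num⟩
instance : Fact (Nat.Prime 37) := ⟨by norm_num⟩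
instance : Fact (Nat.Prime 41) := ⟨by norm_num⟩
instance : Fact (Nat.Prime 43) := ⟨by norm_num⟩
instance : Fact (Nat.Prime 47) := ⟨by norm_num⟩
instance : Fact (Nat.Prime 67) := ⟨by norm_num⟩
instance : Fact (Nat.Prime 73) := ⟨by norm_num⟩
instance : Fact (Nat.Prime 83) := ⟨by norm_num⟩
instance : Fact (Nat.Prime 97) := ⟨by norm_num⟩
instance : Fact (Nat.Prime 149) := ⟨by norm_num⟩
instance : Fact (Nat.Prime 191) := ⟨by norm_num⟩
instance : Fact (Nat.Prime 241) := ⟨by norm_num⟩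
instance : Fact (Nat.Prime 281) := ⟨by norm_num⟩
instance : Fact (Nat.Prime 577) := ⟨by norm_num⟩
instance : Fact (Nat.Prime 617) := ⟨by norm_num⟩
instance : Fact (Nat.Prime 673) := ⟨by norm_num⟩
instance : Fact (Nat.Prime 1723) := ⟨by norm_num⟩
instance : Fact (Nat.Prime 2027) := ⟨by norm_num⟩
instance : Fact (Nat.Prime 2111) := ⟨by norm_num⟩
instance : Fact (Nat.Prime 2281) := ⟨by norm_num⟩
instance : Fact (Nat.Prime 2347) := ⟨by norm_num⟩
instance : Fact (Nat.Prime 2521) := ⟨by norm_num⟩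
instance : Fact (Nat.Prime 2953) := ⟨by norm_num⟩
instance : Fact (Nat.Prime 4391) := ⟨by norm_num⟩
instance : Fact (Nat.Prime 5689) := ⟨by norm_num⟩
instance : Fact (Nat.Prime 7019) := ⟨by norm_num⟩
instance : Fact (Nat.Prime 8123) := ⟨by norm_num⟩
instance : Fact (Nat.Prime 10369) := ⟨by norm_num⟩
instance : Fact (Nat.Prime 27449) := ⟨by norm_num⟩
instance : Fact (Nat.Prime 95737) := ⟨by norm_num⟩
instance : Fact (Nat.Prime 136319) := ⟨by norm_num⟩
instance : Fact (Nat.Prime 175673) := ⟨by norm_num⟩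
instance : Fact (Nat.Prime 836477) := ⟨by norm_num⟩


/-- A rational whose square times a squarefree integer is an integer is itself an integer. -/
lemma int_of_sqfree_mul_sq (D N : ℤ) (hD : Squarefree D) (r : ℚ) (h : (D : ℚ) * r ^ 2 = N) :
    ∃ n : ℤ, r = n := by
  have hden : (r.den : ℚ) ≠ 0 := by exact_mod_cast r.den_nz
  have h1 : (D : ℚ) * r.num ^ 2 = N * r.den ^ 2 := by
    have := Rat.num_div_den r
    rw [← this] at h
    field_simp at h
    linarith
  have h2 : D * r.num ^ 2 = N * (r.den : ℤ) ^ 2 := by exact_mod_cast h1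
  have hc : IsCoprime r.num (r.den : ℤ) := by
    rw [Int.isCoprime_iff_gcd_eq_one]
    exact r.reduced
  have h3 : (r.den : ℤ) ^ 2 ∣ D := by
    have : (r.den : ℤ) ^ 2 ∣ D * r.num ^ 2 := ⟨N, by rw [h2]; ring⟩
    exact (hc.symm.pow (m := 2) (n := 2)).dvd_of_dvd_mul_right this
  have h4 : IsUnit (r.den : ℤ) := hD _ (by rw [← sq]; exact h3)
  have h5 : r.den = 1 := by
    have := Int.isUnit_iff_natAbs_eq.mp h4
    simpa using this
  exact ⟨r.num, ((Rat.den_eq_one_iff r).mp h5).symm⟩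

lemma neg_norm (n : ℤ) (r : ℤ) (h : n % 2 = 1) (hr : r = 1 ∨ r = 3) :
    ∃ n', (n' = n ∨ n' = -n) ∧ n' % 4 = r := by
  rcases hr with rfl | rfl
  · by_cases h1 : n % 4 = 1
    · exact ⟨n, Or.inl rfl, h1⟩
    · exact ⟨-n, Or.inr rfl, by omega⟩
  · by_cases h1 : n % 4 = 3
    · exact ⟨n, Or.inl rfl, h1⟩
    · exact ⟨-n, Or.inr rfl, by omega⟩

lemma odd_of_sq {n : ℤ} (h : n ^ 2 % 2 = 1) : n % 2 = 1 := by
  rcases Int.emod_two_eq_zero_or_one n with h1 | h1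
  · exfalso
    have : n ^ 2 % 2 = 0 := by rw [sq, Int.mul_emod, h1]; rfl
    omega
  · exact h1

lemma sq_mod8 {n : ℤ} (h : n % 2 = 1) : n ^ 2 % 8 = 1 := by
  have := Int.emod_emod_of_dvd n (show (2:ℤ) ∣ 8 by norm_num)
  have h1 : n % 8 = 1 ∨ n % 8 = 3 ∨ n % 8 = 5 ∨ n % 8 = 7 := by omega
  rcases h1 with h1 | h1 | h1 | h1 <;> rw [sq, Int.mul_emod, h1] <;> rfl

/-- parity analysis of a primitive quadruple -/
lemma parity {a b c e : ℤ} (hac : IsCoprime a c) (h1 : a ^ 2 + c ^ 2 = 2 * b ^ 2)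
    (h2 : a ^ 2 + e ^ 2 = 2 * c ^ 2) : a % 2 = 1 ∧ b % 2 = 1 ∧ c % 2 = 1 ∧ e % 2 = 1 := by
  have ha : a % 2 = 1 := by
    rcases Int.emod_two_eq_zero_or_one a with h | h
    · exfalso
      have h3 : c % 2 = 1 := by
        rcases Int.emod_two_eq_zero_or_one c with h' | h'
        · have := hac.isUnit_of_dvd' (Int.dvd_of_emod_eq_zero h) (Int.dvd_of_emod_eq_zero h')
          norm_num [Int.isUnit_iff] at this
        · exact h'
      have := sq_mod8 h3
      have h5 : a ^ 2 % 2 = 0 := by rw [sq, Int.mul_emod, h]; rfl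
      omega
    · exact h
  have ha8 := sq_mod8 ha
  have hc : c % 2 = 1 := odd_of_sq (by omega)
  have hc8 := sq_mod8 hc
  exact ⟨ha, odd_of_sq (by omega), hc, odd_of_sq (by omega)⟩

/-- From a point of `C_D` to a normalized primitive integral quadruple. -/
lemma to_int (D : ℤ) (hD : Squarefree D) (x : Fin 5 → ℚ) (hx : x ≠ 0)
    (e1 : x 0 ^ 2 - 2 * x 1 ^ 2 + x 2 ^ 2 = 0)
    (e2 : x 1 ^ 2 - 2 * x 2 ^ 2 + (D : ℚ) * x 3 ^ 2 = 0)
    (e3 : x 2 ^ 2 - 2 * (D : ℚ) * x 3 ^ 2 + x 4 ^ 2 = 0) :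
    ∃ a b c e y : ℤ, IsCoprime a c ∧ a ^ 2 + c ^ 2 = 2 * b ^ 2 ∧ a ^ 2 + e ^ 2 = 2 * c ^ 2 ∧
      D * y ^ 2 = 2 * c ^ 2 - b ^ 2 ∧ a % 4 = 3 ∧ b % 4 = 1 ∧ c % 4 = 1 ∧ e % 4 = 3 := by
  have hD0 : (D : ℚ) ≠ 0 := by exact_mod_cast hD.ne_zero
  have e4 : x 0 ^ 2 + x 4 ^ 2 = 2 * x 2 ^ 2 := by linarith
  have hx2 : x 2 ≠ 0 := by
    intro h
    rw [h] at e1 e2 e3 e4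
    have h0 : x 0 = 0 := by nlinarith [sq_nonneg (x 0), sq_nonneg (x 4)]
    have h4 : x 4 = 0 := by nlinarith [sq_nonneg (x 0), sq_nonneg (x 4)]
    rw [h0] at e1
    have h1 : x 1 = 0 := by nlinarith
    rw [h1] at e2
    have h3 : x 3 = 0 := by
      have : (D : ℚ) * x 3 ^ 2 = 0 := by linarith
      simpa [hD0] using this
    apply hx
    funext i
    fin_cases i <;> simp [h0, h1, h, h3, h4]
  set q : ℚ := x 0 / x 2 with hq
  have hden : (q.den : ℚ) ≠ 0 := by exact_mod_cast q.den_nz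
  obtain ⟨t, ht⟩ : ∃ t : ℚ, t = x 2 / q.den := ⟨_, rfl⟩
  have ht0 : t ≠ 0 := by rw [ht]; positivity
  have hc : x 2 = t * (q.den : ℤ) := by rw [ht]; push_cast; field_simp
  have ha : x 0 = t * q.num := by
    have : q * q.den = q.num := Rat.mul_den_eq_num q
    rw [← this, ht, hq]; field_simp
  have hcop : IsCoprime q.num (q.den : ℤ) := by
    rw [Int.isCoprime_iff_gcd_eq_one]
    exact q.reduced
  generalize q.num = a at *
  generalize (q.den : ℤ) = c at *
  obtain ⟨b, hb⟩ := int_of_sqfree_mul_sq 2 (a ^ 2 + c ^ 2) Int.prime_two.squarefree (x 1 / t) (by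
    push_cast
    field_simp
    rw [ha, hc] at e1
    linarith)
  obtain ⟨e, he⟩ := int_of_sqfree_mul_sq 1 (2 * c ^ 2 - a ^ 2) squarefree_one (x 4 / t) (by
    push_cast
    field_simp
    rw [ha, hc] at e4
    linarith)
  have hb' : x 1 = t * b := by rw [← hb]; field_simp
  have he' : x 4 = t * e := by rw [← he]; field_simp
  obtain ⟨y, hy⟩ := int_of_sqfree_mul_sq D (2 * c ^ 2 - b ^ 2) hD (x 3 / t) (by
    push_cast
    field_simp
    rw [hb', hc] at e2
    linarith)
  have hy' : x 3 = t * y := by rw [← hy]; field_simp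
  rw [ha, hb', hc] at e1
  rw [hb', hc, hy'] at e2
  rw [ha, hc, he'] at e4
  have ht2 : t ^ 2 ≠ 0 := pow_ne_zero 2 ht0
  have f1 : a ^ 2 + c ^ 2 = 2 * b ^ 2 := by
    have : ((a : ℚ) ^ 2 + c ^ 2) = 2 * b ^ 2 := by
      apply mul_left_cancel₀ ht2; linarith
    exact_mod_cast this
  have f2 : D * y ^ 2 = 2 * c ^ 2 - b ^ 2 := by
    have : (D : ℚ) * y ^ 2 = 2 * c ^ 2 - b ^ 2 := by
      apply mul_left_cancel₀ ht2; linarith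
    exact_mod_cast this
  have f3 : a ^ 2 + e ^ 2 = 2 * c ^ 2 := by
    have : ((a : ℚ) ^ 2 + e ^ 2) = 2 * c ^ 2 := by
      apply mul_left_cancel₀ ht2; linarith
    exact_mod_cast this
  obtain ⟨pa, pb, pc, pe⟩ := parity hcop f1 f3
  obtain ⟨a', sa, na⟩ := neg_norm a 3 pa (by simp)
  obtain ⟨b', sb, nb⟩ := neg_norm b 1 pb (by simp)
  obtain ⟨c', sc, nc⟩ := neg_norm c 1 pc (by simp)
  obtain ⟨e', se, ne⟩ := neg_norm e 3 pe (by simp)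
  have qa : a' ^ 2 = a ^ 2 := by rcases sa with rfl | rfl <;> ring
  have qb : b' ^ 2 = b ^ 2 := by rcases sb with rfl | rfl <;> ring
  have qc : c' ^ 2 = c ^ 2 := by rcases sc with rfl | rfl <;> ring
  have qe : e' ^ 2 = e ^ 2 := by rcases se with rfl | rfl <;> ring
  refine ⟨a', b', c', e', y, ?_, ?_, ?_, ?_, na, nb, nc, ne⟩
  · rcases sa with rfl | rfl <;> rcases sc with rfl | rfl <;> simpa [IsCoprime.neg_left_iff, IsCoprime.neg_right_iff] using hcop
  · rw [qa, qb, qc]; exact f1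
  · rw [qa, qc, qe]; exact f3
  · rw [qb, qc]; exact f2

/-- If `u * v` is a square with `u, v` coprime, then `u` is a square up to sign. -/
lemma sq_of_cop {u v x : ℤ} (hc : IsCoprime u v) (h : u * v = x ^ 2) :
    ∃ σ A : ℤ, (σ = 1 ∨ σ = -1) ∧ u = σ * A ^ 2 := by
  obtain ⟨A, hA⟩ := Int.sq_of_isCoprime hc h
  rcases hA with hA | hA
  · exact ⟨1, A, Or.inl rfl, by rw [hA]; ring⟩
  · exact ⟨-1, A, Or.inr rfl, by rw [hA]; ring⟩

lemma cofactor {σ A v x : ℤ} (hσ : σ = 1 ∨ σ = -1) (hA : A ≠ 0)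
    (h : σ * A ^ 2 * v = x ^ 2) : ∃ k, x = A * k ∧ v = σ * k ^ 2 := by
  have h1 : A ^ 2 ∣ x ^ 2 := ⟨σ * v, by rw [← h]; ring⟩
  obtain ⟨k, rfl⟩ := (Int.pow_dvd_pow_iff (two_ne_zero)).mp h1
  refine ⟨k, rfl, ?_⟩
  have h2 : σ * v = k ^ 2 := by
    apply mul_left_cancel₀ (pow_ne_zero 2 hA)
    linarith
  rcases hσ with rfl | rfl <;> linarith

/-- coprimality from primes -/
lemma cop_of_prime {u v : ℤ} (hu : u ≠ 0)
    (h : ∀ p : ℤ, Prime p → p ∣ u → p ∣ v → False) : IsCoprime u v :=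
  isCoprime_of_prime_dvd (fun h0 => hu h0.1) (fun p hp h1 h2 => h p hp h1 h2)

lemma three_dvd_sq {a c : ℤ} (h : (3 : ℤ) ∣ a ^ 2 + c ^ 2) : (3 : ℤ) ∣ a ∧ (3 : ℤ) ∣ c := by
  have ha : a % 3 = 0 ∨ a % 3 = 1 ∨ a % 3 = 2 := by omega
  have hc : c % 3 = 0 ∨ c % 3 = 1 ∨ c % 3 = 2 := by omega
  have h' := Int.emod_eq_zero_of_dvd h
  rw [sq, sq, Int.add_emod, Int.mul_emod, Int.mul_emod c] at h'
  rcases ha with ha | ha | ha <;> rcases hc with hc | hc | hc <;>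
    simp [ha, hc] at h' <;> exact ⟨Int.dvd_of_emod_eq_zero ha, Int.dvd_of_emod_eq_zero hc⟩

set_option maxHeartbeats 1000000 in
/-- First half of the descent: factoring the two conics. -/
lemma descent_conics {a b c e : ℤ} (hac : IsCoprime a c) (h1 : a ^ 2 + c ^ 2 = 2 * b ^ 2)
    (h2 : a ^ 2 + e ^ 2 = 2 * c ^ 2) (ma : a % 4 = 3) (mb : b % 4 = 1) (mc : c % 4 = 1)
    (me : e % 4 = 3) :
    ∃ τ g a' c' : ℤ, (τ = 1 ∨ τ = -1) ∧ g ≠ 0 ∧ IsCoprime a' c' ∧ a' % 4 = 3 ∧ c' % 4 = 1 ∧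
      2 * b - a - c = 2 * (τ * (g * a') ^ 2) ∧ 2 * c - a - e = 4 * (τ * (g * c') ^ 2) := by
  -- first conic
  obtain ⟨u1, hu1⟩ : ∃ u, 2 * b - a - c = 2 * u := ⟨(2 * b - a - c) / 2, by omega⟩
  obtain ⟨v1, hv1⟩ : ∃ v, a + 2 * b + c = 2 * v := ⟨(a + 2 * b + c) / 2, by omega⟩
  obtain ⟨x1, hx1⟩ : ∃ x, a - c = 2 * x := ⟨(a - c) / 2, by omega⟩
  have u1odd : u1 % 2 = 1 := by omega
  have e1 : u1 * v1 = x1 ^ 2 := by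
    have : (2 * u1) * (2 * v1) = (2 * x1) ^ 2 := by rw [← hu1, ← hv1, ← hx1]; nlinarith
    linarith
  have c1 : IsCoprime u1 v1 := by
    refine cop_of_prime (by omega) ?_
    intro p hp hpu hpv
    have hx : p ∣ x1 := hp.dvd_of_dvd_pow (n := 2) (by rw [← e1]; exact hpu.mul_right _)
    have d1 : p ∣ a := by
      have h4 : 2 * a = (v1 - u1) + 2 * x1 := by linarith
      have h5 : p ∣ 2 * a := by
        rw [h4]; exact dvd_add (dvd_sub hpv hpu) (hx.mul_left 2)
      rcases hp.dvd_or_dvd h5 with h6 | h6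
      · exfalso
        have : p ∣ 1 := by
          have h7 : p ∣ u1 - 2 * (u1 / 2) := dvd_sub hpu (h6.mul_right _)
          have h8 : u1 - 2 * (u1 / 2) = 1 := by omega
          rwa [h8] at h7
        exact hp.not_isUnit (isUnit_of_dvd_one this)
      · exact h6
    have d2 : p ∣ c := by
      have : c = a - 2 * x1 := by linarith
      rw [this]; exact dvd_sub d1 (hx.mul_left 2)
    exact hp.not_isUnit (hac.isUnit_of_dvd' d1 d2)
  -- second conic
  have hea : e ^ 2 - a ^ 2 = 4 * (b ^ 2 - a ^ 2) := by linarith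
  have ha8 := sq_mod8 (n := a) (by omega)
  have hb8 := sq_mod8 (n := b) (by omega)
  obtain ⟨y, hy⟩ : ∃ y, e - a = 4 * y := ⟨(e - a) / 4, by omega⟩
  obtain ⟨z, hz⟩ : ∃ z, e + a = 2 * z := ⟨(e + a) / 2, by omega⟩
  have zodd : z % 2 = 1 := by omega
  have hyz : (y * z) % 4 = 0 := by
    have : (e - a) * (e + a) = 4 * (b ^ 2 - a ^ 2) := by linarith
    rw [hy, hz] at this
    have h3 : 2 * (y * z) = b ^ 2 - a ^ 2 := by linarith
    omega
  have hy4 : y % 4 = 0 := by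
    have h3 : (4 : ℤ) ∣ y * z := Int.dvd_of_emod_eq_zero hyz
    have h4 : IsCoprime (4 : ℤ) z := by
      have : IsCoprime (2 : ℤ) z := by
        rw [Int.isCoprime_iff_gcd_eq_one]
        exact Int.isCoprime_iff_gcd_eq_one.mp ⟨-(z / 2), 1, by omega⟩
      have := this.pow_left (m := 2)
      norm_num at this
      exact this
    exact Int.emod_eq_zero_of_dvd (h4.dvd_of_dvd_mul_right h3)
  obtain ⟨u2, hu2⟩ : ∃ u, 2 * c - a - e = 4 * u := ⟨(2 * c - a - e) / 4, by omega⟩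
  obtain ⟨v2, hv2⟩ : ∃ v, 2 * c + a + e = 4 * v := ⟨(2 * c + a + e) / 4, by omega⟩
  obtain ⟨x2, hx2⟩ : ∃ x, a - e = 4 * x := ⟨(a - e) / 4, by omega⟩
  have u2odd : u2 % 2 = 1 := by omega
  have e2 : u2 * v2 = x2 ^ 2 := by
    have : (4 * u2) * (4 * v2) = (4 * x2) ^ 2 := by rw [← hu2, ← hv2, ← hx2]; nlinarith
    linarith
  have c2 : IsCoprime u2 v2 := by
    refine cop_of_prime (by omega) ?_
    intro p hp hpu hpv
    have hx : p ∣ x2 := hp.dvd_of_dvd_pow (n := 2) (by rw [← e2]; exact hpu.mul_right _)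
    have d2 : p ∣ c := by
      have : c = u2 + v2 := by linarith
      rw [this]; exact dvd_add hpu hpv
    have d1 : p ∣ a := by
      have : a = v2 - u2 + 2 * x2 := by linarith
      rw [this]; exact dvd_add (dvd_sub hpv hpu) (hx.mul_left 2)
    exact hp.not_isUnit (hac.isUnit_of_dvd' d1 d2)
  obtain ⟨σ, A0, hσ, hA0⟩ := sq_of_cop c1 e1
  obtain ⟨τ, B0, hτ, hB0⟩ := sq_of_cop c2 e2
  have A0odd : A0 % 2 = 1 := by
    apply odd_of_sq
    rcases hσ with rfl | rfl <;> omega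
  have B0odd : B0 % 2 = 1 := by
    apply odd_of_sq
    rcases hτ with rfl | rfl <;> omega
  have hAs := sq_mod8 A0odd
  have hBs := sq_mod8 B0odd
  have hστ : τ = σ := by
    have h3 : 4 * b - 3 * a - e = 4 * u2 + 4 * u1 := by linarith
    rcases hσ with rfl | rfl <;> rcases hτ with rfl | rfl <;> first | rfl | (exfalso; omega)
  subst hστ
  -- common factor
  obtain ⟨g, a0, c0, hg, hcop0, hga, hgc⟩ : ∃ g a0 c0 : ℤ, g ≠ 0 ∧ IsCoprime a0 c0 ∧
      A0 = g * a0 ∧ B0 = g * c0 := by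
    have hpos : 0 < Int.gcd A0 B0 := Int.gcd_pos_of_ne_zero_left _ (by omega)
    obtain ⟨a0, c0, h3, h4, h5⟩ := Int.exists_gcd_one hpos
    exact ⟨Int.gcd A0 B0, a0, c0, by positivity, Int.isCoprime_iff_gcd_eq_one.mpr h3,
      by rw [mul_comm]; exact h4, by rw [mul_comm]; exact h5⟩
  have a0odd : a0 % 2 = 1 := by
    rcases Int.emod_two_eq_zero_or_one a0 with h | h
    · rw [hga, Int.mul_emod, h] at A0odd; simp at A0odd
    · exact h
  have c0odd : c0 % 2 = 1 := by
    rcases Int.emod_two_eq_zero_or_one c0 with h | h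
    · rw [hgc, Int.mul_emod, h] at B0odd; simp at B0odd
    · exact h
  obtain ⟨a', sa, na⟩ := neg_norm a0 3 a0odd (by simp)
  obtain ⟨c', sc, nc⟩ := neg_norm c0 1 c0odd (by simp)
  have qa : a' ^ 2 = a0 ^ 2 := by rcases sa with rfl | rfl <;> ring
  have qc : c' ^ 2 = c0 ^ 2 := by rcases sc with rfl | rfl <;> ring
  have hcop : IsCoprime a' c' := by
    rcases sa with rfl | rfl <;> rcases sc with rfl | rfl <;>
      simpa [IsCoprime.neg_left_iff, IsCoprime.neg_right_iff] using hcop0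
  have hU1 : u1 = τ * (g * a') ^ 2 := by rw [hA0, hga, mul_pow, mul_pow, qa]
  have hU2 : u2 = τ * (g * c') ^ 2 := by rw [hB0, hgc, mul_pow, mul_pow, qc]
  exact ⟨τ, g, a', c', hσ, hg, hcop, na, nc, by rw [hu1, hU1], by rw [hu2, hU2]⟩

set_option maxHeartbeats 1000000 in
/-- Middle of the descent: the new quadruple. -/
lemma descent_new {τ a' c' z : ℤ} (hσ : τ = 1 ∨ τ = -1) (hcop : IsCoprime a' c')
    (na : a' % 4 = 3) (nc : c' % 4 = 1)
    (hz2 : z ^ 2 = 2 * ((2 * c' ^ 2 - a' ^ 2) * (c' ^ 2 + a' ^ 2))) :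
    ∃ b' e' s : ℤ, (s = 1 ∨ s = -1) ∧ b' % 4 = 1 ∧ e' % 4 = 3 ∧ a' ^ 2 + c' ^ 2 = 2 * b' ^ 2 ∧
      a' ^ 2 + e' ^ 2 = 2 * c' ^ 2 ∧ z = 2 * (τ * (s * b' * e')) := by
  have hc'0 : c' ≠ 0 := by omega
  have ha'8 := sq_mod8 (n := a') (by omega)
  have hc'8 := sq_mod8 (n := c') (by omega)
  obtain ⟨f, hf⟩ : ∃ f, c' ^ 2 + a' ^ 2 = 2 * f := ⟨(c' ^ 2 + a' ^ 2) / 2, by omega⟩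
  obtain ⟨z', hz'⟩ : ∃ z', z = 2 * z' := by
    have : (2 : ℤ) ∣ z ^ 2 := ⟨_, hz2⟩
    exact Int.prime_two.dvd_of_dvd_pow this
  have hfh : f * (2 * c' ^ 2 - a' ^ 2) = z' ^ 2 := by
    rw [hf, hz'] at hz2; linarith
  have fpos : 0 < f := by
    have := sq_nonneg a'
    have : 0 < c' ^ 2 := by positivity
    omega
  have cfh : IsCoprime f (2 * c' ^ 2 - a' ^ 2) := by
    refine cop_of_prime (by omega) ?_
    intro p hp hpf hph
    have d1 : p ∣ 3 * c' ^ 2 := by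
      have : 3 * c' ^ 2 = 2 * f + (2 * c' ^ 2 - a' ^ 2) := by rw [← hf]; ring
      rw [this]; exact dvd_add (hpf.mul_left 2) hph
    have key : p ∣ c' → False := by
      intro h
      have : p ∣ a' ^ 2 := by
        have h3 : a' ^ 2 = 2 * f - c' ^ 2 := by rw [← hf]; ring
        rw [h3]; exact dvd_sub (hpf.mul_left 2) (dvd_pow h two_ne_zero)
      exact hp.not_isUnit (hcop.isUnit_of_dvd' (hp.dvd_of_dvd_pow this) h)
    rcases hp.dvd_or_dvd d1 with h3 | h3
    · have h4 : (3 : ℤ) ∣ p := by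
        have := (hp.dvd_prime_iff_associated Int.prime_three).mp h3
        exact this.symm.dvd
      have h5 : (3 : ℤ) ∣ a' ^ 2 + c' ^ 2 := by
        have : a' ^ 2 + c' ^ 2 = 2 * f := by rw [← hf]; ring
        rw [this]; exact (h4.trans hpf).mul_left 2
      exact key (h3.trans (three_dvd_sq h5).2)
    · exact key (hp.dvd_of_dvd_pow h3)
  obtain ⟨b0, hb0⟩ : ∃ b0, f = b0 ^ 2 := by
    rcases Int.sq_of_isCoprime cfh hfh with ⟨b0, h | h⟩
    · exact ⟨b0, h⟩
    · exfalso; nlinarith [sq_nonneg b0]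
  have b0ne : b0 ≠ 0 := by rintro rfl; simp at hb0; omega
  obtain ⟨e0, he1, he2⟩ := cofactor (σ := 1) (A := b0) (v := 2 * c' ^ 2 - a' ^ 2) (x := z')
    (Or.inl rfl) b0ne (by rw [← hfh, hb0]; ring)
  have b0odd : b0 % 2 = 1 := odd_of_sq (by omega)
  have e0odd : e0 % 2 = 1 := odd_of_sq (by omega)
  obtain ⟨b', sb, nb⟩ := neg_norm b0 1 b0odd (by simp)
  obtain ⟨e', se, ne⟩ := neg_norm e0 3 e0odd (by simp)
  have qb : b' ^ 2 = b0 ^ 2 := by rcases sb with rfl | rfl <;> ring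
  have qe : e' ^ 2 = e0 ^ 2 := by rcases se with rfl | rfl <;> ring
  obtain ⟨s, hs, hsz⟩ : ∃ s : ℤ, (s = 1 ∨ s = -1) ∧ z' = τ * (s * b' * e') := by
    have : z' ^ 2 = (b' * e') ^ 2 := by rw [mul_pow, qb, qe, he1]; ring
    rcases hσ with rfl | rfl <;> rcases sq_eq_sq_iff_eq_or_eq_neg.mp this with h | h
    · exact ⟨1, Or.inl rfl, by rw [h]; ring⟩
    · exact ⟨-1, Or.inr rfl, by rw [h]; ring⟩
    · exact ⟨-1, Or.inr rfl, by rw [h]; ring⟩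
    · exact ⟨1, Or.inl rfl, by rw [h]; ring⟩
  exact ⟨b', e', s, hs, nb, ne, by linarith, by linarith, by rw [hz', hsz]⟩

set_option maxHeartbeats 2000000 in
/-- The descent step. -/
lemma descent {a b c e : ℤ} (hac : IsCoprime a c) (h1 : a ^ 2 + c ^ 2 = 2 * b ^ 2)
    (h2 : a ^ 2 + e ^ 2 = 2 * c ^ 2) (ma : a % 4 = 3) (mb : b % 4 = 1) (mc : c % 4 = 1)
    (me : e % 4 = 3) :
    ∃ σ g k s a' b' c' e' : ℤ, (σ = 1 ∨ σ = -1) ∧ (s = 1 ∨ s = -1) ∧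
      IsCoprime a' c' ∧ a' ^ 2 + c' ^ 2 = 2 * b' ^ 2 ∧ a' ^ 2 + e' ^ 2 = 2 * c' ^ 2 ∧
      a' % 4 = 3 ∧ b' % 4 = 1 ∧ c' % 4 = 1 ∧ e' % 4 = 3 ∧
      c' ^ 2 ≤ |c| ∧
      2 * σ * a = k ^ 2 - (g * a') ^ 2 + 2 * (g * a') * k ∧
      2 * σ * b = k ^ 2 + (g * a') ^ 2 ∧
      2 * σ * c = k ^ 2 - (g * a') ^ 2 - 2 * (g * a') * k ∧
      2 * σ * e = k ^ 2 - 5 * (g * a') ^ 2 - 6 * (g * a') * k - 4 * (g * e') ^ 2 ∧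
      k * (c' ^ 2 - 2 * a' ^ 2) = g * (c' * (3 * a' * c' + 2 * s * b' * e')) := by
  obtain ⟨τ, g, a', c', hσ, hg, hcop, na, nc, E1, E2⟩ := descent_conics hac h1 h2 ma mb mc me
  obtain ⟨x1, hx1⟩ : ∃ x, a - c = 2 * x := ⟨(a - c) / 2, by omega⟩
  obtain ⟨v1, hv1⟩ : ∃ v, a + 2 * b + c = 2 * v := ⟨(a + 2 * b + c) / 2, by omega⟩
  obtain ⟨v2, hv2⟩ : ∃ v, 2 * c + a + e = 4 * v := ⟨(2 * c + a + e) / 4, by omega⟩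
  obtain ⟨x2, hx2⟩ : ∃ x, a - e = 4 * x := ⟨(a - e) / 4, by omega⟩
  have e1 : τ * (g * a') ^ 2 * v1 = x1 ^ 2 := by
    have : (2 * (τ * (g * a') ^ 2)) * (2 * v1) = (2 * x1) ^ 2 := by
      rw [← E1, ← hv1, ← hx1]; linear_combination -2 * h1
    linarith
  have e2 : τ * (g * c') ^ 2 * v2 = x2 ^ 2 := by
    have : (4 * (τ * (g * c') ^ 2)) * (4 * v2) = (4 * x2) ^ 2 := by
      rw [← E2, ← hv2, ← hx2]; linear_combination -2 * h2
    linarith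
  obtain ⟨u1, hU1⟩ : ∃ u, u = τ * (g * a') ^ 2 := ⟨_, rfl⟩
  obtain ⟨u2, hU2⟩ : ∃ u, u = τ * (g * c') ^ 2 := ⟨_, rfl⟩
  have hu1 : 2 * b - a - c = 2 * u1 := by rw [hU1]; exact E1
  have hu2 : 2 * c - a - e = 4 * u2 := by rw [hU2]; exact E2
  have ha'0 : a' ≠ 0 := by omega
  have hc'0 : c' ≠ 0 := by omega
  obtain ⟨k, hk1, hk2⟩ := cofactor hσ (mul_ne_zero hg ha'0) e1
  obtain ⟨m, hm1, hm2⟩ := cofactor hσ (mul_ne_zero hg hc'0) e2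
  have hττ : τ * τ = 1 := by rcases hσ with rfl | rfl <;> rfl
  -- linear relation
  have lin : c' * m = a' * k + τ * g * c' ^ 2 := by
    apply mul_left_cancel₀ hg
    have : 4 * (g * c' * m) - 4 * (g * a' * k) = 4 * (τ * (g * c') ^ 2) := by
      rw [← hm1, ← hk1, ← hU2]; linarith
    linarith
  obtain ⟨q, hq⟩ : c' ∣ k := by
    have : c' ∣ a' * k := ⟨m - τ * g * c', by linarith⟩
    exact hcop.symm.dvd_of_dvd_mul_left this
  have hm : m = a' * q + τ * g * c' := by
    apply mul_left_cancel₀ hc'0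
    rw [lin, hq]; ring
  have ec1 : 2 * c = 2 * (τ * (g * c') ^ 2 + τ * m ^ 2) := by rw [← hU2, ← hm2]; linarith
  have ec2 : 2 * c = τ * k ^ 2 - τ * (g * a') ^ 2 - 2 * (g * a' * k) := by
    rw [← hU1, ← hk2, ← hk1]; linarith
  have quad : k ^ 2 - (g * a') ^ 2 - 2 * τ * (g * a' * k) = 2 * (g * c') ^ 2 + 2 * m ^ 2 := by
    have := ec1.symm.trans ec2
    rcases hσ with rfl | rfl <;> linarith
  have disc : (q * (c' ^ 2 - 2 * a' ^ 2) - 3 * τ * g * a' * c') ^ 2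
      = g ^ 2 * (2 * ((2 * c' ^ 2 - a' ^ 2) * (c' ^ 2 + a' ^ 2))) := by
    rw [hq, hm] at quad
    rcases hσ with rfl | rfl <;> linear_combination (c' ^ 2 - 2 * a' ^ 2) * quad
  obtain ⟨z, hz⟩ : g ∣ q * (c' ^ 2 - 2 * a' ^ 2) - 3 * τ * g * a' * c' :=
    (Int.pow_dvd_pow_iff (two_ne_zero)).mp ⟨_, disc⟩
  have hz2 : z ^ 2 = 2 * ((2 * c' ^ 2 - a' ^ 2) * (c' ^ 2 + a' ^ 2)) := by
    rw [hz] at disc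
    apply mul_left_cancel₀ (pow_ne_zero 2 hg)
    linarith
  obtain ⟨b', e', s, hs, nb, ne, n1, n2, hzz⟩ := descent_new hσ hcop na nc hz2
  have hee : (g * e') ^ 2 = 2 * (g * c') ^ 2 - (g * a') ^ 2 := by
    linear_combination g ^ 2 * n2
  refine ⟨τ, g, τ * k, s, a', b', c', e', hσ, hs, hcop, n1, n2, na, nb, nc, ne,
    ?_, ?_, ?_, ?_, ?_, ?_⟩
  · -- size
    have h3 : |4 * u2| ≤ 4 * |c| := by
      rw [← hu2, abs_le]
      have hcc := sq_abs c
      have hp : 0 ≤ |c| := abs_nonneg c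
      have hc1 : c ≤ |c| := le_abs_self c
      have hc2 : -c ≤ |c| := neg_le_abs c
      have hae : (a + e) ^ 2 ≤ (2 * |c|) ^ 2 := by nlinarith [sq_nonneg (a - e)]
      have := abs_le.mp (abs_le_of_sq_le_sq hae (by positivity))
      constructor <;> linarith [this.1, this.2]
    have h4 : |4 * u2| = 4 * (g * c') ^ 2 := by
      rw [hU2]
      rcases hσ with rfl | rfl
      · rw [one_mul, abs_of_nonneg (by positivity)]
      · rw [show (4 : ℤ) * (-1 * (g * c') ^ 2) = -(4 * (g * c') ^ 2) by ring, abs_neg,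
          abs_of_nonneg (by positivity)]
    have h5 : 1 ≤ g ^ 2 := by
      have : 0 < g ^ 2 := by positivity
      omega
    have h6 : c' ^ 2 ≤ (g * c') ^ 2 := by
      rw [mul_pow]; nlinarith [sq_nonneg c']
    linarith
  · have : 2 * a = τ * k ^ 2 - τ * (g * a') ^ 2 + 2 * (g * a' * k) := by
      rw [← hU1, ← hk2, ← hk1]; linarith
    linear_combination τ * this + (k ^ 2 - (g * a') ^ 2 - k ^ 2) * hττ
  · have : 2 * b = τ * k ^ 2 + τ * (g * a') ^ 2 := by
      rw [← hU1, ← hk2]; linarith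
    linear_combination τ * this + ((g * a') ^ 2) * hττ
  · linear_combination τ * ec2 + (- (g * a') ^ 2) * hττ
  · have h3 : 2 * b = τ * k ^ 2 + τ * (g * a') ^ 2 := by
      rw [← hU1, ← hk2]; linarith
    have h4 : e = 3 * c - 2 * b - 2 * (τ * (g * e') ^ 2) := by
      rw [hee]; linarith
    rw [h4]
    linear_combination 3 * τ * ec2 - 2 * τ * h3 + (-5 * (g * a') ^ 2 - 4 * (g * e') ^ 2) * hττ
  · rw [hzz] at hz
    rw [hq]
    linear_combination τ * c' * hz + (g * (c' * (3 * a' * c' + 2 * s * b' * e'))) * hττ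

/-- A table row: a projective point `(a, b, c, e)` modulo `p` together with the Legendre symbol
of `2 c ^ 2 - b ^ 2`. -/
abbrev Row := ℤ × ℤ × ℤ × ℤ × ℤ

def tab7 : List Row :=
  [(0, -2, -1, -3, -1), (-1, -1, -1, 1, 1), (-1, 1, 1, -1, 1)]

def tab11 : List Row :=
  [(5, 3, -2, -4, -1), (-4, -4, 4, 4, 1), (-4, -2, -5, -1, -1), (-1, 1, 1, -1, 1)]

def tab13 : List Row :=
  [(2, 0, 3, 1, -1), (4, 4, -4, 4, 1), (-1, 1, 1, -1, 1)]

def tab17 : List Row :=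
  [(-8, 7, 0, -2, 1), (1, -1, 1, 1, 1), (-1, 1, 1, -1, 1)]

def tab19 : List Row :=
  [(4, 2, 7, 5, -1), (6, 6, -6, -6, 1), (-3, -8, 9, -1, -1), (-1, 1, 1, -1, 1)]

def tab23 : List Row :=
  [(-10, 11, 2, 0, 1), (-1, 1, 1, 1, 1), (-1, 1, 1, -1, 1)]

def tab29 : List Row :=
  [(-12, -14, 4, 2, -1), (-6, 12, 7, 2, -1), (9, 3, 13, 5, -1), (1, -1, 1, -1, 1),
    (10, 2, 13, -8, -1), (-4, 8, 5, -11, -1), (-5, 8, 4, 6, -1), (-1, 1, 1, -1, 1)]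

def tab31 : List Row :=
  [(8, 6, 15, 13, -1), (0, 9, 10, -13, -1), (5, 4, 10, -12, -1), (-1, -1, -1, 1, 1),
    (-12, 2, -9, -7, -1), (-14, 8, -5, 3, -1), (-1, 1, 1, -1, 1)]

def tab37 : List Row :=
  [(10, 8, -18, 17, -1), (8, 11, -17, -12, -1), (10, 14, -12, -15, -1), (18, -7, 12, 1, -1),
    (12, 12, -12, 12, 1), (-7, -17, 14, 11, -1), (-16, 0, -15, -3, -1), (-11, -5, -15, 12, -1),
    (-1, 1, 1, -1, 1)]

def tab41 : List Row :=
  [(-16, -18, 8, 6, 1), (12, -7, 6, 16, 1), (1, -1, 1, 1, 1), (15, -16, 0, -12, 1),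
    (-1, 1, 1, -1, 1)]

def tab43 : List Row :=
  [(12, 10, -20, 21, -1), (1, 5, 7, 21, -1), (10, -5, 6, 12, 1), (10, -16, -5, -6, 1),
    (-3, 17, 15, -21, -1), (14, 14, -14, -14, 1), (19, 20, -3, -1, -1), (4, -20, -15, 2, -1),
    (18, 9, -15, -13, 1), (8, -13, -4, -21, 1), (-5, -14, -18, -8, -1), (-1, 1, 1, -1, 1)]

def tab47 : List Row :=
  [(-18, -20, 10, 8, -1), (-22, 14, -7, -15, -1), (-1, -1, -1, 1, 1), (0, 8, 9, 16, 1),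
    (-1, 1, 1, -1, 1)]

def tab67 : List Row :=
  [(20, 18, -28, -30, -1), (-3, 32, 30, -7, 1), (22, 22, -22, -22, 1), (-23, 14, -8, -1, -1),
    (-32, 16, -15, 30, 1), (-1, 1, 1, -1, 1)]

def tab73 : List Row :=
  [(22, 20, -30, -32, -1), (-14, -26, 34, 27, -1), (1, -1, 1, 1, 1), (30, -31, 0, -7, 1),
    (-1, 1, 1, -1, 1)]

def tab83 : List Row :=
  [(-30, -32, 22, 20, 1), (33, 25, -24, 35, 1), (-22, -10, -31, -39, -1), (-28, -28, 28, 28, 1),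
    (40, -15, 26, -1, 1), (-14, -7, -20, 40, 1), (23, -18, 6, -37, -1), (-1, 1, 1, -1, 1)]

def tab97 : List Row :=
  [(30, 28, -38, -40, -1), (-38, 0, -37, -18, 1), (-25, -9, -33, 1, -1), (32, 32, -32, 32, 1),
    (27, -11, 17, 25, -1), (-29, -19, -47, 45, -1), (-1, 1, 1, -1, 1)]

def tab149 : List Row :=
  [(-52, -54, 44, 42, -1), (34, -11, 24, -61, -1), (49, 60, -39, -55, -1),
    (-22, -16, -37, 67, -1), (-49, -18, -66, 65, -1), (-72, -20, 58, -59, -1),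
    (1, -1, 1, -1, 1), (28, 52, -68, 57, -1), (50, -60, -9, -33, -1), (44, 63, -41, -54, -1),
    (-44, -32, 74, 15, -1), (31, 57, -60, 32, -1), (68, 52, -28, -64, -1), (-1, 1, 1, -1, 1)]

def tab191 : List Row :=
  [(-66, -68, 58, 56, 1), (-1, -1, -1, -1, 1), (-18, 88, 71, 50, 1), (-1, 1, 1, -1, 1)]

def tab241 : List Row :=
  [(78, 76, -86, -88, -1), (1, -1, 1, -1, 1), (91, -72, 20, -58, -1), (-1, 1, 1, -1, 1)]

def tab281 : List Row :=
  [(-96, -98, 88, 86, 1), (-75, -103, 104, 73, 1), (-94, -94, 94, 94, 1),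
    (-73, -25, -97, -1, 1), (-123, 79, -43, -86, 1), (-1, 1, 1, -1, 1)]

def tab577 : List Row :=
  [(190, 188, -198, -200, -1), (0, 35, 36, -70, 1), (-158, 211, 54, 107, -1),
    (-1, -1, -1, 1, 1), (148, -260, -111, -104, 1), (-255, 207, -47, -148, 1), (-1, 1, 1, -1, 1)]

def tab617 : List Row :=
  [(-208, -210, 200, 198, -1), (277, 244, -95, -299, -1), (231, 81, -304, -246, -1),
    (286, 12, 299, 141, -1), (-235, -191, 192, 233, -1), (148, 110, 259, -70, -1),
    (22, -264, -241, -231, -1), (124, -150, -25, -263, -1), (-206, -206, 206, 206, 1),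
    (-107, -242, 269, -1, -1), (-248, 214, -33, -65, -1), (-97, 26, -70, 81, -1),
    (-186, 271, 86, -55, -1), (216, 108, -292, 33, -1), (-44, -34, -77, 246, -1),
    (-178, -285, 155, -18, -1), (78, -244, -165, 255, -1), (-1, 1, 1, -1, 1)]

def tab673 : List Row :=
  [(222, 220, -230, -232, -1), (-95, 113, 19, 279, -1), (46, -92, -45, -309, -1),
    (-157, 169, 13, -44, -1), (98, -21, 78, -77, -1), (-113, -99, -211, -54, -1),
    (-1, -1, -1, -1, 1), (-123, -60, -182, -308, -1), (263, 327, -82, -319, -1),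
    (137, 274, -261, 177, -1), (21, -136, -114, -127, -1), (20, -188, -167, -208, -1),
    (167, -188, -20, -81, -1), (-1, 1, 1, -1, 1)]

def tab1723 : List Row :=
  [(572, 570, -580, -582, -1), (296, -846, -549, 3, -1), (-508, -254, -761, -201, 1),
    (443, -249, 195, 232, 1), (546, -55, 492, -484, -1), (574, 574, -574, -574, 1),
    (-599, 374, -224, -1, -1), (440, -512, -71, -377, -1), (436, -218, 219, 438, 1),
    (637, -836, -198, -3, 1), (-416, -206, -621, -779, -1), (-1, 1, 1, -1, 1)]

def tab2027 : List Row :=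
  [(-678, -680, 670, 668, 1), (-922, -369, 737, 232, 1), (-193, 917, 725, 577, 1),
    (945, 255, -826, 986, 1), (-130, 334, 205, 872, 1), (-676, -676, 676, 676, 1),
    (-881, -970, 177, -1, 1), (-7, 5, -1, -525, 1), (645, 691, -690, 647, 1),
    (-970, -60, 998, -232, 1), (-994, -558, 476, -680, 1), (-1, 1, 1, -1, 1)]

def tab2111 : List Row :=
  [(-706, -708, 698, 696, -1), (897, 759, -454, -441, 1), (0, 899, 900, -313, 1),
    (731, 31, 763, 783, 1), (767, 385, -958, 194, -1), (-1, -1, -1, 1, 1),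
    (785, 891, -434, -888, 1), (688, -173, 516, -353, 1), (881, -1015, -133, 406, 1),
    (21, 315, 337, -186, 1), (-1, 1, 1, -1, 1)]

def tab2281 : List Row :=
  [(758, 756, -766, -768, -1), (-523, 522, 0, 473, 1), (493, -62, 432, -987, -1),
    (1, -1, 1, 1, 1), (874, 141, 1016, -180, 1), (-33, -556, -588, 273, 1), (-1, 1, 1, -1, 1)]

def tab2347 : List Row :=
  [(780, 778, -788, -790, -1), (876, 788, -682, -1155, 1), (1131, -608, 524, 1048, 1),
    (300, -717, -416, 17, 1), (782, 782, -782, -782, 1), (-714, -1021, 613, -1, -1),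
    (-373, 507, 135, 1172, 1), (1019, 664, -663, -1021, 1), (745, 255, 1001, 701, 1),
    (-1, 1, 1, -1, 1)]

def tab2521 : List Row :=
  [(838, 836, -846, -848, -1), (47, 843, 891, 629, 1), (-36, 0, -35, -737, 1),
    (-656, 663, 8, 232, 1), (1206, -439, 768, 1, -1), (840, 840, -840, 840, 1),
    (-295, -530, -824, 366, 1), (-1010, -728, 784, -619, 1), (70, 923, 994, 1241, 1),
    (-602, 697, 96, -1193, 1), (-1, 1, 1, -1, 1)]

def tab2953 : List Row :=
  [(982, 980, -990, -992, 1), (329, -241, 89, 1305, -1), (329, -241, 89, -1305, -1),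
    (982, 980, -990, 992, 1), (-1, 1, 1, 1, 1), (-1006, 132, -873, -1161, -1),
    (772, -374, 399, 0, 1), (-1006, 132, -873, 1161, -1), (-1, 1, 1, -1, 1)]

def tab4391 : List Row :=
  [(-1466, -1468, 1458, 1456, 1), (1326, -1181, 146, 640, 1), (-763, -2174, 1455, -561, -1),
    (-1, -1, -1, -1, 1), (-799, -398, -1196, -1998, 1), (-1313, 79, -1233, -1753, 1),
    (1491, 465, 1957, 492, -1), (-1, 1, 1, -1, 1)]

def tab5689 : List Row :=
  [(1894, 1892, -1902, -1904, -1), (-2691, 2690, 0, 1761, 1), (-1384, 2306, 923, 2767, -1),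
    (1, -1, 1, 1, 1), (1699, 1839, -2150, -1187, -1), (1503, 552, 2056, -1405, -1),
    (-1, 1, 1, -1, 1)]

def tab7019 : List Row :=
  [(-2342, -2344, 2334, 2332, -1), (-2063, -1006, -3068, 2109, -1), (-715, 120, -594, -2674, 1),
    (2205, 1979, -2834, -1839, -1), (-313, 3353, 3041, 937, -1), (-3166, -2400, 1454, 387, -1),
    (2284, 1842, -2892, 1429, 1), (-2778, 1928, -849, 2052, -1), (-288, -3369, 3363, -333, -1),
    (-2340, -2340, 2340, 2340, 1), (1221, 2746, -3051, -1, -1), (2350, 2879, -1789, -2861, -1),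
    (1861, 116, 1978, -1649, 1), (-3407, 1237, -2169, 3213, -1),
    (-3486, 1743, -1742, -3484, -1), (-2613, 1329, -1283, 2760, -1),
    (113, -3490, -3376, -1008, 1), (-1331, -2086, -3416, 2731, -1), (447, 1132, 1580, 3212, -1),
    (-1, 1, 1, -1, 1)]

def tab8123 : List Row :=
  [(-2710, -2712, 2702, 2700, -1), (2582, -791, 1792, 1467, 1), (3638, 1819, -2665, 2793, 1),
    (-3205, -3175, 1744, -1753, -1), (-2708, -2708, 2708, 2708, 1), (1413, 3178, -3531, -1, -1),
    (2593, 1993, -3536, -369, 1), (2510, -1255, 1256, -2512, 1), (-2653, 43, -2609, -1826, -1),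
    (-1, 1, 1, -1, 1)]

def tab10369 : List Row :=
  [(3454, 3452, -3462, -3464, 1), (2474, -2684, -209, -38, 1), (-4135, -3592, 2643, -3190, 1),
    (-1133, -2145, -3277, -4236, 1), (-917, 4726, 3810, 2749, 1), (-1768, 1196, -571, 2323, 1),
    (-2657, -3529, 4184, 3051, -1), (-5001, -158, -5158, 362, 1), (-3384, -3116, 3870, 2271, 1),
    (3456, 3456, -3456, -3456, 1), (-1803, -4058, 4509, -1, 1), (2600, -3793, -1192, 2102, 1),
    (3966, -90, 3877, -715, 1), (404, 5074, -4890, 1290, 1), (-3361, -3504, 3505, -3359, 1),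
    (-1123, 2595, 1473, 454, 1), (2006, 1125, 3132, -3523, -1), (5151, -3391, 1761, -2731, 1),
    (-4832, -4645, 893, 4773, 1), (-1, 1, 1, -1, 1)]

def tab27449 : List Row :=
  [(-9152, -9154, 9144, 9142, 1), (11206, 5603, -10639, -6171, 1),
    (-8703, 5080, -3622, 2232, -1), (-9150, -9150, 9150, 9150, 1), (-3580, -1194, -4773, -1, 1),
    (13641, 6904, -6903, 13643, 1), (6442, -10174, -3731, -13591, -1), (-1, 1, 1, -1, 1)]

def tab95737 : List Row :=
  [(31910, 31908, -31918, -31920, -1), (38883, 0, 38884, 802, 1),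
    (-37462, -12488, 45788, 1, -1), (31912, 31912, -31912, 31912, 1),
    (42608, 7080, -46048, -37559, -1), (-29791, -5098, -34888, -33995, -1), (-1, 1, 1, -1, 1)]

def tab136319 : List Row :=
  [(-45442, -45444, 45434, 45432, -1), (58933, 44375, -33010, -25885, 1), (-1, -1, -1, -1, 1),
    (12392, -61962, -49569, -37180, -1), (-48660, 55295, 6636, -63514, 1), (-1, 1, 1, -1, 1)]

def tab175673 : List Row :=
  [(-58560, -58562, 58552, 58550, 1), (-58778, 63931, 5154, -6654, -1),
    (-50956, 43797, -7158, -50552, -1), (47479, 37983, 85463, 80714, 1), (1, -1, 1, 1, 1),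
    (-55742, 71939, 16198, -73759, -1), (-6261, 6260, 0, 7566, 1),
    (-54628, 40360, -14267, 25148, -1), (-1, 1, 1, -1, 1)]

def tab836477 : List Row :=
  [(-278828, -278830, 278820, 278818, 1), (335534, -285843, 49692, 109021, 1),
    (297434, 85430, 382865, 307580, 1), (45794, 337851, 383646, 115603, 1),
    (-330321, 183726, -146594, 227666, 1), (1, -1, 1, -1, 1),
    (-316505, 248682, -67822, 203468, 1), (51288, -173701, -122412, 78268, 1),
    (-250343, 362339, 111997, 175312, 1), (-137514, -411052, 287912, 26609, 1),
    (-182130, -354728, 299620, 293382, 1), (-1, 1, 1, -1, 1)]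

def tabs : List (ℕ × List Row) :=
  [(7, tab7), (11, tab11), (13, tab13), (17, tab17), (19, tab19), (23, tab23), (29, tab29),
    (31, tab31), (37, tab37), (41, tab41), (43, tab43), (47, tab47), (67, tab67), (73, tab73),
    (83, tab83), (97, tab97), (149, tab149), (191, tab191), (241, tab241), (281, tab281),
    (577, tab577), (617, tab617), (673, tab673), (1723, tab1723), (2027, tab2027),
    (2111, tab2111), (2281, tab2281), (2347, tab2347), (2521, tab2521), (2953, tab2953),
    (4391, tab4391), (5689, tab5689), (7019, tab7019), (8123, tab8123), (10369, tab10369),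
    (27449, tab27449), (95737, tab95737), (136319, tab136319), (175673, tab175673),
    (836477, tab836477)]

/-- modular exponentiation by repeated squaring (the second argument is fuel) -/
def powMod (p : ℕ) : ℕ → ℕ → ℕ → ℕ
  | 0, _, _ => 1
  | f + 1, a, n =>
    if n = 0 then 1
    else if n % 2 = 1 then a * powMod p f (a * a % p) (n / 2) % p
    else powMod p f (a * a % p) (n / 2)

lemma powMod_spec (p : ℕ) (f : ℕ) : ∀ a n : ℕ, n < 2 ^ f →
    ((powMod p f a n : ℕ) : ZMod p) = (a : ZMod p) ^ n := by
  induction f with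
  | zero =>
    intro a n hn
    have : n = 0 := by simpa using hn
    simp [powMod, this]
  | succ f ih =>
    intro a n hn
    have hn2 : n / 2 < 2 ^ f := by rw [pow_succ] at hn; omega
    have key : ((powMod p f (a * a % p) (n / 2) : ℕ) : ZMod p) = (a : ZMod p) ^ (2 * (n / 2)) := by
      rw [ih _ _ hn2, ZMod.natCast_mod, Nat.cast_mul, ← sq, ← pow_mul]
    unfold powMod
    split_ifs with h0 h1
    · simp [h0]
    · rw [ZMod.natCast_mod, Nat.cast_mul, key, ← pow_succ']
      congr 1; omega
    · rw [key]
      congr 1; omega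

/-- proportionality test modulo `p`, the table row being normalized by `c - a - b = 1` -/
def propTo (p : ℕ) (r0 r1 r2 r3 : ℤ) (t : Row) : Prop :=
  (r0 - (r2 - r0 - r1) * t.1) % p = 0 ∧ (r1 - (r2 - r0 - r1) * t.2.1) % p = 0 ∧
  (r2 - (r2 - r0 - r1) * t.2.2.1) % p = 0 ∧ (r3 - (r2 - r0 - r1) * t.2.2.2.1) % p = 0

instance (p : ℕ) (r0 r1 r2 r3 : ℤ) (t : Row) : Decidable (propTo p r0 r1 r2 r3 t) := by
  unfold propTo; infer_instance

/-- The point with parameters `k, A, C` is proportional to the row `t`. -/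
def bProp (p : ℕ) (k A C : ℤ) (t : Row) : Prop :=
  propTo p (k ^ 2 - A ^ 2 + 2 * A * k) (k ^ 2 + A ^ 2) (k ^ 2 - A ^ 2 - 2 * A * k)
    (k ^ 2 - 5 * A ^ 2 - 6 * A * k - 4 * C ^ 2) t

instance (p : ℕ) (k A C : ℤ) (t : Row) : Decidable (bProp p k A C t) := by
  unfold bProp; infer_instance

/-- The duplication map with sign `s` sends the point `(a, b, c, e)` to the row `t`. -/
def stepTo (p : ℕ) (s a b c e : ℤ) (t : Row) : Prop :=
  ((c ^ 2 - 2 * a ^ 2) % p ≠ 0 ∧ bProp p (c * (3 * a * c + 2 * s * b * e))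
      (a * (c ^ 2 - 2 * a ^ 2)) (e * (c ^ 2 - 2 * a ^ 2)) t) ∨
  ((3 * a * c - 2 * s * b * e) % p ≠ 0 ∧ bProp p (-(c * (a ^ 2 + 4 * c ^ 2)))
      (a * (3 * a * c - 2 * s * b * e)) (e * (3 * a * c - 2 * s * b * e)) t) ∨
  ((3 * a * c - 2 * s * b * e) % p = 0 ∧ (c * (a ^ 2 + 4 * c ^ 2)) % p ≠ 0 ∧ bProp p 1 0 0 t)

instance (p : ℕ) (s a b c e : ℤ) (t : Row) : Decidable (stepTo p s a b c e t) := by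
  unfold stepTo; infer_instance

/-- cyclic table lookup -/
def look (T : List Row) (i : ℤ) : Row := T.getD (i % T.length).toNat (0, 0, 0, 0, 0)

def chiOK (p : ℕ) (t : Row) : Prop :=
  (t.2.2.2.2 = 1 ∧ powMod p 32 ((2 * t.2.2.1 ^ 2 - t.2.1 ^ 2) % p).toNat (p / 2) = 1) ∨
  (t.2.2.2.2 = -1 ∧ powMod p 32 ((2 * t.2.2.1 ^ 2 - t.2.1 ^ 2) % p).toNat (p / 2) = p - 1)

instance (p : ℕ) (t : Row) : Decidable (chiOK p t) := by
  unfold chiOK; infer_instance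

/-- All the finite verifications for one prime. -/
def tabOK (p : ℕ) (T : List Row) : Prop :=
  p % 2 = 1 ∧ 2 < p ∧ p / 2 < 2 ^ 32 ∧ 0 < T.length ∧ propTo p (-1) 1 1 (-1) (look T (-1)) ∧
  ∀ i ∈ List.range T.length,
    stepTo p (-1) (look T i).1 (look T i).2.1 (look T i).2.2.1 (look T i).2.2.2.1
      (look T (2 * i + 1)) ∧
    stepTo p 1 (look T i).1 (look T i).2.1 (look T i).2.2.1 (look T i).2.2.2.1
      (look T (-2 * i - 2)) ∧
    chiOK p (look T i)

instance (p : ℕ) (T : List Row) : Decidable (tabOK p T) := by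
  unfold tabOK; infer_instance

lemma tabs_ok : ∀ t ∈ tabs, tabOK t.1 t.2 := by
  decide +kernel

lemma look_mod (T : List Row) {i j : ℤ} (h : i % T.length = j % T.length) :
    look T i = look T j := by
  unfold look; rw [h]

/-- `(a, b, c, e)` reduces modulo `p` to a multiple of the row `t`. -/
def RelRow (p : ℕ) (a b c e : ℤ) (t : Row) : Prop :=
  ∃ μ : ZMod p, (a : ZMod p) = μ * (t.1 : ℤ) ∧ (b : ZMod p) = μ * (t.2.1 : ℤ) ∧
    (c : ZMod p) = μ * (t.2.2.1 : ℤ) ∧ (e : ZMod p) = μ * (t.2.2.2.1 : ℤ)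

lemma zmod_zero_of_emod {p : ℕ} {x : ℤ} (h : x % p = 0) : (x : ZMod p) = 0 :=
  (ZMod.intCast_zmod_eq_zero_iff_dvd x p).mpr (Int.dvd_of_emod_eq_zero h)

lemma emod_of_zmod_zero {p : ℕ} {x : ℤ} (h : (x : ZMod p) = 0) : x % p = 0 :=
  Int.emod_eq_zero_of_dvd ((ZMod.intCast_zmod_eq_zero_iff_dvd x p).mp h)

lemma rel_of_scale {p : ℕ} [Fact p.Prime] {a b c e : ℤ} {r0 r1 r2 r3 : ℤ} {t : Row}
    (z g : ZMod p) (hz : z ≠ 0) (h0 : z * a = g * r0) (h1 : z * b = g * r1)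
    (h2 : z * c = g * r2) (h3 : z * e = g * r3) (h : propTo p r0 r1 r2 r3 t) :
    RelRow p a b c e t := by
  obtain ⟨k0, k1, k2, k3⟩ := h
  have k0 := zmod_zero_of_emod k0
  have k1 := zmod_zero_of_emod k1
  have k2 := zmod_zero_of_emod k2
  have k3 := zmod_zero_of_emod k3
  push_cast at k0 k1 k2 k3
  refine ⟨z⁻¹ * (g * (r2 - r0 - r1)), ?_, ?_, ?_, ?_⟩
  · apply mul_left_cancel₀ hz
    rw [h0, mul_assoc, mul_inv_cancel_left₀ hz]
    linear_combination g * k0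
  · apply mul_left_cancel₀ hz
    rw [h1, mul_assoc, mul_inv_cancel_left₀ hz]
    linear_combination g * k1
  · apply mul_left_cancel₀ hz
    rw [h2, mul_assoc, mul_inv_cancel_left₀ hz]
    linear_combination g * k2
  · apply mul_left_cancel₀ hz
    rw [h3, mul_assoc, mul_inv_cancel_left₀ hz]
    linear_combination g * k3

/-- Reduction modulo `p` of a quadruple given by integral parameters. -/
lemma rel_of_params {p : ℕ} [Fact p.Prime] {a b c e σ k A C : ℤ} {k' A' C' : ℤ} {t : Row}
    (hσ : σ = 1 ∨ σ = -1) (hp : (2 : ZMod p) ≠ 0)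
    (e1 : 2 * σ * a = k ^ 2 - A ^ 2 + 2 * A * k)
    (e2 : 2 * σ * b = k ^ 2 + A ^ 2)
    (e3 : 2 * σ * c = k ^ 2 - A ^ 2 - 2 * A * k)
    (e4 : 2 * σ * e = k ^ 2 - 5 * A ^ 2 - 6 * A * k - 4 * C ^ 2)
    (W l : ZMod p) (hW : W ≠ 0) (hk : W * k = l * k') (hA : W * A = l * A') (hC : W * C = l * C')
    (h : bProp p k' A' C' t) : RelRow p a b c e t := by
  have hs : (σ : ZMod p) ≠ 0 := by rcases hσ with rfl | rfl <;> simp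
  have e1 := congrArg (Int.cast : ℤ → ZMod p) e1
  have e2 := congrArg (Int.cast : ℤ → ZMod p) e2
  have e3 := congrArg (Int.cast : ℤ → ZMod p) e3
  have e4 := congrArg (Int.cast : ℤ → ZMod p) e4
  push_cast at e1 e2 e3 e4
  refine rel_of_scale (W ^ 2 * (2 * σ)) (l ^ 2) (mul_ne_zero (pow_ne_zero 2 hW)
    (mul_ne_zero hp hs)) ?_ ?_ ?_ ?_ h
  · push_cast
    linear_combination W ^ 2 * e1 + (W * k + l * k' + 2 * W * A) * hk
      + (2 * l * k' - W * A - l * A') * hA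
  · push_cast
    linear_combination W ^ 2 * e2 + (W * k + l * k') * hk + (W * A + l * A') * hA
  · push_cast
    linear_combination W ^ 2 * e3 + (W * k + l * k' - 2 * W * A) * hk
      + (-2 * l * k' - W * A - l * A') * hA
  · push_cast
    linear_combination W ^ 2 * e4 + (W * k + l * k' - 6 * W * A) * hk
      + (-6 * l * k' - 5 * W * A - 5 * l * A') * hA - 4 * (W * C + l * C') * hC

lemma mu_ne_zero {p : ℕ} [Fact p.Prime] {a b c e : ℤ} {t : Row} (hac : IsCoprime a c)
    (h : RelRow p a b c e t) : ∃ μ : ZMod p, μ ≠ 0 ∧ (a : ZMod p) = μ * (t.1 : ℤ) ∧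
    (b : ZMod p) = μ * (t.2.1 : ℤ) ∧
    (c : ZMod p) = μ * (t.2.2.1 : ℤ) ∧ (e : ZMod p) = μ * (t.2.2.2.1 : ℤ) := by
  obtain ⟨μ, h0, h1, h2, h3⟩ := h
  refine ⟨μ, ?_, h0, h1, h2, h3⟩
  rintro rfl
  obtain ⟨x, y, hxy⟩ := hac
  have := congrArg (Int.cast : ℤ → ZMod p) hxy
  push_cast at this
  rw [h0, h2] at this
  simp at this

lemma rel_step {p : ℕ} [Fact p.Prime] {a b c e σ g k s a' b' c' e' : ℤ} {t t' : Row}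
    (hp : (2 : ZMod p) ≠ 0) (hσ : σ = 1 ∨ σ = -1) (hs : s = 1 ∨ s = -1)
    (hac : IsCoprime a' c') (q1 : a' ^ 2 + c' ^ 2 = 2 * b' ^ 2)
    (q2 : a' ^ 2 + e' ^ 2 = 2 * c' ^ 2) (hw : c' ^ 2 - 2 * a' ^ 2 ≠ 0)
    (e1 : 2 * σ * a = k ^ 2 - (g * a') ^ 2 + 2 * (g * a') * k)
    (e2 : 2 * σ * b = k ^ 2 + (g * a') ^ 2)
    (e3 : 2 * σ * c = k ^ 2 - (g * a') ^ 2 - 2 * (g * a') * k)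
    (e4 : 2 * σ * e = k ^ 2 - 5 * (g * a') ^ 2 - 6 * (g * a') * k - 4 * (g * e') ^ 2)
    (e5 : k * (c' ^ 2 - 2 * a' ^ 2) = g * (c' * (3 * a' * c' + 2 * s * b' * e')))
    (hr : RelRow p a' b' c' e' t)
    (hstep : stepTo p s t.1 t.2.1 t.2.2.1 t.2.2.2.1 t') : RelRow p a b c e t' := by
  obtain ⟨μ, hμ, r0, r1, r2, r3⟩ := mu_ne_zero hac hr
  have e6 : k * (3 * a' * c' - 2 * s * b' * e') = g * (-(c' * (a' ^ 2 + 4 * c' ^ 2))) := by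
    apply mul_left_cancel₀ hw
    have hss : s ^ 2 = 1 := by rcases hs with rfl | rfl <;> rfl
    have q3 : (2 * b' ^ 2) * e' ^ 2 = (a' ^ 2 + c' ^ 2) * (2 * c' ^ 2 - a' ^ 2) := by
      rw [← q1, ← q2]; ring
    linear_combination (3 * a' * c' - 2 * s * b' * e') * e5 - 2 * g * c' * q3
      - 4 * g * c' * b' ^ 2 * e' ^ 2 * hss
  have e5 := congrArg (Int.cast : ℤ → ZMod p) e5
  have e6 := congrArg (Int.cast : ℤ → ZMod p) e6
  push_cast at e5 e6
  rw [r0, r1, r2, r3] at e5 e6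
  rcases hstep with ⟨hne, hb⟩ | ⟨hne, hb⟩ | ⟨hz, hne, hb⟩
  · have hne' : (((t.2.2.1 ^ 2 - 2 * t.1 ^ 2 : ℤ)) : ZMod p) ≠ 0 :=
      fun h => hne (emod_of_zmod_zero h)
    push_cast at hne'
    refine rel_of_params hσ hp e1 e2 e3 e4 _ (g * μ) hne' ?_ ?_ ?_ hb
    · push_cast
      apply mul_left_cancel₀ (pow_ne_zero 2 hμ)
      linear_combination e5
    · push_cast
      rw [r0]; ring
    · push_cast
      rw [r3]; ring
  · have hne' : (((3 * t.1 * t.2.2.1 - 2 * s * t.2.1 * t.2.2.2.1 : ℤ)) : ZMod p) ≠ 0 :=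
      fun h => hne (emod_of_zmod_zero h)
    push_cast at hne'
    refine rel_of_params hσ hp e1 e2 e3 e4 _ (g * μ) hne' ?_ ?_ ?_ hb
    · push_cast
      apply mul_left_cancel₀ (pow_ne_zero 2 hμ)
      linear_combination e6
    · push_cast
      rw [r0]; ring
    · push_cast
      rw [r3]; ring
  · have hne' : (((t.2.2.1 * (t.1 ^ 2 + 4 * t.2.2.1 ^ 2) : ℤ)) : ZMod p) ≠ 0 :=
      fun h => hne (emod_of_zmod_zero h)
    have hz' := zmod_zero_of_emod hz
    push_cast at hne' hz'
    have hg : (g : ZMod p) = 0 := by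
      have h1 : (g : ZMod p) * (μ ^ 3 * (t.2.2.1 * (t.1 ^ 2 + 4 * t.2.2.1 ^ 2))) = 0 := by
        linear_combination e6 - k * μ ^ 2 * hz'
      rcases mul_eq_zero.mp h1 with h1 | h1
      · exact h1
      · exact absurd h1 (mul_ne_zero (pow_ne_zero 3 hμ) hne')
    refine rel_of_params hσ hp e1 e2 e3 e4 1 k one_ne_zero ?_ ?_ ?_ hb
    · push_cast
      ring
    · push_cast
      rw [hg]; ring
    · push_cast
      rw [hg]; ring

lemma tab_step {p : ℕ} {T : List Row} (h : tabOK p T) (i : ℤ) :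
    stepTo p (-1) (look T i).1 (look T i).2.1 (look T i).2.2.1 (look T i).2.2.2.1
      (look T (2 * i + 1)) ∧
    stepTo p 1 (look T i).1 (look T i).2.1 (look T i).2.2.1 (look T i).2.2.2.1
      (look T (-2 * i - 2)) ∧
    chiOK p (look T i) := by
  obtain ⟨-, -, -, hlen, -, h⟩ := h
  have hl : (0 : ℤ) < T.length := by exact_mod_cast hlen
  have h0 := Int.emod_nonneg i hl.ne'
  have h1 := Int.emod_lt_of_pos i hl
  have hcast : (((i % (T.length : ℤ)).toNat : ℕ) : ℤ) = i % T.length := Int.toNat_of_nonneg h0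
  have := h (i % T.length).toNat (List.mem_range.mpr (by omega))
  rw [hcast] at this
  have hm : (i % T.length) ≡ i [ZMOD T.length] := Int.mod_modEq _ _
  have l1 : look T (i % T.length) = look T i := look_mod T hm
  have l2 : look T (2 * (i % T.length) + 1) = look T (2 * i + 1) :=
    look_mod T ((hm.mul_left 2).add_right 1)
  have l3 : look T (-2 * (i % T.length) - 2) = look T (-2 * i - 2) :=
    look_mod T ((hm.mul_left (-2)).sub_right 2)
  rw [l1, l2, l3] at this
  exact this

lemma two_ne {p : ℕ} (h1 : 2 < p) : (2 : ZMod p) ≠ 0 := by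
  intro h
  have h2 : ((2 : ℕ) : ZMod p) = 0 := by exact_mod_cast h
  rw [ZMod.natCast_eq_zero_iff] at h2
  exact absurd (Nat.le_of_dvd (by norm_num) h2) (by omega)

lemma not_two_mul_sq {a c : ℤ} (mc : c % 4 = 1) : c ^ 2 - 2 * a ^ 2 ≠ 0 := by
  intro h
  have := sq_mod8 (n := c) (by omega)
  omega

/-- Every normalized primitive quadruple has a simultaneous index in all the tables. -/
lemma index_exists (n : ℕ) : ∀ a b c e : ℤ, c.natAbs = n → IsCoprime a c →
    a ^ 2 + c ^ 2 = 2 * b ^ 2 → a ^ 2 + e ^ 2 = 2 * c ^ 2 →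
    a % 4 = 3 → b % 4 = 1 → c % 4 = 1 → e % 4 = 3 →
    ∃ i : ℤ, ∀ t ∈ tabs, t.1.Prime → RelRow t.1 a b c e (look t.2 i) := by
  induction n using Nat.strong_induction_on with
  | _ n ih =>
    intro a b c e hn hac h1 h2 ma mb mc me
    by_cases hc : |c| ≤ 1
    · have hc1 : c = 1 := by
        have := abs_le.mp hc
        omega
      subst hc1
      have ha : a = -1 := by
        have : a ^ 2 < 2 ^ 2 := by nlinarith [sq_nonneg e]
        have := abs_lt.mp (abs_lt_of_sq_lt_sq this (by norm_num))
        omega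
      subst ha
      have he : e = -1 := by
        have : e ^ 2 < 2 ^ 2 := by nlinarith
        have := abs_lt.mp (abs_lt_of_sq_lt_sq this (by norm_num))
        omega
      have hb : b = 1 := by
        have : b ^ 2 < 2 ^ 2 := by nlinarith
        have := abs_lt.mp (abs_lt_of_sq_lt_sq this (by norm_num))
        omega
      subst he hb
      refine ⟨-1, fun t ht hp => ?_⟩
      haveI : Fact t.1.Prime := ⟨hp⟩
      obtain ⟨-, -, -, -, h, -⟩ := tabs_ok t ht
      exact rel_of_scale 1 1 one_ne_zero rfl rfl rfl rfl h
    · push Not at hc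
      obtain ⟨σ, g, k, s, a', b', c', e', hσ, hs, hac', q1, q2, ma', mb', mc', me', hle,
        e1, e2, e3, e4, e5⟩ := descent hac h1 h2 ma mb mc me
      have hlt : c'.natAbs < n := by
        have h3 : c' ^ 2 < |c| ^ 2 := by nlinarith
        have h4 : |c'| < |c| := by
          have := abs_lt_of_sq_lt_sq h3 (abs_nonneg c)
          exact this
        rw [Int.abs_eq_natAbs, Int.abs_eq_natAbs] at h4
        rw [← hn]
        exact_mod_cast h4
      obtain ⟨i, hi⟩ := ih _ hlt a' b' c' e' rfl hac' q1 q2 ma' mb' mc' me'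
      have main : ∀ t ∈ tabs, t.1.Prime → ∀ t', stepTo t.1 s (look t.2 i).1 (look t.2 i).2.1
          (look t.2 i).2.2.1 (look t.2 i).2.2.2.1 t' → RelRow t.1 a b c e t' := by
        intro t ht hp t' hst
        haveI : Fact t.1.Prime := ⟨hp⟩
        exact rel_step (two_ne (tabs_ok t ht).2.1) hσ hs hac' q1 q2 (not_two_mul_sq mc')
          e1 e2 e3 e4 e5 (hi t ht hp) hst
      rcases hs with rfl | rfl
      · exact ⟨-2 * i - 2, fun t ht hp => main t ht hp _ (tab_step (tabs_ok t ht) i).2.1⟩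
      · exact ⟨2 * i + 1, fun t ht hp => main t ht hp _ (tab_step (tabs_ok t ht) i).1⟩

lemma one_ne_neg_one {p : ℕ} [Fact p.Prime] (h : (2 : ZMod p) ≠ 0) : (1 : ZMod p) ≠ -1 := by
  intro h1
  apply h
  linear_combination h1

lemma chi_spec {p : ℕ} [Fact p.Prime] (hp : 2 < p) (hp2 : p / 2 < 2 ^ 32) {t : Row}
    (h : chiOK p t) : legendreSym p (2 * t.2.2.1 ^ 2 - t.2.1 ^ 2) = t.2.2.2.2 ∧
      t.2.2.2.2 ≠ 0 := by
  have h2 := two_ne hp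
  have h11 := one_ne_neg_one h2
  generalize hN : 2 * t.2.2.1 ^ 2 - t.2.1 ^ 2 = N
  unfold chiOK at h
  rw [hN] at h
  have hp0 : (0 : ℤ) < p := by exact_mod_cast (by omega : 0 < p)
  have hcast : (((N % p).toNat : ℕ) : ZMod p) = (N : ZMod p) := by
    have h3 : (((N % p).toNat : ℕ) : ℤ) = N % p := Int.toNat_of_nonneg (Int.emod_nonneg _ hp0.ne')
    have h4 : ((((N % p).toNat : ℕ) : ℤ) : ZMod p) = ((N % p : ℤ) : ZMod p) := by rw [h3]
    rw [ZMod.intCast_mod] at h4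
    exact_mod_cast h4
  have hs := powMod_spec p 32 (N % p).toNat (p / 2) hp2
  rw [hcast, ← legendreSym.eq_pow] at hs
  have hN0 : (legendreSym p N : ZMod p) ≠ 0 → legendreSym p N = 1 ∨ legendreSym p N = -1 := by
    intro h3
    apply legendreSym.eq_one_or_neg_one
    intro h4
    apply h3
    rw [(legendreSym.eq_zero_iff p N).mpr h4]; simp
  rcases h with ⟨hc, h⟩ | ⟨hc, h⟩
  · rw [h] at hs
    rw [hc]
    refine ⟨?_, by norm_num⟩
    rcases hN0 (by rw [← hs]; simp) with h3 | h3
    · exact h3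
    · rw [h3] at hs
      exfalso; apply h11; simpa using hs
  · rw [h, Nat.cast_sub (by omega)] at hs
    rw [hc]
    refine ⟨?_, by norm_num⟩
    simp only [CharP.cast_eq_zero, Nat.cast_one, zero_sub] at hs
    rcases hN0 (by rw [← hs]; simp) with h3 | h3
    · rw [h3] at hs
      exfalso; apply h11; simpa using hs.symm
    · exact h3

/-- the Legendre symbol entry -/
def chi (T : List Row) (i : ℤ) : ℤ := (look T i).2.2.2.2

lemma leg_eq {D a b c e y : ℤ} (hac : IsCoprime a c) (hy : D * y ^ 2 = 2 * c ^ 2 - b ^ 2)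
    {i : ℤ} (hi : ∀ t ∈ tabs, t.1.Prime → RelRow t.1 a b c e (look t.2 i))
    (p : ℕ) [hp : Fact p.Prime] (T : List Row) (ht : (p, T) ∈ tabs) :
    legendreSym p D = chi T i := by
  have hr := hi _ ht hp.out
  obtain ⟨μ, hμ, r0, r1, r2, r3⟩ := mu_ne_zero hac hr
  have hok := tabs_ok _ ht
  obtain ⟨hc1, hc2⟩ := chi_spec hok.2.1 hok.2.2.1 (tab_step hok i).2.2
  dsimp only at hc1 hc2 r0 r1 r2 r3
  unfold chi
  obtain ⟨m, rfl⟩ := ZMod.intCast_surjective μ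
  have hN : ((D * y ^ 2 : ℤ) : ZMod p)
      = ((m ^ 2 * (2 * (look T i).2.2.1 ^ 2 - (look T i).2.1 ^ 2) : ℤ) : ZMod p) := by
    rw [hy]; push_cast; rw [r1, r2]; ring
  have hL : legendreSym p (D * y ^ 2)
      = legendreSym p (m ^ 2 * (2 * (look T i).2.2.1 ^ 2 - (look T i).2.1 ^ 2)) := by
    unfold legendreSym; rw [hN]
  rw [legendreSym.mul, legendreSym.mul, legendreSym.sq_one' p hμ, hc1, one_mul] at hL
  have hy0 : (y : ZMod p) ≠ 0 := by
    intro h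
    apply hc2
    rw [← hL]
    have : legendreSym p (y ^ 2) = 0 := by
      rw [legendreSym.eq_zero_iff]; push_cast; rw [h]; ring
    rw [this, mul_zero]
  rw [legendreSym.sq_one' p hy0, mul_one] at hL
  exact hL

lemma pair_check (P : ℤ → ℤ → Prop) (T T' : List Row) (M : ℕ) (hM : 0 < M)
    (h1 : T.length ∣ M) (h2 : T'.length ∣ M)
    (h : ∀ r ∈ List.range M, P (chi T r) (chi T' r)) (i : ℤ) : P (chi T i) (chi T' i) := by
  have hl : (0 : ℤ) < M := by exact_mod_cast hM
  have h0 := Int.emod_nonneg i hl.ne'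
  have h3 := Int.emod_lt_of_pos i hl
  have hcast : (((i % (M : ℤ)).toNat : ℕ) : ℤ) = i % M := Int.toNat_of_nonneg h0
  have := h (i % M).toNat (List.mem_range.mpr (by omega))
  rw [hcast] at this
  have l1 : chi T (i % M) = chi T i := by
    unfold chi
    rw [look_mod T (Int.emod_emod_of_dvd i (by exact_mod_cast h1))]
  have l2 : chi T' (i % M) = chi T' i := by
    unfold chi
    rw [look_mod T' (Int.emod_emod_of_dvd i (by exact_mod_cast h2))]
  rwa [l1, l2] at this

/-- **The Mordell–Weil sieve conditions.**
If `D` is a squarefree integer such that `C_D(ℚ) ≠ ∅`, then the Legendre symbols `(D/p)`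
satisfy the listed conditions (i)–(iv). -/
theorem MW_sieve_conditions (D : ℤ) (hD : Squarefree D)
    (hpt : ∃ x : Fin 5 → ℚ, x ≠ 0 ∧
      x 0 ^ 2 - 2 * x 1 ^ 2 + x 2 ^ 2 = 0 ∧
      x 1 ^ 2 - 2 * x 2 ^ 2 + (D : ℚ) * x 3 ^ 2 = 0 ∧
      x 2 ^ 2 - 2 * (D : ℚ) * x 3 ^ 2 + x 4 ^ 2 = 0) :
    -- (i)
    (legendreSym 17 D = 1 ∧ legendreSym 23 D = 1 ∧ legendreSym 41 D = 1 ∧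
      legendreSym 191 D = 1 ∧ legendreSym 281 D = 1 ∧ legendreSym 2027 D = 1 ∧
      legendreSym 836477 D = 1) ∧
    -- (ii)
    (legendreSym 7 D = legendreSym 13 D ∧
      legendreSym 11 D = legendreSym 19 D ∧ legendreSym 19 D = legendreSym 241 D ∧
      legendreSym 47 D = legendreSym 73 D ∧
      legendreSym 149 D = legendreSym 673 D ∧
      legendreSym 43 D = legendreSym 1723 D ∧
      legendreSym 175673 D = legendreSym 2953 D ∧
      legendreSym 97 D = legendreSym 5689 D ∧ legendreSym 5689 D = legendreSym 95737 D ∧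
      legendreSym 577 D = legendreSym 2281 D ∧
      legendreSym 83 D = legendreSym 4391 D ∧ legendreSym 4391 D = legendreSym 27449 D ∧
      legendreSym 67 D = legendreSym 136319 D ∧
      legendreSym 2111 D = legendreSym 2521 D) ∧
    -- (iii)
    ((legendreSym 29 D = 1 → legendreSym 11 D = 1) ∧
      (legendreSym 149 D = 1 → legendreSym 31 D = 1) ∧
      (legendreSym 7019 D = 1 → legendreSym 8123 D = 1) ∧
      (legendreSym 617 D = 1 → legendreSym 37 D = 1 ∧ legendreSym 7 D = 1)) ∧
    -- (iv)
    ((legendreSym 83 D = -1 → legendreSym 11 D = -1) ∧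
      (legendreSym 2347 D = -1 → legendreSym 47 D = -1) ∧
      (legendreSym 10369 D = -1 → legendreSym 47 D = -1)) := by
  obtain ⟨x, hx, e1, e2, e3⟩ := hpt
  obtain ⟨a, b, c, e, y, hac, h1, h2, hy, ma, mb, mc, me⟩ := to_int D hD x hx e1 e2 e3
  obtain ⟨i, hi⟩ := index_exists _ a b c e rfl hac h1 h2 ma mb mc me
  have L := fun (p : ℕ) (hp : Fact p.Prime) (T : List Row) (ht : (p, T) ∈ tabs) =>
    leg_eq hac hy hi p T ht
  rw [L 7 _ tab7 (by simp [tabs])]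
  rw [L 11 _ tab11 (by simp [tabs])]
  rw [L 13 _ tab13 (by simp [tabs])]
  rw [L 17 _ tab17 (by simp [tabs])]
  rw [L 19 _ tab19 (by simp [tabs])]
  rw [L 23 _ tab23 (by simp [tabs])]
  rw [L 29 _ tab29 (by simp [tabs])]
  rw [L 31 _ tab31 (by simp [tabs])]
  rw [L 37 _ tab37 (by simp [tabs])]
  rw [L 41 _ tab41 (by simp [tabs])]
  rw [L 43 _ tab43 (by simp [tabs])]
  rw [L 47 _ tab47 (by simp [tabs])]
  rw [L 67 _ tab67 (by simp [tabs])]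
  rw [L 73 _ tab73 (by simp [tabs])]
  rw [L 83 _ tab83 (by simp [tabs])]
  rw [L 97 _ tab97 (by simp [tabs])]
  rw [L 149 _ tab149 (by simp [tabs])]
  rw [L 191 _ tab191 (by simp [tabs])]
  rw [L 241 _ tab241 (by simp [tabs])]
  rw [L 281 _ tab281 (by simp [tabs])]
  rw [L 577 _ tab577 (by simp [tabs])]
  rw [L 617 _ tab617 (by simp [tabs])]
  rw [L 673 _ tab673 (by simp [tabs])]
  rw [L 1723 _ tab1723 (by simp [tabs])]
  rw [L 2027 _ tab2027 (by simp [tabs])]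
  rw [L 2111 _ tab2111 (by simp [tabs])]
  rw [L 2281 _ tab2281 (by simp [tabs])]
  rw [L 2347 _ tab2347 (by simp [tabs])]
  rw [L 2521 _ tab2521 (by simp [tabs])]
  rw [L 2953 _ tab2953 (by simp [tabs])]
  rw [L 4391 _ tab4391 (by simp [tabs])]
  rw [L 5689 _ tab5689 (by simp [tabs])]
  rw [L 7019 _ tab7019 (by simp [tabs])]
  rw [L 8123 _ tab8123 (by simp [tabs])]
  rw [L 10369 _ tab10369 (by simp [tabs])]
  rw [L 27449 _ tab27449 (by simp [tabs])]
  rw [L 95737 _ tab95737 (by simp [tabs])]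
  rw [L 136319 _ tab136319 (by simp [tabs])]
  rw [L 175673 _ tab175673 (by simp [tabs])]
  rw [L 836477 _ tab836477 (by simp [tabs])]
  refine ⟨⟨?_, ?_, ?_, ?_, ?_, ?_, ?_⟩, ⟨?_, ?_, ?_, ?_, ?_, ?_, ?_, ?_, ?_, ?_, ?_, ?_, ?_, ?_⟩,
    ⟨?_, ?_, ?_, fun h => ⟨?_, ?_⟩⟩, ⟨?_, ?_, ?_⟩⟩
  · exact pair_check (fun x _ => x = 1) tab17 tab17 3 (by decide) (by decide) (by decide)
      (by decide +kernel) i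
  · exact pair_check (fun x _ => x = 1) tab23 tab23 3 (by decide) (by decide) (by decide)
      (by decide +kernel) i
  · exact pair_check (fun x _ => x = 1) tab41 tab41 5 (by decide) (by decide) (by decide)
      (by decide +kernel) i
  · exact pair_check (fun x _ => x = 1) tab191 tab191 4 (by decide) (by decide) (by decide)
      (by decide +kernel) i
  · exact pair_check (fun x _ => x = 1) tab281 tab281 6 (by decide) (by decide) (by decide)
      (by decide +kernel) i
  · exact pair_check (fun x _ => x = 1) tab2027 tab2027 12 (by decide) (by decide) (by decide)
      (by decide +kernel) i
  · exact pair_check (fun x _ => x = 1) tab836477 tab836477 12 (by decide) (by decide) (by decide)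
      (by decide +kernel) i
  · exact pair_check (fun x y => x = y) tab7 tab13 3 (by decide) (by decide) (by decide)
      (by decide +kernel) i
  · exact pair_check (fun x y => x = y) tab11 tab19 4 (by decide) (by decide) (by decide)
      (by decide +kernel) i
  · exact pair_check (fun x y => x = y) tab19 tab241 4 (by decide) (by decide) (by decide)
      (by decide +kernel) i
  · exact pair_check (fun x y => x = y) tab47 tab73 5 (by decide) (by decide) (by decide)
      (by decide +kernel) i
  · exact pair_check (fun x y => x = y) tab149 tab673 14 (by decide) (by decide) (by decide)
      (by decide +kernel) i
  · exact pair_check (fun x y => x = y) tab43 tab1723 12 (by decide) (by decide) (by decide)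
      (by decide +kernel) i
  · exact pair_check (fun x y => x = y) tab175673 tab2953 9 (by decide) (by decide) (by decide)
      (by decide +kernel) i
  · exact pair_check (fun x y => x = y) tab97 tab5689 7 (by decide) (by decide) (by decide)
      (by decide +kernel) i
  · exact pair_check (fun x y => x = y) tab5689 tab95737 7 (by decide) (by decide) (by decide)
      (by decide +kernel) i
  · exact pair_check (fun x y => x = y) tab577 tab2281 7 (by decide) (by decide) (by decide)
      (by decide +kernel) i
  · exact pair_check (fun x y => x = y) tab83 tab4391 8 (by decide) (by decide) (by decide)
      (by decide +kernel) i
  · exact pair_check (fun x y => x = y) tab4391 tab27449 8 (by decide) (by decide) (by decide)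
      (by decide +kernel) i
  · exact pair_check (fun x y => x = y) tab67 tab136319 6 (by decide) (by decide) (by decide)
      (by decide +kernel) i
  · exact pair_check (fun x y => x = y) tab2111 tab2521 11 (by decide) (by decide) (by decide)
      (by decide +kernel) i
  · exact pair_check (fun x y => x = 1 → y = 1) tab29 tab11 8 (by decide) (by decide) (by decide)
      (by decide +kernel) i
  · exact pair_check (fun x y => x = 1 → y = 1) tab149 tab31 14 (by decide) (by decide) (by decide)
      (by decide +kernel) i
  · exact pair_check (fun x y => x = 1 → y = 1) tab7019 tab8123 20 (by decide) (by decide) (by decide)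
      (by decide +kernel) i
  · exact pair_check (fun x y => x = 1 → y = 1) tab617 tab37 18 (by decide) (by decide) (by decide)
      (by decide +kernel) i h
  · exact pair_check (fun x y => x = 1 → y = 1) tab617 tab7 18 (by decide) (by decide) (by decide)
      (by decide +kernel) i h
  · exact pair_check (fun x y => x = -1 → y = -1) tab83 tab11 8 (by decide) (by decide) (by decide)
      (by decide +kernel) i
  · exact pair_check (fun x y => x = -1 → y = -1) tab2347 tab47 10 (by decide) (by decide) (by decide)
      (by decide +kernel) i
  · exact pair_check (fun x y => x = -1 → y = -1) tab10369 tab47 20 (by decide) (by decide) (by decide)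
      (by decide +kernel) i
end

section
/- Let D > 3 be a prime number, let K = ℚ(√2), and set q(t) = t⁴ − 8t³ + 2t² + 8t + 1, q₁(t) = t² − (4 + 2√2)t − 3 − 2√2 ∈ K[t], and let q₂(t) be its conjugate t² − (4 − 2√2)t − 3 + 2√2, so that q(t) = q₁(t)q₂(t). Assume the curve F : D·X₃² = q(t) has a rational point, and let α ∈ ℤ[√2] be such that for some rational point (t₀, X₃,₀) of F (with t₀, X₃,₀ ∈ ℚ), q₁(t₀)/α is a square in K. Then for every rational point (t, X₃) of F, the element q₁(t) ∈ K lies in one of the four classes α·(K*)², \bar{α}·(K*)², (−α)·(K*)², (−\bar{α})·(K*)², where \bar{α} denotes the conjugate of α over ℚ. -/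
open IntermediateField

/-- The real quadratic field `K = ℚ(√2)`, realized inside `ℝ`. -/
noncomputable def Qsqrt2 : IntermediateField ℚ ℝ := ℚ⟮Real.sqrt 2⟯

/-- The element `√2` of `ℚ(√2)`. -/
noncomputable def sq2 : Qsqrt2 := ⟨Real.sqrt 2, mem_adjoin_simple_self ℚ (Real.sqrt 2)⟩

/-- The quartic `q(t) = t⁴ − 8t³ + 2t² + 8t + 1` (evaluated over `ℚ`). -/
def qQuartic (t : ℚ) : ℚ := t ^ 4 - 8 * t ^ 3 + 2 * t ^ 2 + 8 * t + 1

/-- The factor `q₁(t) = t² − (4 + 2√2)t − 3 − 2√2 ∈ ℚ(√2)[t]`. -/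
noncomputable def q1 (t : Qsqrt2) : Qsqrt2 :=
  t ^ 2 - (4 + 2 * sq2) * t - 3 - 2 * sq2

lemma sq2_mul_self : sq2 * sq2 = 2 := by
  apply Subtype.ext
  simp [sq2]
  rfl

/-- The embedding of `ℤ[√2]` into `ℚ(√2)`. -/
noncomputable def emb : ℤ√2 →+* Qsqrt2 :=
  Zsqrtd.lift ⟨sq2, by rw [sq2_mul_self]; norm_num⟩

lemma emb_apply (x : ℤ√2) : emb x = (x.re : Qsqrt2) + (x.im : Qsqrt2) * sq2 := rfl

lemma two_nonsq (n : ℤ) : (2 : ℤ) ≠ n * n := by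
  intro h
  have h1 : n < 2 := by nlinarith
  have h2 : -2 < n := by nlinarith
  interval_cases n <;> omega

lemma emb_inj : Function.Injective emb := Zsqrtd.lift_injective _ two_nonsq

instance isDomainZ2 : IsDomain (ℤ√2) := emb_inj.isDomain emb

lemma norm_ne_zero_Z2 {x : ℤ√2} (hx : x ≠ 0) : x.norm ≠ 0 := by
  rwa [Ne, Zsqrtd.norm_eq_zero two_nonsq]

lemma exists_quot (x y : ℤ√2) (hy : y ≠ 0) :
    ∃ c : ℤ√2, (x - y * c).norm.natAbs < y.norm.natAbs := by
  have hN := norm_ne_zero_Z2 hy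
  have hNQ : (y.norm : ℚ) ≠ 0 := by exact_mod_cast hN
  set A : ℚ := ((x * star y).re : ℚ) / y.norm with hA
  set B : ℚ := ((x * star y).im : ℚ) / y.norm with hB
  refine ⟨⟨round A, round B⟩, ?_⟩
  have h1 := abs_le.1 (abs_sub_round A)
  have h2 := abs_le.1 (abs_sub_round B)
  set c : ℤ√2 := ⟨round A, round B⟩ with hc
  have key : ((x - y * c).norm : ℚ) = y.norm * ((A - round A) ^ 2 - 2 * (B - round B) ^ 2) := by
    have e1 : A * y.norm = ((x * star y).re : ℚ) := by rw [hA]; field_simp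
    have e2 : B * y.norm = ((x * star y).im : ℚ) := by rw [hB]; field_simp
    apply mul_left_cancel₀ hNQ
    have e3 : y.norm * (x - y * c).norm =
        ((x * star y).re - y.norm * c.re) ^ 2 - 2 * ((x * star y).im - y.norm * c.im) ^ 2 := by
      simp [Zsqrtd.norm_def]; ring
    have e4 : (y.norm : ℚ) * (x - y * c).norm =
        ((x * star y).re - y.norm * c.re) ^ 2 - 2 * ((x * star y).im - y.norm * c.im) ^ 2 := by
      exact_mod_cast e3
    rw [e4, ← e1, ← e2]; simp only [hc]; ring
  zify
  have : |((x - y * c).norm : ℚ)| < |(y.norm : ℚ)| := by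
    rw [key, abs_mul]
    apply mul_lt_of_lt_one_right (abs_pos.2 hNQ)
    rw [abs_lt]
    constructor <;> nlinarith
  exact_mod_cast this

open Classical in
@[reducible] noncomputable def euclZ2 : EuclideanDomain (ℤ√2) :=
  { (inferInstance : CommRing (ℤ√2)), (inferInstance : Nontrivial (ℤ√2)) with
    quotient := fun x y => if h : y = 0 then 0 else (exists_quot x y h).choose
    remainder := fun x y => x - y * (if h : y = 0 then 0 else (exists_quot x y h).choose)
    quotient_zero := by simp
    quotient_mul_add_remainder_eq := fun x y => by ring
    r := _
    r_wellFounded := (measure (Int.natAbs ∘ Zsqrtd.norm)).wf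
    remainder_lt := fun x y hy => by
      have := (exists_quot x y hy).choose_spec
      change (x - y * _).norm.natAbs < y.norm.natAbs
      simpa [hy] using this
    mul_left_not_lt := fun a b hb => by
      have := norm_ne_zero_Z2 hb
      have h2 : 1 ≤ b.norm.natAbs := by omega
      have h3 := Nat.mul_le_mul_left a.norm.natAbs h2
      change ¬ ((a * b).norm.natAbs < a.norm.natAbs)
      rw [Zsqrtd.norm_mul, Int.natAbs_mul]
      omega }

instance pidZ2 : IsPrincipalIdealRing (ℤ√2) :=
  @EuclideanDomain.to_principal_ideal_domain _ euclZ2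

lemma exists_conj : ∃ c : Qsqrt2 →+* Qsqrt2, c sq2 = -sq2 := by
  have hirr : Irreducible (Polynomial.X ^ 2 - Polynomial.C (2 : ℚ)) := by
    apply X_pow_sub_C_irreducible_of_prime Nat.prime_two
    intro b hb
    have h : IsSquare ((2 : ℤ) : ℚ) := ⟨b, by push_cast; rw [← hb]; ring⟩
    rw [Rat.isSquare_intCast_iff] at h
    obtain ⟨n, hn⟩ := h
    exact two_nonsq n hn
  have hmin : Polynomial.X ^ 2 - Polynomial.C (2 : ℚ) = minpoly ℚ (Real.sqrt 2) :=
    minpoly.eq_of_irreducible_of_monic hirr (by simp)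
      (Polynomial.monic_X_pow_sub_C _ (by norm_num))
  have hint : IsIntegral ℚ (Real.sqrt 2) := by
    refine ⟨Polynomial.X ^ 2 - Polynomial.C (2 : ℚ),
      Polynomial.monic_X_pow_sub_C _ (by norm_num), by simp⟩
  have hroot : (-sq2) ∈ (minpoly ℚ (Real.sqrt 2)).aroots Qsqrt2 := by
    rw [Polynomial.mem_aroots]
    refine ⟨minpoly.ne_zero hint, ?_⟩
    rw [← hmin]
    simp [sq, sq2_mul_self]
  exact ⟨((algHomAdjoinIntegralEquiv ℚ hint).symm ⟨-sq2, hroot⟩).toRingHom,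
    algHomAdjoinIntegralEquiv_symm_apply_gen ℚ hint ⟨-sq2, hroot⟩⟩

lemma conj_emb (c : Qsqrt2 →+* Qsqrt2) (hc : c sq2 = -sq2) (x : ℤ√2) :
    c (emb x) = emb (star x) := by
  simp [emb_apply, hc]

/-- Units of norm one are squares up to sign. -/
lemma unit_norm_one (x : ℤ√2) (hx : x.norm = 1) :
    ∃ z : Qsqrt2, z ≠ 0 ∧ (emb x = z ^ 2 ∨ emb x = - z ^ 2) := by
  let f : Pell.Solution₁ 2 := Pell.Solution₁.mk 3 2 (by norm_num)
  have hf : Pell.IsFundamental f := by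
    refine ⟨by simp [f], by simp [f], ?_⟩
    intro b hb
    simp only [f, Pell.Solution₁.x_mk]
    by_contra hlt
    have h2 : b.x = 2 := by omega
    have := b.prop
    rw [h2] at this
    omega
  let X : Pell.Solution₁ 2 := ⟨x, Zsqrtd.norm_eq_one_iff_mem_unitary.1 hx⟩
  obtain ⟨n, hn⟩ := hf.eq_zpow_or_neg_zpow X
  let φ : Pell.Solution₁ 2 →* Qsqrt2 :=
    (emb : ℤ√2 →* Qsqrt2).comp (unitary (ℤ√2)).subtype
  have hφf : φ f = (1 + sq2) ^ 2 := by
    have : φ f = (3 : Qsqrt2) + 2 * sq2 := by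
      change emb ⟨3, 2⟩ = _
      simp [emb_apply]
    rw [this]
    linear_combination -sq2_mul_self
  have hφX : φ X = emb x := rfl
  have hne : (1 + sq2) ≠ 0 := by
    intro h
    have h1 : (sq2 - 1) * (1 + sq2) = 1 := by linear_combination sq2_mul_self
    rw [h] at h1
    simp at h1
  have hpow : φ (f ^ n) = ((1 + sq2) ^ n) ^ 2 := by
    have : φ (f ^ n) = (φ f) ^ n := map_zpow' φ (fun a => by
      apply eq_inv_of_mul_eq_one_left
      rw [← map_mul]; simp) f n
    rw [this, hφf, ← zpow_natCast, ← zpow_natCast, ← zpow_mul, ← zpow_mul, mul_comm]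
  refine ⟨(1 + sq2) ^ n, zpow_ne_zero _ hne, ?_⟩
  rcases hn with hn | hn
  · left; rw [← hφX, hn, hpow]
  · right
    rw [← hφX, hn, ← hpow]
    change emb (- ((f ^ n : Pell.Solution₁ 2) : ℤ√2)) = _
    rw [map_neg]; rfl

lemma norm_prime_split (D : ℤ) (hD : Prime D) (hD3 : 3 < D) (A : ℤ√2) (w : ℤ)
    (hA : IsCoprime A.re A.im) (hN : A.norm = D * w ^ 2) :
    ∃ p : ℤ√2, p.norm = D := by
  have hnp : ¬ Prime (D : ℤ√2) := by
    intro hp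
    have hdvd : (D : ℤ√2) ∣ A * star A := by
      rw [← Zsqrtd.norm_eq_mul_conj, hN]
      exact ⟨(w : ℤ√2) ^ 2, by push_cast; ring⟩
    have : D ∣ A.re ∧ D ∣ A.im := by
      rcases hp.dvd_or_dvd hdvd with h | h
      · exact (Zsqrtd.intCast_dvd _ _).1 h
      · simpa using (Zsqrtd.intCast_dvd _ _).1 h
    exact hD.not_isUnit (hA.isUnit_of_dvd' this.1 this.2)
  rw [← irreducible_iff_prime] at hnp
  have hDn : D.natAbs.Prime := Int.prime_iff_natAbs_prime.1 hD
  have hu : ¬ IsUnit (D : ℤ√2) := by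
    rw [← Zsqrtd.norm_eq_one_iff, Zsqrtd.norm_intCast, Int.natAbs_mul]
    intro h
    have := Nat.eq_one_of_mul_eq_one_right h
    omega
  have hab : ∃ a b, (D : ℤ√2) = a * b ∧ ¬IsUnit a ∧ ¬IsUnit b := by
    simpa [irreducible_iff, hu, not_forall, not_or] using hnp
  obtain ⟨a, b, hab, ha, hb⟩ := hab
  have hn : a.norm.natAbs = D.natAbs :=
    ((hDn.mul_eq_prime_sq_iff (mt Zsqrtd.norm_eq_one_iff.1 ha)
      (mt Zsqrtd.norm_eq_one_iff.1 hb)).1 (by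
        rw [← Int.natAbs_mul, ← Zsqrtd.norm_mul, ← hab, Zsqrtd.norm_intCast, Int.natAbs_mul, sq])).1
  rcases Int.natAbs_eq_natAbs_iff.1 hn with h | h
  · exact ⟨a, h⟩
  · refine ⟨a * ⟨1, 1⟩, ?_⟩
    rw [Zsqrtd.norm_mul, h]
    simp [Zsqrtd.norm_def]

lemma class_of_dvd (D : ℤ) (hD : Prime D) (A p : ℤ√2) (w : ℤ)
    (hA : IsCoprime A (star A)) (hN : A.norm = D * w ^ 2) (hp : p.norm = D) (hpA : p ∣ A) :
    ∃ z : Qsqrt2, z ≠ 0 ∧ (emb A = emb p * z ^ 2 ∨ emb A = - emb p * z ^ 2) := by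
  obtain ⟨C, rfl⟩ := hpA
  have hC : C.norm = w ^ 2 := by
    rw [Zsqrtd.norm_mul, hp] at hN
    exact mul_left_cancel₀ hD.ne_zero hN
  have hCs : C * star C = (w : ℤ√2) ^ 2 := by
    rw [← Zsqrtd.norm_eq_mul_conj, hC]; push_cast; rfl
  have hcop : IsCoprime C (star C) := by
    rw [star_mul'] at hA
    exact hA.of_mul_left_right.of_mul_right_right
  obtain ⟨s, u, hs⟩ := exists_associated_pow_of_mul_eq_pow' hcop hCs
  have hC0 : C ≠ 0 := by
    rintro rfl
    rw [star_zero] at hcop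
    exact not_isCoprime_zero_zero hcop
  have hs0 : s ≠ 0 := by
    rintro rfl
    apply hC0
    rw [← hs]; simp
  have hu1 : (u : ℤ√2).norm = 1 := by
    have h1 : IsUnit (u : ℤ√2).norm := (Zsqrtd.isUnit_iff_norm_isUnit _).1 u.isUnit
    rcases Int.isUnit_iff.1 h1 with h | h
    · exact h
    · exfalso
      have h2 : s.norm ^ 2 * (u : ℤ√2).norm = w ^ 2 := by
        rw [← hC, ← hs, Zsqrtd.norm_mul, sq, sq, Zsqrtd.norm_mul]
      have h3 := norm_ne_zero_Z2 hs0
      rw [h] at h2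
      have : 0 < s.norm ^ 2 := by positivity
      nlinarith [sq_nonneg w]
  obtain ⟨z, hz0, hz⟩ := unit_norm_one _ hu1
  have hes : emb s ≠ 0 := (map_ne_zero_iff emb emb_inj).2 hs0
  refine ⟨emb s * z, mul_ne_zero hes hz0, ?_⟩
  rw [← hs, map_mul, map_mul, map_pow]
  rcases hz with hz | hz
  · left; rw [hz]; ring
  · right; rw [hz]; ring

lemma class_of_norm (D : ℤ) (hD : Prime D) (A p : ℤ√2) (w : ℤ)
    (hA : IsCoprime A (star A)) (hN : A.norm = D * w ^ 2) (hp : p.norm = D) :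
    ∃ z : Qsqrt2, z ≠ 0 ∧ (emb A = emb p * z ^ 2 ∨ emb A = - emb p * z ^ 2 ∨
      emb A = emb (star p) * z ^ 2 ∨ emb A = - emb (star p) * z ^ 2) := by
  have hpp : Prime p := by
    rw [← irreducible_iff_prime]
    have hDi := hD.irreducible
    rw [← hp] at hDi
    refine ⟨fun h => hDi.not_isUnit ((Zsqrtd.isUnit_iff_norm_isUnit _).1 h), fun a b hab => ?_⟩
    rw [hab, Zsqrtd.norm_mul] at hDi
    rcases hDi.isUnit_or_isUnit rfl with h | h
    · exact Or.inl ((Zsqrtd.isUnit_iff_norm_isUnit _).2 h)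
    · exact Or.inr ((Zsqrtd.isUnit_iff_norm_isUnit _).2 h)
  have hdvd : p ∣ A * star A := by
    rw [← Zsqrtd.norm_eq_mul_conj, hN, ← hp]
    push_cast
    rw [Zsqrtd.norm_eq_mul_conj, mul_assoc]
    exact dvd_mul_of_dvd_left (dvd_mul_right _ _) _ |>.trans (by rw [mul_assoc])
  rcases hpp.dvd_or_dvd hdvd with h | h
  · obtain ⟨z, h0, h1⟩ := class_of_dvd D hD A p w hA hN hp h
    exact ⟨z, h0, by tauto⟩
  · have h' : star p ∣ A := by
      obtain ⟨c, hc⟩ := h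
      refine ⟨star c, ?_⟩
      rw [← star_mul', ← hc, star_star]
    obtain ⟨z, h0, h1⟩ := class_of_dvd D hD A (star p) w hA hN (by rw [Zsqrtd.norm_conj, hp]) h'
    exact ⟨z, h0, by tauto⟩

lemma point_to_norm (D : ℤ) (hD : Prime D) (hD3 : 3 < D) (t X : ℚ)
    (h : (D : ℚ) * X ^ 2 = qQuartic t) :
    ∃ (A : ℤ√2) (w : ℤ) (z : Qsqrt2), IsCoprime A.re A.im ∧ IsCoprime A (star A) ∧
      A.norm = D * w ^ 2 ∧ z ≠ 0 ∧ q1 (t : Qsqrt2) = emb A * z ^ 2 := by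
  obtain ⟨m, n, hn, hmn, rfl⟩ : ∃ m n : ℤ, n ≠ 0 ∧ IsCoprime m n ∧ t = m / n :=
    ⟨t.num, t.den, by exact_mod_cast t.den_nz, by
      rw [Int.isCoprime_iff_nat_coprime]; simpa using t.reduced, by
      push_cast; exact (Rat.num_div_den t).symm⟩
  have hnQ : (n : ℚ) ≠ 0 := by exact_mod_cast hn
  obtain ⟨u, hu⟩ : ∃ u : ℤ, u = m ^ 2 - 4 * m * n - 3 * n ^ 2 := ⟨_, rfl⟩
  obtain ⟨v, hv⟩ : ∃ v : ℤ, v = -2 * m * n - 2 * n ^ 2 := ⟨_, rfl⟩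
  have hg4 : (Int.gcd u v : ℤ) ∣ 4 := by
    have gu : (Int.gcd u v : ℤ) ∣ u := Int.gcd_dvd_left _ _
    have gv : (Int.gcd u v : ℤ) ∣ v := Int.gcd_dvd_right _ _
    have hun : IsCoprime u n := by
      have : u = m ^ 2 + n * (-4 * m - 3 * n) := by rw [hu]; ring
      rw [this]
      exact (IsCoprime.pow_left hmn).add_mul_left_left _
    have hgn : IsCoprime (Int.gcd u v : ℤ) n := hun.of_isCoprime_of_dvd_left gu
    have h1 : (Int.gcd u v : ℤ) ∣ 2 * (m + n) := by
      apply hgn.dvd_of_dvd_mul_left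
      have : n * (2 * (m + n)) = -v := by rw [hv]; ring
      rw [this]; exact (dvd_neg).2 gv
    have h2 : (Int.gcd u v : ℤ) ∣ n ^ 2 * 4 := by
      have : n ^ 2 * 4 = 2 * u - 2 * (m + n) * (m - 5 * n) := by rw [hu]; ring
      rw [this]
      exact dvd_sub (dvd_mul_of_dvd_right gu _) (dvd_mul_of_dvd_left h1 _)
    exact (IsCoprime.pow_right hgn).dvd_of_dvd_mul_left h2
  have hgpos : 0 < Int.gcd u v := by
    rcases Nat.eq_zero_or_pos (Int.gcd u v) with h0 | h0
    · rw [h0] at hg4; norm_num at hg4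
    · exact h0
  obtain ⟨u', v', hcop0, hu', hv'⟩ := Int.exists_gcd_one hgpos
  have hcop : IsCoprime u' v' := Int.isCoprime_iff_gcd_eq_one.2 hcop0
  set g : ℕ := Int.gcd u v with hg
  have hg0 : (g : ℚ) ≠ 0 := by positivity
  -- integrality
  obtain ⟨w, hw⟩ : ∃ w : ℤ, u' ^ 2 - 2 * v' ^ 2 = D * w ^ 2 := by
    have e1 : ((u : ℚ) ^ 2 - 2 * (v : ℚ) ^ 2) = D * (X * n ^ 2) ^ 2 := by
      have : (D : ℚ) * (X * n ^ 2) ^ 2 = (D * X ^ 2) * n ^ 4 := by ring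
      rw [this, h, qQuartic, hu, hv]
      push_cast
      field_simp
      ring
    have e2 : ((u' : ℚ) ^ 2 - 2 * (v' : ℚ) ^ 2) = D * (X * n ^ 2 / g) ^ 2 := by
      rw [hu', hv'] at e1
      push_cast at e1
      field_simp
      linear_combination e1
    have hsq : IsSquare ((D * (u' ^ 2 - 2 * v' ^ 2) : ℤ) : ℚ) :=
      ⟨D * (X * n ^ 2 / g), by push_cast; rw [e2]; ring⟩
    rw [Rat.isSquare_intCast_iff] at hsq
    obtain ⟨k, hk⟩ := hsq
    have hDk : D ∣ k := by
      have : D ∣ k * k := ⟨_, hk.symm⟩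
      rcases hD.dvd_or_dvd this with h | h <;> exact h
    obtain ⟨l, rfl⟩ := hDk
    refine ⟨l, mul_left_cancel₀ hD.ne_zero ?_⟩
    rw [hk]; ring
  have hDodd : Odd D := by
    have hDn : D.natAbs.Prime := Int.prime_iff_natAbs_prime.1 hD
    have := hDn.eq_two_or_odd'
    rcases this with h | h
    · omega
    · exact Int.natAbs_odd.1 h
  have hu'odd : Odd u' := by
    by_contra hne
    rw [Int.not_odd_iff_even] at hne
    have hweven : Even w := by
      by_contra hwo
      rw [Int.not_even_iff_odd] at hwo
      have h1 : Odd (D * w ^ 2) := hDodd.mul hwo.pow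
      rw [← hw] at h1
      have h2 : Even (u' ^ 2 - 2 * v' ^ 2) :=
        (hne.pow_of_ne_zero (by norm_num)).sub (even_two_mul _)
      exact (Int.not_even_iff_odd.2 h1) h2
    have hveven : Even v' := by
      by_contra hvo
      rw [Int.not_even_iff_odd] at hvo
      obtain ⟨a, rfl⟩ := hne
      obtain ⟨b, rfl⟩ := hweven
      obtain ⟨c, rfl⟩ := hvo
      have : 2 * (2 * a ^ 2 - 4 * c ^ 2 - 4 * c - 2 * D * b ^ 2) = 2 := by linear_combination hw
      have : 2 * (a ^ 2 - 2 * c ^ 2 - 2 * c - D * b ^ 2) = 1 := by linarith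
      omega
    have := hcop.isUnit_of_dvd' hne.two_dvd hveven.two_dvd
    rw [Int.isUnit_iff] at this
    omega
  have hNodd : IsCoprime (4 : ℤ) (u' ^ 2 - 2 * v' ^ 2) := by
    have : Odd (u' ^ 2 - 2 * v' ^ 2) := hu'odd.pow.sub_even (even_two_mul _)
    have h2 : IsCoprime (2 : ℤ) (u' ^ 2 - 2 * v' ^ 2) := by
      obtain ⟨k, hk⟩ := this
      exact ⟨-k, 1, by rw [hk]; ring⟩
    have := IsCoprime.pow_left (m := 2) h2
    norm_num at this
    exact this
  obtain ⟨z, hz0, hz⟩ : ∃ z : Qsqrt2, z ≠ 0 ∧ (g : Qsqrt2) = z ^ 2 := by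
    have hg4' : g ∣ 4 := by exact_mod_cast hg4
    have hle : g ≤ 4 := Nat.le_of_dvd (by norm_num) hg4'
    have hs0 : sq2 ≠ 0 := by
      intro h
      have := sq2_mul_self
      rw [h] at this
      simp at this
    have : g = 1 ∨ g = 2 ∨ g = 4 := by
      clear_value g
      interval_cases g <;> omega
    rcases this with h | h | h <;> rw [h]
    · exact ⟨1, one_ne_zero, by norm_num⟩
    · exact ⟨sq2, hs0, by push_cast; rw [sq, sq2_mul_self]⟩
    · exact ⟨2, two_ne_zero, by norm_num⟩
  have hnK : (n : Qsqrt2) ≠ 0 := by exact_mod_cast hn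
  refine ⟨⟨u', v'⟩, w, z / n, hcop, ?_, ?_, div_ne_zero hz0 hnK, ?_⟩
  · obtain ⟨a, b, hab⟩ := hNodd
    obtain ⟨c, d, hcd⟩ := hcop
    -- `1 = a * 4 * (c u' + d v') + b N`
    refine ⟨⟨2 * a * c, a * d⟩ + (b : ℤ√2) * star ⟨u', v'⟩,
      ⟨2 * a * c, -(a * d)⟩, ?_⟩
    ext
    · simp
      linear_combination hab + 4 * a * hcd
    · simp
      ring
  · rw [← hw, Zsqrtd.norm_def]; ring
  · have h1 : (u : Qsqrt2) = u' * g := by rw [hu']; push_cast; rfl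
    have h2 : (v : Qsqrt2) = v' * g := by rw [hv']; push_cast; rfl
    rw [div_pow, ← hz, emb_apply, q1]
    have h3 : ((u' : Qsqrt2) + v' * sq2) * (g / n ^ 2) = (u + v * sq2) / n ^ 2 := by
      rw [h1, h2]; ring
    rw [h3, hu, hv]
    push_cast
    field_simp
    ring

/-- **Four square classes suffice to cover the rational points of `F_D⁽⁴⁾`.**
Let `D > 3` be prime, and suppose the curve `F : D·X₃² = q(t)` has a rational point. Let
`α = a + b√2 ∈ ℤ[√2]` be such that `q₁(t₀)/α` is a square in `K = ℚ(√2)` for some rational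
point `(t₀, X₃)` of `F`. Then for every rational point `(t, X₃)` of `F`, the value
`q₁(t) ∈ K` lies in one of the classes `α·(K*)²`, `ᾱ·(K*)²`, `(−α)·(K*)²`, `(−ᾱ)·(K*)²`. -/
theorem four_twists_cover_F4_rational_points
    (D : ℤ) (hD : Prime D) (hD3 : 3 < D)
    (a b : ℤ)
    (hα : ∃ t₀ X₃ : ℚ, (D : ℚ) * X₃ ^ 2 = qQuartic t₀ ∧
      ∃ z : Qsqrt2, q1 (t₀ : Qsqrt2) = ((a : Qsqrt2) + (b : Qsqrt2) * sq2) * z ^ 2) :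
    ∀ t X₃ : ℚ, (D : ℚ) * X₃ ^ 2 = qQuartic t →
      (∃ z : Qsqrt2, z ≠ 0 ∧ q1 (t : Qsqrt2) = ((a : Qsqrt2) + (b : Qsqrt2) * sq2) * z ^ 2) ∨
      (∃ z : Qsqrt2, z ≠ 0 ∧ q1 (t : Qsqrt2) = ((a : Qsqrt2) - (b : Qsqrt2) * sq2) * z ^ 2) ∨
      (∃ z : Qsqrt2, z ≠ 0 ∧ q1 (t : Qsqrt2) = -((a : Qsqrt2) + (b : Qsqrt2) * sq2) * z ^ 2) ∨
      (∃ z : Qsqrt2, z ≠ 0 ∧ q1 (t : Qsqrt2) = -((a : Qsqrt2) - (b : Qsqrt2) * sq2) * z ^ 2) := by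
  obtain ⟨t₀, X₀, h0, z0, hz0⟩ := hα
  intro t X h
  obtain ⟨A, w, y, hAc, hA, hN, hy, hAq⟩ := point_to_norm D hD hD3 t X h
  obtain ⟨B, w', y', hBc, hB, hN', hy', hBq⟩ := point_to_norm D hD hD3 t₀ X₀ h0
  obtain ⟨p, hp⟩ := norm_prime_split D hD hD3 A w hAc hN
  obtain ⟨c, hc⟩ := exists_conj
  obtain ⟨x, hx, hx'⟩ := class_of_norm D hD A p w hA hN hp
  obtain ⟨r, hr, hr'⟩ := class_of_norm D hD B p w' hB hN' hp
  have hB0 : emb B ≠ 0 := by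
    rw [map_ne_zero_iff emb emb_inj]
    rintro rfl
    rw [star_zero] at hB
    exact not_isCoprime_zero_zero hB
  have hz : z0 ≠ 0 := by
    rintro rfl
    rw [hBq] at hz0
    have : emb B * y' ^ 2 ≠ 0 := mul_ne_zero hB0 (pow_ne_zero _ hy')
    apply this
    rw [hz0]; ring
  have hab : emb ⟨a, b⟩ = (a : Qsqrt2) + (b : Qsqrt2) * sq2 := rfl
  have hab' : emb (star ⟨a, b⟩) = (a : Qsqrt2) - (b : Qsqrt2) * sq2 := by
    simp [emb_apply, sub_eq_add_neg]
  rw [← hab] at hz0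
  rw [← hab, ← hab', hAq]
  have e1 : emb ⟨a, b⟩ = emb B * (y' / z0) ^ 2 := by
    rw [hBq] at hz0
    field_simp
    exact hz0.symm
  -- `α = ± emb p₁ * s²`
  set s := r * (y' / z0) with hs
  have hs0 : s ≠ 0 := mul_ne_zero hr (div_ne_zero hy' hz)
  have hcs0 : c s ≠ 0 := (map_ne_zero c).2 hs0
  obtain ⟨e, p₁, he, hp₁, hα₁⟩ : ∃ (e : Qsqrt2) (p₁ : ℤ√2), (e = 1 ∨ e = -1) ∧
      (p₁ = p ∨ p₁ = star p) ∧ emb ⟨a, b⟩ = e * emb p₁ * s ^ 2 := by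
    rcases hr' with h | h | h | h
    · exact ⟨1, p, by simp, by simp, by rw [e1, h, hs]; ring⟩
    · exact ⟨-1, p, by simp, by simp, by rw [e1, h, hs]; ring⟩
    · exact ⟨1, star p, by simp, by simp, by rw [e1, h, hs]; ring⟩
    · exact ⟨-1, star p, by simp, by simp, by rw [e1, h, hs]; ring⟩
  have hα₂ : emb (star ⟨a, b⟩) = e * emb (star p₁) * (c s) ^ 2 := by
    rw [← conj_emb c hc, hα₁, map_mul, map_mul, map_pow, conj_emb c hc]
    rcases he with rfl | rfl <;> simp
  obtain ⟨e', p₂, he', hp₂, hA₁⟩ : ∃ (e' : Qsqrt2) (p₂ : ℤ√2), (e' = 1 ∨ e' = -1) ∧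
      (p₂ = p₁ ∨ p₂ = star p₁) ∧ emb A = e' * emb p₂ * x ^ 2 := by
    have hpc : ∀ p₂ : ℤ√2, (p₂ = p ∨ p₂ = star p) → (p₂ = p₁ ∨ p₂ = star p₁) := by
      rintro p₂ (rfl | rfl) <;> rcases hp₁ with rfl | rfl <;> simp
    rcases hx' with h | h | h | h
    · exact ⟨1, p, by simp, hpc _ (by simp), by rw [h]; ring⟩
    · exact ⟨-1, p, by simp, hpc _ (by simp), by rw [h]; ring⟩
    · exact ⟨1, star p, by simp, hpc _ (by simp), by rw [h]; ring⟩
    · exact ⟨-1, star p, by simp, hpc _ (by simp), by rw [h]; ring⟩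
  have hne1 : x * y / s ≠ 0 := div_ne_zero (mul_ne_zero hx hy) hs0
  have hne2 : x * y / c s ≠ 0 := div_ne_zero (mul_ne_zero hx hy) hcs0
  rw [hA₁, hα₁, hα₂]
  have key : ∀ (P S : Qsqrt2), S ≠ 0 → P * S ^ 2 * (x * y / S) ^ 2 = P * x ^ 2 * y ^ 2 := by
    intro P S hS
    field_simp
  have k1 := key (emb p₁) s hs0
  have k2 := key (emb (star p₁)) (c s) hcs0
  rcases hp₂ with rfl | rfl
  · rcases he with rfl | rfl <;> rcases he' with rfl | rfl
    · exact Or.inl ⟨_, hne1, by linear_combination -k1⟩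
    · exact Or.inr (Or.inr (Or.inl ⟨_, hne1, by linear_combination k1⟩))
    · exact Or.inr (Or.inr (Or.inl ⟨_, hne1, by linear_combination -k1⟩))
    · exact Or.inl ⟨_, hne1, by linear_combination k1⟩
  · rcases he with rfl | rfl <;> rcases he' with rfl | rfl
    · exact Or.inr (Or.inl ⟨_, hne2, by linear_combination -k2⟩)
    · exact Or.inr (Or.inr (Or.inr ⟨_, hne2, by linear_combination k2⟩))
    · exact Or.inr (Or.inr (Or.inr ⟨_, hne2, by linear_combination -k2⟩))
    · exact Or.inr (Or.inl ⟨_, hne2, by linear_combination k2⟩)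
end

section
/- Let K be a field of characteristic zero containing an element s with s² = 2, and let δ ∈ K, δ ≠ 0. Set q₁(t) = t² − (4 + 2s)t − 3 − 2s and p(t) = t⁴ − 12t³ + 2t² + 12t + 1. If (t, W) ∈ K² satisfies δ·W² = q₁(t)·p(t) and t ≠ s − 1, then the pair (x, y) = ( −2(−3 + 2s)·q₁(t)/(t − s + 1)², 3(−4 + 3s)·W/(t − s + 1)³ ) satisfies δ·y² = x³ + 5s·x² − x. (This defines a non-constant morphism from the genus-2 curve H_δ : δW² = q₁(t)p(t) to the elliptic curve E_δ : δy² = x³ + 5√2·x² − x over ℚ(√2).) -/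
/-- **The morphism from the genus-2 curve `H_δ` to the elliptic curve `E_δ`.**
Let `K` be a field of characteristic zero containing `s` with `s² = 2` and let `δ ≠ 0`.
If `(t, W)` satisfies `δ·W² = q₁(t)·p(t)` with `q₁(t) = t² − (4+2s)t − 3 − 2s` and
`p(t) = t⁴ − 12t³ + 2t² + 12t + 1`, and `t ≠ s − 1`, then
`(x, y) = (−2(−3+2s)q₁(t)/(t−s+1)², 3(−4+3s)W/(t−s+1)³)` satisfies `δ·y² = x³ + 5s·x² − x`. -/
theorem genus2_to_elliptic_morphism
    (K : Type*) [Field K] [CharZero K] (s : K) (hs : s ^ 2 = 2)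
    (δ : K) (hδ : δ ≠ 0) (t W : K)
    (h : δ * W ^ 2 =
      (t ^ 2 - (4 + 2 * s) * t - 3 - 2 * s) *
        (t ^ 4 - 12 * t ^ 3 + 2 * t ^ 2 + 12 * t + 1))
    (ht : t ≠ s - 1) :
    δ * (3 * (-4 + 3 * s) * W / (t - s + 1) ^ 3) ^ 2 =
      (-2 * (-3 + 2 * s) * (t ^ 2 - (4 + 2 * s) * t - 3 - 2 * s) / (t - s + 1) ^ 2) ^ 3 +
        5 * s * (-2 * (-3 + 2 * s) * (t ^ 2 - (4 + 2 * s) * t - 3 - 2 * s) / (t - s + 1) ^ 2) ^ 2 -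
        (-2 * (-3 + 2 * s) * (t ^ 2 - (4 + 2 * s) * t - 3 - 2 * s) / (t - s + 1) ^ 2) := by
  have hd : t - s + 1 ≠ 0 := fun h0 => ht (by linear_combination h0)
  have key : 9 * (-4 + 3 * s) ^ 2 * (t ^ 4 - 12 * t ^ 3 + 2 * t ^ 2 + 12 * t + 1) =
      (-2 * (-3 + 2 * s)) ^ 3 * (t ^ 2 - (4 + 2 * s) * t - 3 - 2 * s) ^ 2 +
      5 * s * (-2 * (-3 + 2 * s)) ^ 2 * (t ^ 2 - (4 + 2 * s) * t - 3 - 2 * s) * (t - s + 1) ^ 2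
      - (-2 * (-3 + 2 * s)) * (t - s + 1) ^ 4 := by
    clear h ht hd
    grind
  generalize t ^ 2 - (4 + 2 * s) * t - 3 - 2 * s = q at *
  generalize t ^ 4 - 12 * t ^ 3 + 2 * t ^ 2 + 12 * t + 1 = p at *
  generalize t - s + 1 = d at *
  generalize -2 * (-3 + 2 * s) = c at *
  generalize -4 + 3 * s = e at *
  have e1 : δ * (3 * e * W / d ^ 3) ^ 2 = 9 * e ^ 2 * (δ * W ^ 2) / d ^ 6 := by
    field_simp
    ring
  have e2 : (c * q / d ^ 2) ^ 3 + 5 * s * (c * q / d ^ 2) ^ 2 - c * q / d ^ 2 =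
      q * (c ^ 3 * q ^ 2 + 5 * s * c ^ 2 * q * d ^ 2 - c * d ^ 4) / d ^ 6 := by
    field_simp
  rw [e1, e2, h, ← key]
  ring
end
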